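/- Let N ≥ 3, μ ∈ (0, μ₀) with μ₀ = (N-2)²/4, and let V ∈ C^γ_loc(ℝ^N∖{0}) (γ ∈ (0,1)) be a positive potential satisfying |x|^{-2} - c₅ ≤ V(x) ≤ |x|^{-2} for all x ∈ ℝ^N∖{0}, for some c₅ > 0. Then for every k > 0 there exists a positive classical solution u_k of -Δu - μVu = 0 in ℝ^N∖{0} satisfying the dμ-distributional identity with constant k, minimal among all positive classical solutions satisfying that identity with the same k, and moreover lim_{x→0} u_k(x)|x|^{-τ₋(μ)} = k. -/

import Mathlib

open Filter MeasureTheory Metric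

noncomputable section

/-- Euclidean space ℝ^N. -/
abbrev Euc (N : ℕ) : Type := EuclideanSpace ℝ (Fin N)

/-- The Laplacian of `u` at `x`, as the sum of the pure second derivatives in the
coordinate directions. -/
def lap {N : ℕ} (u : Euc N → ℝ) (x : Euc N) : ℝ :=
  ∑ i : Fin N, fderiv ℝ (fun y => fderiv ℝ u y (EuclideanSpace.single i 1)) x
    (EuclideanSpace.single i 1)

/-- μ₀ = (N-2)²/4. -/
def mu0 (N : ℕ) : ℝ := ((N : ℝ) - 2) ^ 2 / 4

/-- τ₋(μ) = -(N-2)/2 - √(μ₀-μ). -/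
def tauMinus (N : ℕ) (μ : ℝ) : ℝ := -((N : ℝ) - 2) / 2 - Real.sqrt (mu0 N - μ)

/-- τ₊(μ) = -(N-2)/2 + √(μ₀-μ). -/
def tauPlus (N : ℕ) (μ : ℝ) : ℝ := -((N : ℝ) - 2) / 2 + Real.sqrt (mu0 N - μ)

/-- Surface area of the unit sphere in ℝ^N, i.e. N times the volume of the unit ball. -/
def sphereArea (N : ℕ) : ℝ := N * (volume (ball (0 : Euc N) 1)).toReal

/-- The normalizing constant c_μ: 2√(μ₀-μ)|𝕊^{N-1}| for μ < μ₀ and |𝕊^{N-1}| for μ = μ₀. -/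
def cMu (N : ℕ) (μ : ℝ) : ℝ :=
  if μ < mu0 N then 2 * Real.sqrt (mu0 N - μ) * sphereArea N else sphereArea N

/-- The normalizing constant c_N = ((N-2)|𝕊^{N-1}|)⁻¹ of the fundamental solution of -Δ. -/
def cN (N : ℕ) : ℝ := (((N : ℝ) - 2) * sphereArea N)⁻¹

/-- The singular profile Φ_μ: |x|^{τ₋(μ)} for μ < μ₀ and |x|^{-(N-2)/2}(-ln|x|) for μ = μ₀. -/
def PhiFun (N : ℕ) (μ : ℝ) (x : Euc N) : ℝ :=
  if μ < mu0 N then ‖x‖ ^ tauMinus N μ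
  else ‖x‖ ^ (-((N : ℝ) - 2) / 2) * (-Real.log ‖x‖)

/-- The adjoint operator L*_μ ξ(x) = -Δξ(x) - 2τ₊(μ)|x|⁻² x·∇ξ(x). -/
def LstarMu (N : ℕ) (μ : ℝ) (ξ : Euc N → ℝ) (x : Euc N) : ℝ :=
  -lap ξ x - 2 * tauPlus N μ / ‖x‖ ^ 2 * fderiv ℝ ξ x x

/-- The adjoint operator L*_{μV} ξ = L*_μ ξ - μ(V - |x|⁻²)ξ. -/
def LstarMuV (N : ℕ) (μ : ℝ) (V ξ : Euc N → ℝ) (x : Euc N) : ℝ :=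
  LstarMu N μ ξ x - μ * (V x - ‖x‖ ^ (-2 : ℝ)) * ξ x

/-- A compactly supported C^{1,1} test function: compactly supported, differentiable,
with Lipschitz gradient. -/
def IsC11c {N : ℕ} (ξ : Euc N → ℝ) : Prop :=
  HasCompactSupport ξ ∧ Differentiable ℝ ξ ∧ ∃ L : NNReal, LipschitzWith L (fderiv ℝ ξ)

/-- The dμ-distributional identity with constant `k`. -/
def DistribIdentity (N : ℕ) (μ : ℝ) (V u : Euc N → ℝ) (k : ℝ) : Prop :=
  ∀ ξ : Euc N → ℝ, IsC11c ξ →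
    ∫ x : Euc N, u x * LstarMuV N μ V ξ x * ‖x‖ ^ tauPlus N μ = cMu N μ * k * ξ 0

/-- `u` is a classical solution of -Δu - μVu = 0 in ℝ^N∖{0}. -/
def IsSolution (N : ℕ) (μ : ℝ) (V u : Euc N → ℝ) : Prop :=
  ContDiffOn ℝ 2 u {x : Euc N | x ≠ 0} ∧
  ∀ x : Euc N, x ≠ 0 → -lap u x - μ * V x * u x = 0

/-- `f` is locally γ-Hölder continuous on `s`. -/
def LocHolderOn {N : ℕ} (γ : ℝ) (s : Set (Euc N)) (f : Euc N → ℝ) : Prop :=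
  ∀ x ∈ s, ∃ ε > 0, ∃ C > 0, ∀ y ∈ ball x ε ∩ s, ∀ z ∈ ball x ε ∩ s,
    |f y - f z| ≤ C * dist y z ^ γ

/-- The filter `‖x‖ → +∞` on ℝ^N. -/
def normAtTop (N : ℕ) : Filter (Euc N) := comap norm atTop

/-- Assumption (V): V is locally Hölder and positive on ℝ^N∖{0},
0 ≤ V(x) - |x|⁻² ≤ c₀, and limsup_{|x|→∞} V(x)|x|² = α. -/
def AssumpV (N : ℕ) (V : Euc N → ℝ) (α : ℝ) : Prop :=
  (∃ γ : ℝ, 0 < γ ∧ γ < 1 ∧ LocHolderOn γ {x : Euc N | x ≠ 0} V) ∧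
  (∀ x : Euc N, x ≠ 0 → 0 < V x) ∧
  (∃ c₀ : ℝ, 0 < c₀ ∧ ∀ x : Euc N, x ≠ 0 →
    0 ≤ V x - ‖x‖ ^ (-2 : ℝ) ∧ V x - ‖x‖ ^ (-2 : ℝ) ≤ c₀) ∧
  limsup (fun x : Euc N => V x * ‖x‖ ^ 2) (normAtTop N) = α

/-- Assumption (Ṽ): V is locally Hölder and positive on ℝ^N∖{0},
0 ≤ V(x) - |x|⁻² ≤ c₀, and liminf_{|x|→∞} V(x)|x|² = β. -/
def AssumpVtilde (N : ℕ) (V : Euc N → ℝ) (β : ℝ) : Prop :=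
  (∃ γ : ℝ, 0 < γ ∧ γ < 1 ∧ LocHolderOn γ {x : Euc N | x ≠ 0} V) ∧
  (∀ x : Euc N, x ≠ 0 → 0 < V x) ∧
  (∃ c₀ : ℝ, 0 < c₀ ∧ ∀ x : Euc N, x ≠ 0 →
    0 ≤ V x - ‖x‖ ^ (-2 : ℝ) ∧ V x - ‖x‖ ^ (-2 : ℝ) ≤ c₀) ∧
  liminf (fun x : Euc N => V x * ‖x‖ ^ 2) (normAtTop N) = β

/-- The potential V_ρ(x) = |x|⁻²(1 + ρ|x|²)/(1 + |x|²). -/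
def Vrho (N : ℕ) (ρ : ℝ) (x : Euc N) : ℝ :=
  ‖x‖ ^ (-2 : ℝ) * (1 + ρ * ‖x‖ ^ 2) / (1 + ‖x‖ ^ 2)

/-- Ω has C² boundary: it is the sublevel set of a C² function whose differential
does not vanish on the boundary. -/
def HasC2Boundary {N : ℕ} (Ω : Set (Euc N)) : Prop :=
  ∃ φ : Euc N → ℝ, ContDiff ℝ 2 φ ∧ Ω = {x | φ x < 0} ∧
    ∀ x ∈ frontier Ω, fderiv ℝ φ x ≠ 0

/-- The `i`-th coordinate vector of `Euc N`. -/
abbrev coordVec {N : ℕ} (i : Fin N) : Euc N := EuclideanSpace.single i 1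

/-- The trace of a bilinear form on `Euc N`. -/
def bilinTrace {N : ℕ} (B : Euc N →L[ℝ] Euc N →L[ℝ] ℝ) : ℝ :=
  ∑ i : Fin N, B (coordVec i) (coordVec i)

/-- The inner product of the gradients of `f` and `g` at `x`. -/
def gradDot {N : ℕ} (f g : Euc N → ℝ) (x : Euc N) : ℝ :=
  ∑ i : Fin N, fderiv ℝ f x (coordVec i) * fderiv ℝ g x (coordVec i)

/-- `f` is differentiable near `x` and twice differentiable at `x`. -/
def TwiceDiffAt {N : ℕ} (f : Euc N → ℝ) (x : Euc N) : Prop :=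
  (∀ᶠ y in nhds x, DifferentiableAt ℝ f y) ∧ DifferentiableAt ℝ (fderiv ℝ f) x

theorem continuous_bilinTrace {N : ℕ} :
    Continuous (bilinTrace : (Euc N →L[ℝ] Euc N →L[ℝ] ℝ) → ℝ) := by
  unfold bilinTrace
  fun_prop

theorem lap_eq_bilinTrace {N : ℕ} {u : Euc N → ℝ} {x : Euc N}
    (h : DifferentiableAt ℝ (fderiv ℝ u) x) :
    lap u x = bilinTrace (fderiv ℝ (fderiv ℝ u) x) := by
  unfold lap bilinTrace
  refine Finset.sum_congr rfl fun i _ => ?_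
  rw [fderiv_clm_apply h (differentiableAt_const _)]
  simp

theorem lap_congr {N : ℕ} {u v : Euc N → ℝ} {x : Euc N} (h : u =ᶠ[nhds x] v) :
    lap u x = lap v x := by
  unfold lap
  refine Finset.sum_congr rfl fun i _ => ?_
  have h1 : (fun y => fderiv ℝ u y (EuclideanSpace.single i 1)) =ᶠ[nhds x]
      fun y => fderiv ℝ v y (EuclideanSpace.single i 1) := by
    filter_upwards [h.fderiv (𝕜 := ℝ)] with y hy
    rw [hy]
  rw [h1.fderiv_eq]

theorem ContDiffAt.twiceDiffAt {N : ℕ} {u : Euc N → ℝ} {x : Euc N} (h : ContDiffAt ℝ 2 u x) :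
    TwiceDiffAt u x := by
  refine ⟨?_, ?_⟩
  · filter_upwards [h.eventually (by simp)] with y hy
    exact hy.differentiableAt (by simp)
  · exact (h.fderiv_right (m := 1) (by norm_num)).differentiableAt (by simp)

theorem TwiceDiffAt.differentiableAt {N : ℕ} {u : Euc N → ℝ} {x : Euc N} (h : TwiceDiffAt u x) :
    DifferentiableAt ℝ u x := h.1.self_of_nhds

theorem TwiceDiffAt.apply {N : ℕ} {u : Euc N → ℝ} {x : Euc N} (h : TwiceDiffAt u x) (e : Euc N) :
    DifferentiableAt ℝ (fun y => fderiv ℝ u y e) x :=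
  h.2.clm_apply (differentiableAt_const _)

theorem lap_add {N : ℕ} {f g : Euc N → ℝ} {x : Euc N} (hf : TwiceDiffAt f x)
    (hg : TwiceDiffAt g x) : lap (fun y => f y + g y) x = lap f x + lap g x := by
  unfold lap
  rw [← Finset.sum_add_distrib]
  refine Finset.sum_congr rfl fun i _ => ?_
  have h1 : (fun y => fderiv ℝ (fun y => f y + g y) y (EuclideanSpace.single i 1)) =ᶠ[nhds x]
      fun y => fderiv ℝ f y (EuclideanSpace.single i 1)
        + fderiv ℝ g y (EuclideanSpace.single i 1) := by
    filter_upwards [hf.1, hg.1] with y hy hy2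
    rw [fderiv_fun_add hy hy2]; rfl
  rw [h1.fderiv_eq, fderiv_fun_add (hf.apply _) (hg.apply _)]; rfl

theorem lap_const_mul {N : ℕ} {f : Euc N → ℝ} {x : Euc N} (hf : TwiceDiffAt f x) (c : ℝ) :
    lap (fun y => c * f y) x = c * lap f x := by
  unfold lap
  rw [Finset.mul_sum]
  refine Finset.sum_congr rfl fun i _ => ?_
  have h1 : (fun y => fderiv ℝ (fun y => c * f y) y (EuclideanSpace.single i 1)) =ᶠ[nhds x]
      fun y => c * fderiv ℝ f y (EuclideanSpace.single i 1) := by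
    filter_upwards [hf.1] with y hy
    rw [fderiv_const_mul hy]; rfl
  rw [h1.fderiv_eq, fderiv_const_mul (hf.apply _)]; rfl

theorem TwiceDiffAt.mul {N : ℕ} {f g : Euc N → ℝ} {x : Euc N} (hf : TwiceDiffAt f x)
    (hg : TwiceDiffAt g x) : TwiceDiffAt (fun y => f y * g y) x := by
  refine ⟨?_, ?_⟩
  · filter_upwards [hf.1, hg.1] with y hy hy2
    exact hy.mul hy2
  · have h1 : fderiv ℝ (fun y => f y * g y) =ᶠ[nhds x]
        fun y => f y • fderiv ℝ g y + g y • fderiv ℝ f y := by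
      filter_upwards [hf.1, hg.1] with y hy hy2
      exact fderiv_fun_mul hy hy2
    rw [h1.differentiableAt_iff]
    exact (hf.differentiableAt.smul hg.2).add (hg.differentiableAt.smul hf.2)

theorem lap_comp_smul {N : ℕ} (u : Euc N → ℝ) (c : ℝ) (x : Euc N) :
    lap (fun y => u (c • y)) x = c ^ 2 * lap u (c • x) := by
  unfold lap
  rw [Finset.mul_sum]
  refine Finset.sum_congr rfl fun i _ => ?_
  simp only [fderiv_comp_smul, smul_apply]
  rw [show (fun y => c • fderiv ℝ u (c • y) (EuclideanSpace.single i 1)) =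
    c • fun y => (fun z => fderiv ℝ u z (EuclideanSpace.single i (1:ℝ))) (c • y) from rfl,
    fderiv_const_smul_field, Pi.smul_apply]
  rw [fderiv_comp_smul (f := fun z => fderiv ℝ u z (EuclideanSpace.single i (1:ℝ)))]
  simp [sq, mul_assoc]

theorem hasFDerivAt_comp_norm {N : ℕ} {h : ℝ → ℝ} {h' : ℝ} {x : Euc N} (hx : x ≠ 0)
    (hh : HasDerivAt h h' ‖x‖) :
    HasFDerivAt (fun y : Euc N => h ‖y‖) ((h' / ‖x‖) • innerSL ℝ x) x := by
  have h0 : ‖x‖ ≠ 0 := norm_ne_zero_iff.mpr hx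
  have h1 : HasFDerivAt (fun y : Euc N => Real.sqrt (‖y‖ ^ 2))
      ((1 / (2 * Real.sqrt (‖x‖ ^ 2))) • (2 • innerSL ℝ x)) x :=
    (hasStrictFDerivAt_norm_sq x).hasFDerivAt.sqrt (by positivity)
  simp only [Real.sqrt_sq (norm_nonneg _)] at h1
  have h2 := hh.comp_hasFDerivAt x h1
  refine h2.congr_fderiv ?_
  ext v
  simp
  field_simp

theorem lap_comp_norm {N : ℕ} {h h' : ℝ → ℝ} {h'' : ℝ} {x : Euc N} (hx : x ≠ 0)
    (hh : ∀ᶠ r in nhds ‖x‖, HasDerivAt h (h' r) r) (hh' : HasDerivAt h' h'' ‖x‖) :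
    lap (fun y : Euc N => h ‖y‖) x = h'' + (N - 1) / ‖x‖ * h' ‖x‖ := by
  have h0 : ‖x‖ ≠ 0 := norm_ne_zero_iff.mpr hx
  have e1 : ∀ i : Fin N, fderiv ℝ (fun y => fderiv ℝ (fun y : Euc N => h ‖y‖) y (coordVec i)) x
      (coordVec i) = h' ‖x‖ / ‖x‖ + (h'' * ‖x‖ - h' ‖x‖) / ‖x‖ ^ 3 * (x i) ^ 2 := by
    intro i
    have h1 : (fun y => fderiv ℝ (fun y : Euc N => h ‖y‖) y (coordVec i)) =ᶠ[nhds x]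
        fun y => (h' ‖y‖ / ‖y‖) * y i := by
      filter_upwards [continuous_norm.continuousAt.eventually hh, isOpen_ne.mem_nhds hx]
        with y hy hy0
      rw [(hasFDerivAt_comp_norm hy0 hy).fderiv]
      simp [EuclideanSpace.inner_single_right]
    rw [h1.fderiv_eq]
    have h2 : HasDerivAt (fun r => h' r / r) ((h'' * ‖x‖ - h' ‖x‖ * 1) / ‖x‖ ^ 2) ‖x‖ :=
      hh'.div (hasDerivAt_id _) h0
    have h3 := hasFDerivAt_comp_norm hx h2
    have h4 : HasFDerivAt (fun y : Euc N => y i) (EuclideanSpace.proj i : Euc N →L[ℝ] ℝ) x :=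
      (EuclideanSpace.proj i : Euc N →L[ℝ] ℝ).hasFDerivAt
    rw [(h3.fun_mul h4).fderiv]
    simp [EuclideanSpace.inner_single_right]
    field_simp
  have e2 : lap (fun y : Euc N => h ‖y‖) x =
      ∑ i : Fin N, (h' ‖x‖ / ‖x‖ + (h'' * ‖x‖ - h' ‖x‖) / ‖x‖ ^ 3 * (x i) ^ 2) :=
    Finset.sum_congr rfl fun i _ => e1 i
  rw [e2, Finset.sum_add_distrib, ← Finset.mul_sum, ← EuclideanSpace.real_norm_sq_eq]
  simp
  field_simp
  ring

theorem lap_norm_rpow {N : ℕ} (σ : ℝ) {x : Euc N} (hx : x ≠ 0) :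
    lap (fun y : Euc N => ‖y‖ ^ σ) x = σ * (σ + N - 2) * ‖x‖ ^ (σ - 2) := by
  have h0 : 0 < ‖x‖ := norm_pos_iff.mpr hx
  rw [lap_comp_norm (h := fun r => r ^ σ) (h' := fun r => σ * r ^ (σ - 1))
    (h'' := σ * ((σ - 1) * ‖x‖ ^ (σ - 1 - 1))) hx]
  · rw [show σ - 1 - 1 = σ - 2 by ring, show σ - 1 = (σ - 2) + 1 by ring, Real.rpow_add_one h0.ne']
    field_simp
    ring
  · filter_upwards [lt_mem_nhds h0] with r hr
    exact Real.hasDerivAt_rpow_const (Or.inl hr.ne')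
  · exact (Real.hasDerivAt_rpow_const (Or.inl h0.ne')).const_mul _

theorem contDiffAt_norm_rpow {N : ℕ} (σ : ℝ) {x : Euc N} (hx : x ≠ 0) {n : WithTop ℕ∞} :
    ContDiffAt ℝ n (fun y : Euc N => ‖y‖ ^ σ) x :=
  (contDiffAt_norm ℝ hx).rpow_const_of_ne (norm_ne_zero_iff.mpr hx)

theorem IsLocalMin.lap_nonneg {N : ℕ} {g : Euc N → ℝ} {x : Euc N} (hg : TwiceDiffAt g x)
    (hm : IsLocalMin g x) : 0 ≤ lap g x := by
  unfold lap
  refine Finset.sum_nonneg fun i _ => ?_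
  set e : Euc N := EuclideanSpace.single i 1
  let γ : ℝ → Euc N := fun t => x + t • e
  have hγ : ∀ t, HasDerivAt γ e t := fun t => by
    simpa only [one_smul, id_eq] using ((hasDerivAt_id t).smul_const e).const_add x
  have γ0 : γ 0 = x := by simp [γ]
  have hγc : ContinuousAt γ 0 := (hγ 0).continuousAt
  have hd : ∀ᶠ t in nhds (0:ℝ), HasDerivAt (fun t => g (γ t)) (fderiv ℝ g (γ t) e) t := by
    have : ∀ᶠ y in nhds (γ 0), DifferentiableAt ℝ g y := by rw [γ0]; exact hg.1
    filter_upwards [hγc.eventually this] with t ht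
    exact ht.hasFDerivAt.comp_hasDerivAt t (hγ t)
  have hd2 : HasDerivAt (fun t => fderiv ℝ g (γ t) e)
      (fderiv ℝ (fun y => fderiv ℝ g y e) x e) 0 := by
    have h1 : HasFDerivAt (fun y => fderiv ℝ g y e) (fderiv ℝ (fun y => fderiv ℝ g y e) x) (γ 0) := by
      rw [γ0]; exact (hg.apply e).hasFDerivAt
    exact h1.comp_hasDerivAt 0 (hγ 0)
  have hdd : deriv (fun t => g (γ t)) =ᶠ[nhds 0] fun t => fderiv ℝ g (γ t) e := by
    filter_upwards [hd] with t ht using ht.deriv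
  have h2 : deriv (deriv fun t => g (γ t)) 0 = fderiv ℝ (fun y => fderiv ℝ g y e) x e := by
    rw [hdd.deriv_eq, hd2.deriv]
  have hmin : IsLocalMin (fun t => g (γ t)) 0 := by
    have : ∀ᶠ y in nhds (γ 0), g x ≤ g y := by rw [γ0]; exact hm
    filter_upwards [hγc.eventually this] with t ht
    simpa [γ0] using ht
  by_contra! hneg
  have hmax : IsLocalMax (fun t => g (γ t)) 0 :=
    isLocalMax_of_deriv_deriv_neg (by rw [h2]; exact hneg) hmin.deriv_eq_zero
      hd.self_of_nhds.continuousAt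
  have hconst : (fun t => g (γ t)) =ᶠ[nhds 0] fun _ => g (γ 0) := by
    filter_upwards [hmin, hmax] with t h1 h2
    exact le_antisymm h2 h1
  have : deriv (fun t => g (γ t)) =ᶠ[nhds 0] fun _ => 0 := by
    filter_upwards [hconst.eventuallyEq_nhds] with t ht
    rw [ht.deriv_eq]; simp
  rw [← h2, this.deriv_eq] at hneg
  simp at hneg

/-- Minimum principle on the punctured space, with barriers `‖x‖ ^ a` and `‖x‖ ^ b`. -/
theorem nonneg_of_lap_nonpos {N : ℕ} {h : Euc N → ℝ} {a b : ℝ}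
    (ha : 2 - (N:ℝ) < a) (ha0 : a < 0) (hb : 2 - (N:ℝ) < b) (hb0 : b < 0)
    (hC : ∀ x : Euc N, x ≠ 0 → ContDiffAt ℝ 2 h x)
    (hlap : ∀ x : Euc N, x ≠ 0 → lap h x ≤ 0)
    (hbd : ∀ ε > 0, ∃ r > 0, ∃ R, ∀ x : Euc N, x ≠ 0 → (‖x‖ < r ∨ R < ‖x‖) →
      -(ε * (‖x‖ ^ a + ‖x‖ ^ b)) ≤ h x) :
    ∀ x : Euc N, x ≠ 0 → 0 ≤ h x := by
  intro x₀ hx₀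
  by_contra! hneg
  have hx₀p : 0 < ‖x₀‖ := norm_pos_iff.mpr hx₀
  have hS : 0 < ‖x₀‖ ^ a + ‖x₀‖ ^ b := by positivity
  obtain ⟨ε, hε, hε2⟩ : ∃ ε > 0, h x₀ + ε * (‖x₀‖ ^ a + ‖x₀‖ ^ b) < 0 := by
    refine ⟨-h x₀ / (2 * (‖x₀‖ ^ a + ‖x₀‖ ^ b)), div_pos (by linarith) (by positivity), ?_⟩
    have : -h x₀ / (2 * (‖x₀‖ ^ a + ‖x₀‖ ^ b)) * (‖x₀‖ ^ a + ‖x₀‖ ^ b) = -h x₀ / 2 := by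
      field_simp
    rw [this]; linarith
  let g : Euc N → ℝ := fun x => h x + ε * (‖x‖ ^ a + ‖x‖ ^ b)
  have hgC : ∀ x : Euc N, x ≠ 0 → ContDiffAt ℝ 2 g x := fun x hx =>
    (hC x hx).add (contDiffAt_const.mul ((contDiffAt_norm_rpow a hx).add (contDiffAt_norm_rpow b hx)))
  have hgl : ∀ x : Euc N, x ≠ 0 → lap g x < 0 := by
    intro x hx
    have h0 : 0 < ‖x‖ := norm_pos_iff.mpr hx
    have ta := (contDiffAt_norm_rpow a hx (n := 2)).twiceDiffAt
    have tb := (contDiffAt_norm_rpow b hx (n := 2)).twiceDiffAt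
    have tab := ((contDiffAt_norm_rpow a hx (n := 2)).add (contDiffAt_norm_rpow b hx)).twiceDiffAt
    have tm := (contDiffAt_const (c := ε)).mul
      ((contDiffAt_norm_rpow a hx (n := 2)).add (contDiffAt_norm_rpow b hx)) |>.twiceDiffAt
    have e1 : lap g x = lap h x + ε * (lap (fun y => ‖y‖ ^ a) x + lap (fun y => ‖y‖ ^ b) x) := by
      rw [← lap_add ta tb, ← lap_const_mul tab, ← lap_add (hC x hx).twiceDiffAt tm]
    rw [e1, lap_norm_rpow a hx, lap_norm_rpow b hx]
    have ka : a * (a + N - 2) < 0 := mul_neg_of_neg_of_pos ha0 (by linarith)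
    have kb : b * (b + N - 2) < 0 := mul_neg_of_neg_of_pos hb0 (by linarith)
    have pa : 0 < ‖x‖ ^ (a - 2) := by positivity
    have pb : 0 < ‖x‖ ^ (b - 2) := by positivity
    have := mul_neg_of_neg_of_pos ka pa
    have := mul_neg_of_neg_of_pos kb pb
    have := hlap x hx
    nlinarith
  obtain ⟨r, hr, R, hrR⟩ := hbd ε hε
  let A : Set (Euc N) := {x | r ≤ ‖x‖ ∧ ‖x‖ ≤ R}
  have hAc : IsCompact A := by
    refine (isCompact_closedBall (0 : Euc N) R).of_isClosed_subset ?_ ?_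
    · exact (isClosed_le continuous_const continuous_norm).inter
        (isClosed_le continuous_norm continuous_const)
    · intro x hx; simpa using hx.2
  have hout : ∀ x : Euc N, x ≠ 0 → x ∉ A → 0 ≤ g x := by
    intro x hx hxA
    have : ‖x‖ < r ∨ R < ‖x‖ := by
      by_contra! hcon
      exact hxA ⟨hcon.1, hcon.2⟩
    have := hrR x hx this
    simp only [g]; linarith
  have hx₀A : x₀ ∈ A := by
    by_contra hcon
    have h1 := hout x₀ hx₀ hcon
    simp only [g] at h1; linarith
  have hA0 : ∀ x ∈ A, x ≠ 0 := fun x hx => norm_pos_iff.mp (hr.trans_le hx.1)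
  obtain ⟨z, hzA, hz⟩ := hAc.exists_isMinOn ⟨x₀, hx₀A⟩
    (f := g) (fun x hx => (hgC x (hA0 x hx)).continuousAt.continuousWithinAt)
  have hgz : g z < 0 := (hz hx₀A).trans_lt hε2
  have hmin : IsLocalMin g z := by
    filter_upwards [isOpen_ne.mem_nhds (hA0 z hzA)] with y hy
    by_cases hyA : y ∈ A
    · exact hz hyA
    · exact hgz.le.trans (hout y hy hyA)
  have := hmin.lap_nonneg (hgC z (hA0 z hzA)).twiceDiffAt
  have := hgl z (hA0 z hzA)
  linarith

/-- A smooth radial function vanishing near the origin and equal to `1` outside the unit ball. -/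
def radCut {N : ℕ} (z : Euc N) : ℝ := Real.smoothTransition (2 * ‖z‖ ^ 2 - 1)

/-- The radial profile of `radCut`. -/
def cutProfile (r : ℝ) : ℝ := Real.smoothTransition (2 * r ^ 2 - 1)

theorem radCut_eq_one {N : ℕ} {z : Euc N} (hz : 1 ≤ ‖z‖) : radCut z = 1 :=
  Real.smoothTransition.one_of_one_le (by nlinarith)

theorem radCut_eq_zero {N : ℕ} {z : Euc N} (hz : ‖z‖ ≤ 1 / 2) : radCut z = 0 :=
  Real.smoothTransition.zero_of_nonpos (by nlinarith [norm_nonneg z])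

theorem radCut_nonneg {N : ℕ} (z : Euc N) : 0 ≤ radCut z := Real.smoothTransition.nonneg _

theorem radCut_le_one {N : ℕ} (z : Euc N) : radCut z ≤ 1 := Real.smoothTransition.le_one _

theorem contDiff_radCut {N : ℕ} : ContDiff ℝ 2 (radCut : Euc N → ℝ) :=
  Real.smoothTransition.contDiff.comp
    ((contDiff_const.mul (contDiff_norm_sq ℝ)).sub contDiff_const)

theorem contDiff_radCut_mul {N : ℕ} {g : Euc N → ℝ} (hg : ∀ x, x ≠ 0 → ContDiffAt ℝ 2 g x) :
    ContDiff ℝ 2 (fun z => radCut z * g z) := by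
  rw [contDiff_iff_contDiffAt]
  intro x
  by_cases hx : x = 0
  · have : (fun z => radCut z * g z) =ᶠ[nhds x] fun _ => 0 := by
      rw [hx]
      filter_upwards [ball_mem_nhds (0 : Euc N) (by norm_num : (0:ℝ) < 1 / 2)] with y hy
      rw [radCut_eq_zero (by simpa using (mem_ball_zero_iff.mp hy).le), zero_mul]
    exact contDiffAt_const.congr_of_eventuallyEq this
  · exact contDiff_radCut.contDiffAt.mul (hg x hx)

/-- The dilation of `g` by `ε` with weight `ε ^ a`. -/
def dil {N : ℕ} {F : Type*} [NormedAddCommGroup F] [NormedSpace ℝ F] (ε a : ℝ) (g : Euc N → F)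
    (z : Euc N) : F := ε ^ a • g (ε⁻¹ • z)

section Dil
variable {N : ℕ} {F : Type*} [NormedAddCommGroup F] [NormedSpace ℝ F]

theorem fderiv_dil {ε : ℝ} (hε : 0 < ε) (a : ℝ) (g : Euc N → F) :
    fderiv ℝ (dil ε a g) = dil ε (a - 1) (fderiv ℝ g) := by
  ext1 z
  unfold dil
  rw [show (fun z => ε ^ a • g (ε⁻¹ • z)) = ε ^ a • fun z => g (ε⁻¹ • z) from rfl,
    fderiv_const_smul_field, Pi.smul_apply, fderiv_comp_smul, smul_smul, Real.rpow_sub_one hε.ne']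
  rfl

theorem norm_dil_le {ε a C : ℝ} (hε : 0 < ε) {g : Euc N → F} (hg : ∀ z, ‖g z‖ ≤ C * ‖z‖ ^ a)
    (z : Euc N) : ‖dil ε a g z‖ ≤ C * ‖z‖ ^ a := by
  unfold dil
  rw [norm_smul, Real.norm_of_nonneg (by positivity)]
  calc ε ^ a * ‖g (ε⁻¹ • z)‖ ≤ ε ^ a * (C * ‖ε⁻¹ • z‖ ^ a) := by gcongr; exact hg _
    _ = C * ‖z‖ ^ a := by
      rw [norm_smul, norm_inv, Real.norm_of_nonneg hε.le, Real.mul_rpow (by positivity)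
        (norm_nonneg _), Real.inv_rpow hε.le]
      have : ε ^ a ≠ 0 := by positivity
      field_simp

theorem dil_eq_zero {ε a : ℝ} (hε : 0 < ε) {g : Euc N → F} (hg : ∀ z, ‖z‖ < 1 / 2 → g z = 0)
    {z : Euc N} (hz : ‖z‖ < ε / 2) : dil ε a g z = 0 := by
  unfold dil
  rw [hg, smul_zero]
  rw [norm_smul, norm_inv, Real.norm_of_nonneg hε.le, inv_mul_lt_iff₀ hε]
  linarith

theorem norm_dil_le_decay {ε a p C : ℝ} (hε : 0 < ε) (hC : 0 ≤ C) (hap : a ≤ p) (hp : p ≤ 0)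
    {g : Euc N → F} (hg : ∀ z, ‖g z‖ ≤ C * ‖z‖ ^ a) (hg0 : ∀ z, ‖z‖ < 1 / 2 → g z = 0) :
    ∃ C', 0 ≤ C' ∧ ∀ z, ‖dil ε a g z‖ ≤ C' * (1 + ‖z‖) ^ p := by
  refine ⟨C * ((ε / 2) ^ (a - p) * ((1 + 2 / ε)⁻¹) ^ p), by positivity, fun z => ?_⟩
  rcases lt_or_ge ‖z‖ (ε / 2) with hz | hz
  · rw [dil_eq_zero hε hg0 hz, norm_zero]; positivity
  · have hz0 : 0 < ‖z‖ := lt_of_lt_of_le (by positivity) hz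
    refine (norm_dil_le hε hg z).trans ?_
    rw [mul_assoc, mul_assoc, ← Real.mul_rpow (by positivity) (by positivity)]
    refine mul_le_mul_of_nonneg_left ?_ hC
    calc ‖z‖ ^ a = ‖z‖ ^ (a - p) * ‖z‖ ^ p := by rw [← Real.rpow_add hz0]; ring_nf
      _ ≤ (ε / 2) ^ (a - p) * ((1 + 2 / ε)⁻¹ * (1 + ‖z‖)) ^ p := by
        refine mul_le_mul ?_ ?_ (by positivity) (by positivity)
        · exact Real.rpow_le_rpow_of_nonpos (by positivity) hz (by linarith)
        · refine Real.rpow_le_rpow_of_nonpos (by positivity) ?_ hp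
          rw [inv_mul_le_iff₀ (by positivity), add_mul]
          have : 1 ≤ 2 / ε * ‖z‖ := by
            rw [div_mul_eq_mul_div, le_div_iff₀ hε]; linarith
          linarith

theorem exists_norm_le_of_homogeneous {g : Euc N → F} {a : ℝ} (ha : a ≤ 0) (hc : Continuous g)
    (h0 : ∀ z, ‖z‖ < 1 / 2 → g z = 0)
    (hh : ∀ l : ℝ, 1 ≤ l → ∀ w : Euc N, 1 < ‖w‖ → g (l • w) = l ^ a • g w) :
    ∃ C, 0 ≤ C ∧ ∀ z, ‖g z‖ ≤ C * ‖z‖ ^ a := by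
  obtain ⟨M, hM⟩ := (isCompact_closedBall (0 : Euc N) 2).exists_bound_of_continuousOn hc.continuousOn
  have hM0 : 0 ≤ M := (norm_nonneg _).trans (hM 0 (by simp))
  have key : ∀ z : Euc N, ‖z‖ ≤ 2 → ‖g z‖ ≤ M * (2 ^ (-a)) * ‖z‖ ^ a := by
    intro z hz
    rcases lt_or_ge ‖z‖ (1 / 2) with h | h
    · rw [h0 z h, norm_zero]; positivity
    · have hz0 : 0 < ‖z‖ := by linarith
      have h1 : (2:ℝ) ^ a ≤ ‖z‖ ^ a := Real.rpow_le_rpow_of_nonpos hz0 hz ha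
      calc ‖g z‖ ≤ M := hM z (by simpa using hz)
        _ = M * (2 ^ (-a)) * 2 ^ a := by
          rw [mul_assoc, ← Real.rpow_add (by norm_num)]; simp
        _ ≤ _ := by gcongr
  refine ⟨M * 2 ^ (-a), by positivity, fun z => ?_⟩
  rcases le_or_gt ‖z‖ 2 with h | h
  · exact key z h
  · have hl : 0 < ‖z‖ / 2 := by linarith
    have hw : ‖(‖z‖ / 2)⁻¹ • z‖ = 2 := by
      rw [norm_smul, norm_inv, Real.norm_of_nonneg hl.le]; field_simp
    have hz : z = (‖z‖ / 2) • ((‖z‖ / 2)⁻¹ • z) := by rw [smul_inv_smul₀ hl.ne']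
    have h1 := hh (‖z‖ / 2) (by linarith) ((‖z‖ / 2)⁻¹ • z) (by rw [hw]; norm_num)
    rw [← hz] at h1
    rw [h1, norm_smul, Real.norm_of_nonneg (by positivity)]
    calc (‖z‖ / 2) ^ a * ‖g ((‖z‖ / 2)⁻¹ • z)‖ ≤ (‖z‖ / 2) ^ a * (M * (2 ^ (-a)) * 2 ^ a) := by
          gcongr
          simpa only [hw] using key ((‖z‖ / 2)⁻¹ • z) hw.le
      _ = M * 2 ^ (-a) * ((‖z‖ / 2) ^ a * 2 ^ a) := by ring
      _ = _ := by rw [← Real.mul_rpow hl.le (by norm_num)]; congr 2; ring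

theorem fderiv_homogeneous {g : Euc N → F} {a : ℝ}
    (hh : ∀ l : ℝ, 1 ≤ l → ∀ w : Euc N, 1 < ‖w‖ → g (l • w) = l ^ a • g w) :
    ∀ l : ℝ, 1 ≤ l → ∀ w : Euc N, 1 < ‖w‖ →
      fderiv ℝ g (l • w) = l ^ (a - 1) • fderiv ℝ g w := by
  intro l hl w hw
  have h1 : (fun w => g (l • w)) =ᶠ[nhds w] l ^ a • g := by
    filter_upwards [(isOpen_lt continuous_const continuous_norm).mem_nhds hw] with y hy
    exact hh l hl y hy
  have h2 := h1.fderiv_eq (𝕜 := ℝ)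
  rw [fderiv_comp_smul, fderiv_const_smul_field, Pi.smul_apply] at h2
  have hl0 : l ≠ 0 := by linarith
  rw [Real.rpow_sub_one hl0, div_eq_inv_mul, ← smul_smul, ← h2, inv_smul_smul₀ hl0]

theorem fderiv_eq_zero_of_ball {g : Euc N → F} (h0 : ∀ z, ‖z‖ < 1 / 2 → g z = 0) :
    ∀ z, ‖z‖ < 1 / 2 → fderiv ℝ g z = 0 := by
  intro z hz
  have : g =ᶠ[nhds z] fun _ => 0 := by
    filter_upwards [(isOpen_lt continuous_norm continuous_const).mem_nhds hz] with y hy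
    exact h0 y hy
  rw [this.fderiv_eq]; simp

end Dil

/-- The regularisation of the Newtonian kernel at unit scale. -/
def regKer (N : ℕ) (z : Euc N) : ℝ := radCut z * ‖z‖ ^ (2 - N : ℝ)

theorem contDiff_regKer (N : ℕ) : ContDiff ℝ 2 (regKer N) :=
  contDiff_radCut_mul fun _ hx => contDiffAt_norm_rpow _ hx

theorem regKer_eq_zero {N : ℕ} (z : Euc N) (hz : ‖z‖ < 1 / 2) : regKer N z = 0 := by
  rw [regKer, radCut_eq_zero hz.le, zero_mul]

theorem regKer_homogeneous {N : ℕ} (l : ℝ) (hl : 1 ≤ l) (w : Euc N) (hw : 1 < ‖w‖) :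
    regKer N (l • w) = l ^ (2 - N : ℝ) • regKer N w := by
  have h1 : ‖l • w‖ = l * ‖w‖ := by rw [norm_smul, Real.norm_of_nonneg (by linarith)]
  rw [regKer, regKer, radCut_eq_one hw.le, radCut_eq_one (by rw [h1]; nlinarith), h1,
    Real.mul_rpow (by linarith) (by linarith)]
  simp

theorem dil_regKer_eq {N : ℕ} {ε : ℝ} (hε : 0 < ε) {z : Euc N} (hz : ε ≤ ‖z‖) :
    dil ε (2 - N : ℝ) (regKer N) z = ‖z‖ ^ (2 - N : ℝ) := by
  have h1 : ‖ε⁻¹ • z‖ = ε⁻¹ * ‖z‖ := by rw [norm_smul, norm_inv, Real.norm_of_nonneg hε.le]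
  rw [dil, regKer, radCut_eq_one (by rw [h1, le_inv_mul_iff₀ hε]; simpa using hz), h1,
    Real.mul_rpow (by positivity) (by positivity), Real.inv_rpow hε.le, smul_eq_mul]
  have : ε ^ (2 - N : ℝ) ≠ 0 := by positivity
  field_simp

theorem dil_regKer_nonneg {N : ℕ} {ε : ℝ} (hε : 0 < ε) (z : Euc N) :
    0 ≤ dil ε (2 - N : ℝ) (regKer N) z := by
  unfold dil regKer
  have := radCut_nonneg (ε⁻¹ • z)
  positivity

theorem dil_regKer_le {N : ℕ} {ε : ℝ} (hε : 0 < ε) (z : Euc N) :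
    dil ε (2 - N : ℝ) (regKer N) z ≤ ‖z‖ ^ (2 - N : ℝ) := by
  have h := norm_dil_le (a := (2 - N : ℝ)) (C := 1) hε (g := regKer N) (fun z => by
    rw [regKer, norm_mul, Real.norm_of_nonneg (radCut_nonneg z), Real.norm_of_nonneg (by positivity)]
    exact mul_le_mul_of_nonneg_right (radCut_le_one z) (by positivity)) z
  rw [one_mul] at h
  exact (le_abs_self _).trans h

theorem contDiff_fderiv_regKer (N : ℕ) : ContDiff ℝ 1 (fderiv ℝ (regKer N)) :=
  (contDiff_regKer N).fderiv_right (by norm_num)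

theorem continuous_fderiv_fderiv_regKer (N : ℕ) :
    Continuous (fderiv ℝ (fderiv ℝ (regKer N))) :=
  (contDiff_fderiv_regKer N).continuous_fderiv (by simp)

theorem exists_bound_fderiv_regKer {N : ℕ} (hN : 2 ≤ N) :
    ∃ C, 0 ≤ C ∧ ∀ z, ‖fderiv ℝ (regKer N) z‖ ≤ C * ‖z‖ ^ (2 - N - 1 : ℝ) :=
  exists_norm_le_of_homogeneous (by have : (2:ℝ) ≤ N := by exact_mod_cast hN
                                    linarith) (contDiff_fderiv_regKer N).continuous
    (fderiv_eq_zero_of_ball regKer_eq_zero) (fderiv_homogeneous regKer_homogeneous)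

theorem exists_bound_fderiv_fderiv_regKer {N : ℕ} (hN : 2 ≤ N) :
    ∃ C, 0 ≤ C ∧ ∀ z, ‖fderiv ℝ (fderiv ℝ (regKer N)) z‖ ≤ C * ‖z‖ ^ (2 - N - 1 - 1 : ℝ) :=
  exists_norm_le_of_homogeneous (by have : (2:ℝ) ≤ N := by exact_mod_cast hN
                                    linarith) (continuous_fderiv_fderiv_regKer N)
    (fderiv_eq_zero_of_ball (fderiv_eq_zero_of_ball regKer_eq_zero))
    (fderiv_homogeneous (fderiv_homogeneous regKer_homogeneous))

/-- `f` is measurable and integrable against the weight `(1 + ‖y‖) ^ (2 - N)`. -/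
def PotAdmissible {N : ℕ} (f : Euc N → ℝ) : Prop :=
  AEStronglyMeasurable f volume ∧ Integrable (fun y => (1 + ‖y‖) ^ (2 - N : ℝ) * f y)

/-- The (unnormalised) Newtonian potential of `f`. -/
def newtPot {N : ℕ} (f : Euc N → ℝ) (x : Euc N) : ℝ := ∫ y, f y * ‖x - y‖ ^ (2 - N : ℝ)

theorem one_add_norm_sub_rpow_le {N : ℕ} {p : ℝ} (hp : p ≤ 0) (x y : Euc N) :
    (1 + ‖x - y‖) ^ p ≤ (1 + ‖x‖) ^ (-p) * (1 + ‖y‖) ^ p := by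
  have h1 : 1 + ‖y‖ ≤ (1 + ‖x‖) * (1 + ‖x - y‖) := by
    have : ‖y‖ ≤ ‖x‖ + ‖x - y‖ := by
      calc ‖y‖ = ‖x - (x - y)‖ := by congr 1; abel
        _ ≤ _ := norm_sub_le _ _
    nlinarith [norm_nonneg x, norm_nonneg (x - y)]
  have h2 := Real.rpow_le_rpow_of_nonpos (by positivity) h1 hp
  rw [Real.mul_rpow (by positivity) (by positivity)] at h2
  calc (1 + ‖x - y‖) ^ p = (1 + ‖x‖) ^ (-p) * ((1 + ‖x‖) ^ p * (1 + ‖x - y‖) ^ p) := by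
        rw [← mul_assoc, ← Real.rpow_add (by positivity)]; simp
    _ ≤ _ := by gcongr

section Conv
variable {N : ℕ} {F : Type*} [NormedAddCommGroup F] [NormedSpace ℝ F]

theorem PotAdmissible.aesm_smul {f : Euc N → ℝ} (hf : PotAdmissible f) {K : Euc N → F}
    (hK : Continuous K) (x : Euc N) :
    AEStronglyMeasurable (fun y => f y • K (x - y)) volume :=
  hf.1.smul (hK.comp (continuous_const.sub continuous_id)).aestronglyMeasurable

theorem PotAdmissible.integrable_smul {f : Euc N → ℝ} (hf : PotAdmissible f) {K : Euc N → F}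
    (hN : 2 ≤ N) (hK : Continuous K) {C : ℝ} (hC : 0 ≤ C)
    (hKb : ∀ z, ‖K z‖ ≤ C * (1 + ‖z‖) ^ (2 - N : ℝ)) (x : Euc N) :
    Integrable (fun y => f y • K (x - y)) := by
  have hp : (2 - N : ℝ) ≤ 0 := by have : (2:ℝ) ≤ N := by exact_mod_cast hN
                                  linarith
  refine ((hf.2.norm).const_mul (C * (1 + ‖x‖) ^ (-(2 - N : ℝ)))).mono' (hf.aesm_smul hK x) ?_
  filter_upwards with y
  rw [norm_smul, norm_mul, Real.norm_of_nonneg (r := (1 + ‖y‖) ^ (2 - N : ℝ)) (by positivity)]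
  calc ‖f y‖ * ‖K (x - y)‖ ≤ ‖f y‖ * (C * ((1 + ‖x‖) ^ (-(2 - N : ℝ)) * (1 + ‖y‖) ^ (2 - N : ℝ))) := by
        gcongr
        exact (hKb _).trans (by gcongr; exact one_add_norm_sub_rpow_le hp x y)
    _ = _ := by ring

theorem PotAdmissible.norm_smul_le {f : Euc N → ℝ} {K : Euc N → F}
    (hN : 2 ≤ N) {C : ℝ} (hC : 0 ≤ C)
    (hKb : ∀ z, ‖K z‖ ≤ C * (1 + ‖z‖) ^ (2 - N : ℝ)) (x₀ x : Euc N) (hx : x ∈ ball x₀ 1)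
    (y : Euc N) :
    ‖f y • K (x - y)‖ ≤
      C * (2 + ‖x₀‖) ^ (-(2 - N : ℝ)) * ‖(1 + ‖y‖) ^ (2 - N : ℝ) * f y‖ := by
  have hp : (2 - N : ℝ) ≤ 0 := by have : (2:ℝ) ≤ N := by exact_mod_cast hN
                                  linarith
  have hx1 : 1 + ‖x‖ ≤ 2 + ‖x₀‖ := by
    have h1 : ‖x - x₀‖ < 1 := by simpa [dist_eq_norm] using hx
    have := norm_le_norm_add_norm_sub' x x₀
    linarith
  rw [norm_smul, norm_mul, Real.norm_of_nonneg (r := (1 + ‖y‖) ^ (2 - N : ℝ)) (by positivity)]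
  calc ‖f y‖ * ‖K (x - y)‖
      ≤ ‖f y‖ * (C * ((2 + ‖x₀‖) ^ (-(2 - N : ℝ)) * (1 + ‖y‖) ^ (2 - N : ℝ))) := by
        gcongr
        refine (hKb _).trans ?_
        gcongr
        refine (one_add_norm_sub_rpow_le hp x y).trans ?_
        gcongr
        linarith
    _ = _ := by ring

theorem PotAdmissible.continuous_conv {f : Euc N → ℝ} (hf : PotAdmissible f) {K : Euc N → F}
    (hN : 2 ≤ N) (hK : Continuous K) {C : ℝ} (hC : 0 ≤ C)
    (hKb : ∀ z, ‖K z‖ ≤ C * (1 + ‖z‖) ^ (2 - N : ℝ)) :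
    Continuous (fun x => ∫ y, f y • K (x - y)) := by
  rw [continuous_iff_continuousAt]
  intro x₀
  refine continuousAt_of_dominated (Eventually.of_forall fun x => hf.aesm_smul hK x) ?_
    (hf.2.norm.const_mul (C * (2 + ‖x₀‖) ^ (-(2 - N : ℝ)))) ?_
  · filter_upwards [ball_mem_nhds x₀ one_pos] with x hx
    exact Eventually.of_forall fun y => PotAdmissible.norm_smul_le hN hC hKb x₀ x hx y
  · filter_upwards with y
    exact (continuous_const.smul (hK.comp (continuous_id.sub continuous_const))).continuousAt

theorem PotAdmissible.hasFDerivAt_conv {f : Euc N → ℝ} (hf : PotAdmissible f) {K : Euc N → F}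
    (hN : 2 ≤ N) (hK : ContDiff ℝ 1 K) {C C' : ℝ} (hC : 0 ≤ C) (hC' : 0 ≤ C')
    (hKb : ∀ z, ‖K z‖ ≤ C * (1 + ‖z‖) ^ (2 - N : ℝ))
    (hKb' : ∀ z, ‖fderiv ℝ K z‖ ≤ C' * (1 + ‖z‖) ^ (2 - N : ℝ)) (x₀ : Euc N) :
    HasFDerivAt (fun x => ∫ y, f y • K (x - y)) (∫ y, f y • fderiv ℝ K (x₀ - y)) x₀ := by
  refine hasFDerivAt_integral_of_dominated_of_fderiv_le (ball_mem_nhds x₀ one_pos)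
    (Eventually.of_forall fun x => hf.aesm_smul hK.continuous x)
    (hf.integrable_smul hN hK.continuous hC hKb x₀)
    (hf.aesm_smul (hK.continuous_fderiv (by simp)) x₀) ?_
    (hf.2.norm.const_mul (C' * (2 + ‖x₀‖) ^ (-(2 - N : ℝ))))
    (F' := fun x y => f y • fderiv ℝ K (x - y)) ?_
  · exact Eventually.of_forall fun y x hx => PotAdmissible.norm_smul_le hN hC' hKb' x₀ x hx y
  · refine Eventually.of_forall fun y x _ => ?_
    have h1 : HasFDerivAt K (fderiv ℝ K (x - y)) (x - y) :=
      (hK.differentiable (by simp) _).hasFDerivAt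
    have h2 : HasFDerivAt (fun x => K (x - y)) (fderiv ℝ K (x - y)) x := by
      rw [sub_eq_add_neg, ← hasFDerivAt_comp_add_right] at h1
      simpa only [sub_eq_add_neg] using h1
    exact h2.const_smul (f y)

end Conv

/-- The integral of `‖z‖ ^ b` over a ball. -/
def ballMoment (N : ℕ) (b r : ℝ) : ℝ := ∫ z in closedBall (0 : Euc N) r, ‖z‖ ^ b

theorem integrableOn_norm_rpow {N : ℕ} (hN : 2 ≤ N) {b : ℝ} (hb : -(N:ℝ) < b) (R : ℝ) :
    IntegrableOn (fun z : Euc N => ‖z‖ ^ b) (closedBall 0 R) := by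
  have : Nonempty (Fin N) := ⟨⟨0, by omega⟩⟩
  have : Nontrivial (Euc N) := inferInstance
  rcases lt_or_ge R 0 with hR | hR
  · rw [closedBall_eq_empty.mpr hR]; exact integrableOn_empty
  rw [← integrable_indicator_iff measurableSet_closedBall]
  have h1 : (closedBall (0 : Euc N) R).indicator (fun z : Euc N => ‖z‖ ^ b)
      = fun z => (Set.Iic R).indicator (fun r : ℝ => r ^ b) ‖z‖ := by
    ext z
    simp only [Set.indicator, mem_closedBall_zero_iff, Set.mem_Iic]
  rw [h1, integrable_fun_norm_addHaar volume (f := (Set.Iic R).indicator (fun r : ℝ => r ^ b))]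
  have h2 : IntegrableOn (fun y : ℝ => y ^ ((N:ℝ) - 1 + b)) (Set.Ioc 0 R) := by
    rw [← intervalIntegrable_iff_integrableOn_Ioc_of_le hR]
    exact intervalIntegral.intervalIntegrable_rpow' (by linarith)
  rw [← integrable_indicator_iff measurableSet_Ioc] at h2
  rw [← integrable_indicator_iff measurableSet_Ioi]
  refine h2.congr (Eventually.of_forall fun y => ?_)
  simp only [Set.indicator, Set.mem_Ioc, Set.mem_Ioi, Set.mem_Iic, finrank_euclideanSpace,
    Fintype.card_fin, smul_eq_mul]
  by_cases hy : 0 < y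
  · by_cases hy2 : y ≤ R
    · simp only [hy, hy2, and_self, if_true]
      rw [Real.rpow_add hy, ← Real.rpow_natCast, Nat.cast_sub (by omega)]
      simp
    · simp [hy2]
  · simp [hy]

theorem ballMoment_tendsto {N : ℕ} (hN : 2 ≤ N) {b : ℝ} (hb : -(N:ℝ) < b) :
    Tendsto (fun n : ℕ => ballMoment N b (1 / ((n:ℝ) + 1))) atTop (nhds 0) := by
  have : Nonempty (Fin N) := ⟨⟨0, by omega⟩⟩
  have hanti : Antitone fun n : ℕ => closedBall (0 : Euc N) (1 / ((n:ℝ) + 1)) := by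
    intro m n hmn
    exact closedBall_subset_closedBall (Nat.one_div_le_one_div hmn)
  have h := tendsto_setIntegral_of_antitone (μ := volume) (f := fun z : Euc N => ‖z‖ ^ b)
    (fun n => measurableSet_closedBall) hanti ⟨0, integrableOn_norm_rpow hN hb _⟩
  have h0 : ⋂ n : ℕ, closedBall (0 : Euc N) (1 / ((n:ℝ) + 1)) = {0} := by
    ext z
    simp only [Set.mem_iInter, mem_closedBall_zero_iff, Set.mem_singleton_iff]
    constructor
    · intro hz
      have := ge_of_tendsto' tendsto_one_div_add_atTop_nhds_zero_nat hz
      exact norm_le_zero_iff.mp this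
    · rintro rfl n
      rw [norm_zero]; positivity
  rw [h0] at h
  simpa [ballMoment] using h

section Local
variable {N : ℕ} {F : Type*} [NormedAddCommGroup F] [NormedSpace ℝ F]

theorem local_bound_aux {c : Euc N → ℝ} {k : Euc N → F} {b γ B C r : ℝ} {x : Euc N}
    (hB : 0 ≤ B) (hC : 0 ≤ C)
    (hk : ∀ z, ‖k z‖ ≤ C * ‖z‖ ^ b) (hk0 : ∀ z, r < ‖z‖ → k z = 0)
    (hc : ∀ y, ‖x - y‖ ≤ r → ‖c y‖ ≤ B * ‖x - y‖ ^ γ) (y : Euc N) (hy : y ≠ x) :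
    ‖c y • k (x - y)‖ ≤
      (closedBall (0 : Euc N) r).indicator (fun z => B * C * ‖z‖ ^ (b + γ)) (x - y) := by
  have hxy : 0 < ‖x - y‖ := norm_pos_iff.mpr (sub_ne_zero.mpr hy.symm)
  by_cases h : ‖x - y‖ ≤ r
  · rw [Set.indicator_of_mem (by simpa using h), norm_smul, Real.rpow_add hxy]
    calc ‖c y‖ * ‖k (x - y)‖ ≤ (B * ‖x - y‖ ^ γ) * (C * ‖x - y‖ ^ b) := by
          gcongr
          · exact hc y h
          · exact hk _
      _ = _ := by ring
  · rw [hk0 _ (not_le.mp h), smul_zero, norm_zero]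
    exact Set.indicator_nonneg (fun z _ => by positivity) _

theorem integrable_local_bound (hN : 2 ≤ N) {b : ℝ} (hb : -(N:ℝ) < b) (D r : ℝ) (x : Euc N) :
    Integrable fun y : Euc N =>
      (closedBall (0 : Euc N) r).indicator (fun z => D * ‖z‖ ^ b) (x - y) := by
  have h1 : Integrable ((closedBall (0 : Euc N) r).indicator (fun z => D * ‖z‖ ^ b)) :=
    (integrable_indicator_iff measurableSet_closedBall).mpr
      ((integrableOn_norm_rpow hN hb r).const_mul D)
  exact h1.comp_sub_left x

theorem integrable_of_local (hN : 2 ≤ N) {c : Euc N → ℝ} {k : Euc N → F} {b γ B C r : ℝ}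
    {x : Euc N} (hB : 0 ≤ B) (hC : 0 ≤ C) (hbγ : -(N:ℝ) < b + γ)
    (hm : AEStronglyMeasurable (fun y => c y • k (x - y)) volume)
    (hk : ∀ z, ‖k z‖ ≤ C * ‖z‖ ^ b) (hk0 : ∀ z, r < ‖z‖ → k z = 0)
    (hc : ∀ y, ‖x - y‖ ≤ r → ‖c y‖ ≤ B * ‖x - y‖ ^ γ) :
    Integrable (fun y => c y • k (x - y)) := by
  have : Nonempty (Fin N) := ⟨⟨0, by omega⟩⟩
  refine (integrable_local_bound hN hbγ (B * C) r x).mono' hm ?_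
  filter_upwards [compl_mem_ae_iff.mpr (measure_singleton x)] with y hy
  exact local_bound_aux hB hC hk hk0 hc y hy

theorem norm_integral_local_le (hN : 2 ≤ N) {c : Euc N → ℝ} {k : Euc N → F} {b γ B C r : ℝ}
    {x : Euc N} (hB : 0 ≤ B) (hC : 0 ≤ C) (hbγ : -(N:ℝ) < b + γ)
    (hk : ∀ z, ‖k z‖ ≤ C * ‖z‖ ^ b) (hk0 : ∀ z, r < ‖z‖ → k z = 0)
    (hc : ∀ y, ‖x - y‖ ≤ r → ‖c y‖ ≤ B * ‖x - y‖ ^ γ) :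
    ‖∫ y, c y • k (x - y)‖ ≤ B * C * ballMoment N (b + γ) r := by
  have : Nonempty (Fin N) := ⟨⟨0, by omega⟩⟩
  refine (norm_integral_le_of_norm_le (integrable_local_bound hN hbγ (B * C) r x) ?_).trans_eq ?_
  · filter_upwards [compl_mem_ae_iff.mpr (measure_singleton x)] with y hy
    exact local_bound_aux hB hC hk hk0 hc y hy
  · rw [integral_sub_left_eq_self
      ((closedBall (0 : Euc N) r).indicator (fun z => B * C * ‖z‖ ^ (b + γ))),
      integral_indicator measurableSet_closedBall, integral_const_mul]
    rfl

theorem integral_fderiv_eq_zero_of_hasCompactSupport [CompleteSpace F] {g : Euc N → F}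
    (hg : ContDiff ℝ 1 g) (hc : HasCompactSupport g) : ∫ z, fderiv ℝ g z = 0 := by
  have hi : Integrable (fderiv ℝ g) :=
    (hg.continuous_fderiv (by simp)).integrable_of_hasCompactSupport (hc.fderiv (𝕜 := ℝ))
  ext v
  rw [ContinuousLinearMap.integral_apply hi]
  have hv : Integrable (fun z => fderiv ℝ g z v) :=
    (ContinuousLinearMap.apply ℝ F v).integrable_comp hi
  have := integral_smul_fderiv_eq_neg_fderiv_smul_of_integrable (𝕜 := ℝ) (μ := (volume : Measure (Euc N)))
    (f := fun _ => (1:ℝ)) (g := g) (v := v) (by simp) (by simpa using hv)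
    (by simpa using hg.continuous.integrable_of_hasCompactSupport hc)
    (fun x => by fun_prop) (fun x _ => hg.differentiable (by simp) x)
  simpa using this

/-- Passage to the limit in derivatives that are uniformly Cauchy. -/
theorem exists_fderiv_of_uniformCauchySeqOn [CompleteSpace F] {s : Set (Euc N)} (hs : IsOpen s)
    {U : ℕ → Euc N → F} {U' : ℕ → Euc N → Euc N →L[ℝ] F} {V : Euc N → F}
    (hd : ∀ n x, HasFDerivAt (U n) (U' n x) x) (hc : ∀ n, Continuous (U' n))
    (hlim : ∀ x ∈ s, Tendsto (fun n => U n x) atTop (nhds (V x)))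
    (hU : UniformCauchySeqOn U' atTop s) :
    ∃ V' : Euc N → Euc N →L[ℝ] F, TendstoUniformlyOn U' V' atTop s ∧
      (∀ x ∈ s, HasFDerivAt V (V' x) x) ∧ ContinuousOn V' s := by
  have h1 : ∀ x ∈ s, ∃ l, Tendsto (fun n => U' n x) atTop (nhds l) := fun x hx =>
    cauchySeq_tendsto_of_complete (hU.cauchySeq hx)
  classical
  let V' : Euc N → Euc N →L[ℝ] F := fun x => if hx : x ∈ s then (h1 x hx).choose else 0
  have hV' : ∀ x ∈ s, Tendsto (fun n => U' n x) atTop (nhds (V' x)) := by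
    intro x hx
    simp only [V', hx, dif_pos]
    exact (h1 x hx).choose_spec
  have hunif := hU.tendstoUniformlyOn_of_tendsto hV'
  refine ⟨V', hunif, fun x hx => ?_, ?_⟩
  · exact hasFDerivAt_of_tendstoUniformlyOn hs hunif (fun n x _ => hd n x) hlim hx
  · exact hunif.continuousOn (Eventually.of_forall fun n => (hc n).continuousOn).frequently

end Local

section Cauchy
variable {N : ℕ} {F : Type*} [NormedAddCommGroup F] [NormedSpace ℝ F]

theorem dil_eq_dil_of_le {g : Euc N → F} {a ε ε' : ℝ} (hε' : 0 < ε') (hle : ε' ≤ ε)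
    (hh : ∀ l : ℝ, 1 ≤ l → ∀ w : Euc N, 1 < ‖w‖ → g (l • w) = l ^ a • g w)
    {z : Euc N} (hz : ε < ‖z‖) : dil ε a g z = dil ε' a g z := by
  have hε : 0 < ε := hε'.trans_le hle
  have h1 : ε'⁻¹ • z = (ε / ε') • (ε⁻¹ • z) := by
    rw [smul_smul]; congr 1; field_simp
  have h2 : 1 < ‖ε⁻¹ • z‖ := by
    rw [norm_smul, norm_inv, Real.norm_of_nonneg hε.le, lt_inv_mul_iff₀ hε]; simpa using hz
  rw [dil, dil, h1, hh _ ((one_le_div hε').mpr hle) _ h2, smul_smul, Real.div_rpow hε.le hε'.le]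
  congr 1
  have : ε' ^ a ≠ 0 := by positivity
  field_simp

theorem dil_eq_dil {g : Euc N → F} {a ε ε' : ℝ} (hε : 0 < ε) (hε' : 0 < ε')
    (hh : ∀ l : ℝ, 1 ≤ l → ∀ w : Euc N, 1 < ‖w‖ → g (l • w) = l ^ a • g w)
    {z : Euc N} (hz : ε < ‖z‖) (hz' : ε' < ‖z‖) : dil ε a g z = dil ε' a g z := by
  rcases le_total ε' ε with h | h
  · exact dil_eq_dil_of_le hε' h hh hz
  · exact (dil_eq_dil_of_le hε h hh hz').symm

theorem continuous_dil {g : Euc N → F} (hg : Continuous g) (ε a : ℝ) :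
    Continuous (dil ε a g) := by
  unfold dil
  fun_prop

theorem contDiff_dil {g : Euc N → F} {n : WithTop ℕ∞} (hg : ContDiff ℝ n g) (ε a : ℝ) :
    ContDiff ℝ n (dil ε a g) := by
  have h1 : ContDiff ℝ n fun z : Euc N => ε⁻¹ • z := contDiff_id.const_smul ε⁻¹
  exact (hg.comp h1).const_smul (ε ^ a)

/-- The regularisation scales `1 / (n + 1)`. -/
def epsSeq (n : ℕ) : ℝ := 1 / ((n : ℝ) + 1)

theorem epsSeq_pos (n : ℕ) : 0 < epsSeq n := by unfold epsSeq; positivity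

theorem epsSeq_anti {m n : ℕ} (h : m ≤ n) : epsSeq n ≤ epsSeq m := Nat.one_div_le_one_div h

theorem epsSeq_tendsto : Tendsto epsSeq atTop (nhds 0) := tendsto_one_div_add_atTop_nhds_zero_nat

theorem hasCompactSupport_dil_sub {g : Euc N → F} {a ε ε' : ℝ} (hε : 0 < ε) (hε' : 0 < ε')
    (hh : ∀ l : ℝ, 1 ≤ l → ∀ w : Euc N, 1 < ‖w‖ → g (l • w) = l ^ a • g w) :
    HasCompactSupport (fun z => dil ε a g z - dil ε' a g z) := by
  refine HasCompactSupport.of_support_subset_isCompact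
    (isCompact_closedBall (0 : Euc N) (max ε ε')) fun z hz => ?_
  rw [mem_closedBall_zero_iff]
  by_contra! h
  exact hz (sub_eq_zero.mpr (dil_eq_dil hε hε' hh ((le_max_left _ _).trans_lt h)
    ((le_max_right _ _).trans_lt h)))

theorem uniformCauchySeqOn_conv_dil {f : Euc N → ℝ} (hN : 2 ≤ N) (hf : PotAdmissible f)
    {g : Euc N → F} {a C B γ δ : ℝ} (hgc : Continuous g) (hC : 0 ≤ C) (ha : a ≤ 2 - N)
    (hgb : ∀ z, ‖g z‖ ≤ C * ‖z‖ ^ a) (hg0 : ∀ z, ‖z‖ < 1 / 2 → g z = 0)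
    (hh : ∀ l : ℝ, 1 ≤ l → ∀ w : Euc N, 1 < ‖w‖ → g (l • w) = l ^ a • g w)
    (haγ : -(N:ℝ) < a + γ) (hB : 0 ≤ B) (hδ : 0 < δ) {s : Set (Euc N)} {c : Euc N → ℝ}
    (hc : ∀ x ∈ s, ∀ y, ‖x - y‖ ≤ δ → ‖f y - c x‖ ≤ B * ‖x - y‖ ^ γ)
    (hz : ∀ x ∈ s, ∀ ε > 0, ∀ ε' > 0, c x • ∫ z, (dil ε a g z - dil ε' a g z) = 0) :
    UniformCauchySeqOn (fun n x => ∫ y, f y • dil (epsSeq n) a g (x - y)) atTop s := by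
  have hp : (2 - N : ℝ) ≤ 0 := by have : (2:ℝ) ≤ N := by exact_mod_cast hN
                                  linarith
  have hlim := (ballMoment_tendsto hN haγ).const_mul (B * (2 * C))
  rw [mul_zero] at hlim
  rw [Metric.uniformCauchySeqOn_iff]
  intro η hη
  obtain ⟨M, hM1, hM2⟩ := ((hlim.eventually (gt_mem_nhds hη)).and
    (epsSeq_tendsto.eventually (gt_mem_nhds hδ))).exists
  refine ⟨M, fun m hm n hn x hx => ?_⟩
  have hinteg : ∀ n, Integrable (fun y => f y • dil (epsSeq n) a g (x - y)) := fun n => by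
    obtain ⟨C', hC', hb⟩ := norm_dil_le_decay (epsSeq_pos n) hC ha hp hgb hg0
    exact hf.integrable_smul hN (continuous_dil hgc _ _) hC' hb x
  let k : Euc N → F := fun z => dil (epsSeq m) a g z - dil (epsSeq n) a g z
  have hkc : Continuous k := (continuous_dil hgc _ _).sub (continuous_dil hgc _ _)
  have hki : Integrable k := hkc.integrable_of_hasCompactSupport
    (hasCompactSupport_dil_sub (epsSeq_pos m) (epsSeq_pos n) hh)
  have hsub : (∫ y, f y • dil (epsSeq m) a g (x - y)) - ∫ y, f y • dil (epsSeq n) a g (x - y)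
      = ∫ y, (f y - c x) • k (x - y) := by
    rw [← integral_sub (hinteg m) (hinteg n)]
    have h1 : ∫ y, c x • k (x - y) = 0 := by
      rw [integral_smul, integral_sub_left_eq_self k]
      exact hz x hx _ (epsSeq_pos m) _ (epsSeq_pos n)
    have h2 : Integrable (fun y => f y • k (x - y)) := by
      refine ((hinteg m).sub (hinteg n)).congr (Eventually.of_forall fun y => ?_)
      simp only [k, smul_sub, Pi.sub_apply]
    rw [← sub_zero (∫ y, (f y • dil (epsSeq m) a g (x - y) - f y • dil (epsSeq n) a g (x - y))),
      ← h1]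
    simp only [← smul_sub]
    change (∫ y, f y • k (x - y)) - _ = _
    have h3 : Integrable (fun y => c x • k (x - y)) := (hki.comp_sub_left x).smul (c x)
    rw [← integral_sub h2 h3]
    simp only [sub_smul]
  rw [dist_eq_norm, hsub]
  refine lt_of_le_of_lt (norm_integral_local_le hN (b := a) (γ := γ) (B := B) (C := 2 * C)
    (r := epsSeq M) hB (by positivity) haγ ?_ ?_ ?_) hM1
  · intro z
    calc ‖k z‖ ≤ C * ‖z‖ ^ a + C * ‖z‖ ^ a := (norm_sub_le _ _).trans
          (add_le_add (norm_dil_le (epsSeq_pos m) hgb z) (norm_dil_le (epsSeq_pos n) hgb z))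
      _ = _ := by ring
  · intro z hz
    exact sub_eq_zero.mpr (dil_eq_dil (epsSeq_pos m) (epsSeq_pos n) hh
      ((epsSeq_anti hm).trans_lt hz) ((epsSeq_anti hn).trans_lt hz))
  · intro y hy
    exact hc x hx y (hy.trans hM2.le)

end Cauchy

section Potential
variable {N : ℕ}

theorem regKer_bound (z : Euc N) : ‖regKer N z‖ ≤ 1 * ‖z‖ ^ (2 - N : ℝ) := by
  rw [regKer, norm_mul, Real.norm_of_nonneg (radCut_nonneg z), Real.norm_of_nonneg (by positivity)]
  exact mul_le_mul_of_nonneg_right (radCut_le_one z) (by positivity)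

/-- The regularised potentials. -/
def regPot (f : Euc N → ℝ) (n : ℕ) (x : Euc N) : ℝ :=
  ∫ y, f y • dil (epsSeq n) (2 - N : ℝ) (regKer N) (x - y)

theorem hasFDerivAt_regPot {f : Euc N → ℝ} (hN : 2 ≤ N) (hf : PotAdmissible f) (n : ℕ) (x : Euc N) :
    HasFDerivAt (regPot f n)
      (∫ y, f y • dil (epsSeq n) (2 - N - 1 : ℝ) (fderiv ℝ (regKer N)) (x - y)) x := by
  have hp : (2 - N : ℝ) ≤ 0 := by have : (2:ℝ) ≤ N := by exact_mod_cast hN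
                                  linarith
  obtain ⟨C1, hC1, hb1⟩ := norm_dil_le_decay (epsSeq_pos n) zero_le_one le_rfl hp
    (regKer_bound (N := N)) regKer_eq_zero
  obtain ⟨D, hD, hb⟩ := exists_bound_fderiv_regKer hN
  obtain ⟨C2, hC2, hb2⟩ := norm_dil_le_decay (epsSeq_pos n) hD (by linarith) hp hb
    (fderiv_eq_zero_of_ball regKer_eq_zero)
  have h := hf.hasFDerivAt_conv hN (K := dil (epsSeq n) (2 - N : ℝ) (regKer N)) ?_ hC1 hC2 hb1
    (by rw [fderiv_dil (epsSeq_pos n)]; exact hb2) x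
  · rw [fderiv_dil (epsSeq_pos n)] at h
    exact h
  · exact contDiff_dil ((contDiff_regKer N).of_le one_le_two) _ _

theorem hasFDerivAt_fderiv_regPot {f : Euc N → ℝ} (hN : 2 ≤ N) (hf : PotAdmissible f) (n : ℕ)
    (x : Euc N) :
    HasFDerivAt (fun x => ∫ y, f y • dil (epsSeq n) (2 - N - 1 : ℝ) (fderiv ℝ (regKer N)) (x - y))
      (∫ y, f y • dil (epsSeq n) (2 - N - 1 - 1 : ℝ) (fderiv ℝ (fderiv ℝ (regKer N))) (x - y))
      x := by
  have hp : (2 - N : ℝ) ≤ 0 := by have : (2:ℝ) ≤ N := by exact_mod_cast hN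
                                  linarith
  obtain ⟨D1, hD1, hd1⟩ := exists_bound_fderiv_regKer hN
  obtain ⟨C1, hC1, hb1⟩ := norm_dil_le_decay (epsSeq_pos n) hD1 (by linarith) hp hd1
    (fderiv_eq_zero_of_ball regKer_eq_zero)
  obtain ⟨D, hD, hb⟩ := exists_bound_fderiv_fderiv_regKer hN
  obtain ⟨C2, hC2, hb2⟩ := norm_dil_le_decay (epsSeq_pos n) hD (by linarith) hp hb
    (fderiv_eq_zero_of_ball (fderiv_eq_zero_of_ball regKer_eq_zero))
  have h := hf.hasFDerivAt_conv hN
    (K := dil (epsSeq n) (2 - N - 1 : ℝ) (fderiv ℝ (regKer N))) ?_ hC1 hC2 hb1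
    (by rw [fderiv_dil (epsSeq_pos n)]; exact hb2) x
  · rw [fderiv_dil (epsSeq_pos n)] at h
    exact h
  · exact contDiff_dil (contDiff_fderiv_regKer N) _ _

theorem continuous_fderiv_regPot {f : Euc N → ℝ} (hN : 2 ≤ N) (hf : PotAdmissible f) (n : ℕ) :
    Continuous
      (fun x => ∫ y, f y • dil (epsSeq n) (2 - N - 1 : ℝ) (fderiv ℝ (regKer N)) (x - y)) :=
  continuous_iff_continuousAt.mpr fun x => (hasFDerivAt_fderiv_regPot hN hf n x).continuousAt

theorem continuous_fderiv_fderiv_regPot {f : Euc N → ℝ} (hN : 2 ≤ N) (hf : PotAdmissible f)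
    (n : ℕ) :
    Continuous (fun x => ∫ y, f y •
      dil (epsSeq n) (2 - N - 1 - 1 : ℝ) (fderiv ℝ (fderiv ℝ (regKer N))) (x - y)) := by
  have hp : (2 - N : ℝ) ≤ 0 := by have : (2:ℝ) ≤ N := by exact_mod_cast hN
                                  linarith
  obtain ⟨D, hD, hb⟩ := exists_bound_fderiv_fderiv_regKer hN
  obtain ⟨C2, hC2, hb2⟩ := norm_dil_le_decay (epsSeq_pos n) hD (by linarith) hp hb
    (fderiv_eq_zero_of_ball (fderiv_eq_zero_of_ball regKer_eq_zero))
  exact hf.continuous_conv hN (continuous_dil (continuous_fderiv_fderiv_regKer N) _ _) hC2 hb2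

theorem measurable_newtKer (x : Euc N) : Measurable fun y : Euc N => ‖x - y‖ ^ (2 - N : ℝ) :=
  ((measurable_const.sub measurable_id).norm).pow_const _

/-- Comparison of the potential with its regularisation near a point where `f` is bounded. -/
theorem newtPot_sub_regPot {f : Euc N → ℝ} (hN : 2 ≤ N) (hf : PotAdmissible f)
    {x : Euc N} {M δ : ℝ} (hM : ∀ y, ‖x - y‖ ≤ δ → ‖f y‖ ≤ M) (n : ℕ) (hn : epsSeq n ≤ δ) :
    Integrable (fun y => f y * ‖x - y‖ ^ (2 - N : ℝ)) ∧
      ‖newtPot f x - regPot f n x‖ ≤ M * 2 * ballMoment N ((2 - N : ℝ) + 0) (epsSeq n) := by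
  have hp : (2 - N : ℝ) ≤ 0 := by have : (2:ℝ) ≤ N := by exact_mod_cast hN
                                  linarith
  have hM0 : 0 ≤ M := (norm_nonneg _).trans (hM x (by simpa using (epsSeq_pos n).le.trans hn))
  obtain ⟨C1, hC1, hb1⟩ := norm_dil_le_decay (epsSeq_pos n) zero_le_one le_rfl hp
    (regKer_bound (N := N)) regKer_eq_zero
  have hi := hf.integrable_smul hN (continuous_dil (contDiff_regKer N).continuous (epsSeq n) _)
    hC1 hb1 x
  let k : Euc N → ℝ := fun z => ‖z‖ ^ (2 - N : ℝ) - dil (epsSeq n) (2 - N : ℝ) (regKer N) z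
  have hk : ∀ z, ‖k z‖ ≤ 2 * ‖z‖ ^ (2 - N : ℝ) := fun z => by
    have h1 := dil_regKer_nonneg (epsSeq_pos n) z
    have h2 := dil_regKer_le (epsSeq_pos n) z
    rw [Real.norm_of_nonneg (sub_nonneg.mpr h2)]
    linarith
  have hk0 : ∀ z, epsSeq n < ‖z‖ → k z = 0 := fun z hz =>
    sub_eq_zero.mpr (dil_regKer_eq (epsSeq_pos n) hz.le).symm
  have hc : ∀ y, ‖x - y‖ ≤ epsSeq n → ‖f y‖ ≤ M * ‖x - y‖ ^ (0:ℝ) := fun y hy => by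
    rw [Real.rpow_zero, mul_one]; exact hM y (hy.trans hn)
  have hm : AEStronglyMeasurable (fun y => f y • k (x - y)) volume :=
    hf.1.smul ((measurable_newtKer x).aestronglyMeasurable.sub
      ((continuous_dil (contDiff_regKer N).continuous _ _).comp
        (continuous_const.sub continuous_id)).aestronglyMeasurable)
  have hb : -(N:ℝ) < (2 - N : ℝ) + 0 := by linarith
  have hik := integrable_of_local hN hM0 zero_le_two hb hm hk hk0 hc
  have hiΓ : Integrable (fun y => f y * ‖x - y‖ ^ (2 - N : ℝ)) := by
    refine (hi.add hik).congr (Eventually.of_forall fun y => ?_)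
    simp only [k, Pi.add_apply, smul_eq_mul]
    ring
  refine ⟨hiΓ, ?_⟩
  have := norm_integral_local_le hN hM0 zero_le_two hb hk hk0 hc
  rw [newtPot, regPot, ← integral_sub hiΓ hi]
  refine le_trans (le_of_eq ?_) this
  congr 2
  ext y
  simp only [k, smul_eq_mul]
  ring

theorem regPot_tendsto {f : Euc N → ℝ} (hN : 2 ≤ N) (hf : PotAdmissible f)
    {x : Euc N} {M δ : ℝ} (hδ : 0 < δ) (hM : ∀ y, ‖x - y‖ ≤ δ → ‖f y‖ ≤ M) :
    Tendsto (fun n => regPot f n x) atTop (nhds (newtPot f x)) := by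
  have h1 := (ballMoment_tendsto hN (b := (2 - N : ℝ) + 0) (by linarith)).const_mul (M * 2)
  rw [mul_zero] at h1
  rw [tendsto_iff_norm_sub_tendsto_zero]
  refine squeeze_zero' (Eventually.of_forall fun n => norm_nonneg _) ?_ h1
  filter_upwards [epsSeq_tendsto.eventually (gt_mem_nhds hδ)] with n hn
  rw [norm_sub_rev]
  exact (newtPot_sub_regPot hN hf hM n hn.le).2

theorem integrable_newtKer_mul {f : Euc N → ℝ} (hN : 2 ≤ N) (hf : PotAdmissible f)
    {x : Euc N} {M δ : ℝ} (hδ : 0 < δ) (hM : ∀ y, ‖x - y‖ ≤ δ → ‖f y‖ ≤ M) :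
    Integrable (fun y => f y * ‖x - y‖ ^ (2 - N : ℝ)) := by
  obtain ⟨n, hn⟩ := (epsSeq_tendsto.eventually (gt_mem_nhds hδ)).exists
  exact (newtPot_sub_regPot hN hf hM n hn.le).1

theorem exists_fderiv_newtPot {f : Euc N → ℝ} (hN : 2 ≤ N) (hf : PotAdmissible f)
    {s : Set (Euc N)} (hs : IsOpen s) {M δ : ℝ} (hδ : 0 < δ) (hM0 : 0 ≤ M)
    (hM : ∀ x ∈ s, ∀ y, ‖x - y‖ ≤ δ → ‖f y‖ ≤ M) :
    ∃ V' : Euc N → Euc N →L[ℝ] ℝ,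
      TendstoUniformlyOn (fun n x => ∫ y, f y •
        dil (epsSeq n) (2 - N - 1 : ℝ) (fderiv ℝ (regKer N)) (x - y)) V' atTop s ∧
      (∀ x ∈ s, HasFDerivAt (newtPot f) (V' x) x) ∧ ContinuousOn V' s := by
  obtain ⟨D, hD, hb⟩ := exists_bound_fderiv_regKer hN
  refine exists_fderiv_of_uniformCauchySeqOn hs (hasFDerivAt_regPot hN hf)
    (continuous_fderiv_regPot hN hf) (fun x hx => regPot_tendsto hN hf hδ (hM x hx))
    (uniformCauchySeqOn_conv_dil hN hf (contDiff_fderiv_regKer N).continuous hD (by linarith) hb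
      (fderiv_eq_zero_of_ball regKer_eq_zero) (fderiv_homogeneous regKer_homogeneous)
      (γ := 0) (by linarith) hM0 hδ (c := fun _ => 0) ?_ ?_)
  · intro x hx y hy
    simpa using hM x hx y hy
  · intros; simp

theorem contDiffAt_one_newtPot {f : Euc N → ℝ} (hN : 2 ≤ N) (hf : PotAdmissible f)
    {x₀ : Euc N} {M δ : ℝ} (hδ : 0 < δ) (hM : ∀ y ∈ ball x₀ δ, ‖f y‖ ≤ M) :
    ContDiffAt ℝ 1 (newtPot f) x₀ := by
  have hM0 : 0 ≤ M := (norm_nonneg _).trans (hM x₀ (mem_ball_self hδ))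
  obtain ⟨V', -, h2, h3⟩ := exists_fderiv_newtPot hN hf (s := ball x₀ (δ / 2)) isOpen_ball
    (δ := δ / 3) (by positivity) hM0 (M := M) (fun x hx y hy => hM y (by
      have h1 : dist x x₀ < δ / 2 := hx
      have h2 : dist y x ≤ δ / 3 := by rw [dist_comm, dist_eq_norm]; exact hy
      have := dist_triangle y x x₀
      exact mem_ball.mpr (by linarith)))
  have h : ContDiffAt ℝ (((0 : ℕ) : WithTop ℕ∞) + 1) (newtPot f) x₀ := by
    rw [contDiffAt_succ_iff_hasFDerivAt]
    refine ⟨V', ⟨_, ball_mem_nhds x₀ (half_pos hδ), fun x hx => h2 x hx⟩, ?_⟩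
    exact contDiffAt_zero.mpr ⟨_, ball_mem_nhds x₀ (half_pos hδ), h3⟩
  simpa using h

/-- Minus the Laplacian mass of the Newtonian kernel. -/
def newtConst (N : ℕ) : ℝ := -∫ z : Euc N, bilinTrace (fderiv ℝ (fderiv ℝ (regKer N)) z)

/-- The trace of a bilinear form, as a continuous linear map. -/
def bilinTraceCLM (N : ℕ) : (Euc N →L[ℝ] Euc N →L[ℝ] ℝ) →L[ℝ] ℝ where
  toFun := bilinTrace
  map_add' A B := by simp [bilinTrace, Finset.sum_add_distrib]
  map_smul' c A := by simp [bilinTrace, Finset.mul_sum]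
  cont := continuous_bilinTrace

theorem norm_bilinTrace_le (B : Euc N →L[ℝ] Euc N →L[ℝ] ℝ) : ‖bilinTrace B‖ ≤ N * ‖B‖ := by
  have h : ∀ i : Fin N, ‖B (coordVec i) (coordVec i)‖ ≤ ‖B‖ := fun i => by
    have := B.le_opNorm₂ (coordVec i) (coordVec i)
    simpa [coordVec] using this
  calc ‖bilinTrace B‖ ≤ ∑ i : Fin N, ‖B (coordVec i) (coordVec i)‖ := norm_sum_le _ _
    _ ≤ ∑ _i : Fin N, ‖B‖ := Finset.sum_le_sum fun i _ => h i
    _ = N * ‖B‖ := by simp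

theorem bilinTrace_regKer_eq_zero {z : Euc N} (hz : 1 < ‖z‖) :
    bilinTrace (fderiv ℝ (fderiv ℝ (regKer N)) z) = 0 := by
  have hz0 : z ≠ 0 := by rintro rfl; simp at hz; linarith
  rw [← lap_eq_bilinTrace ((contDiff_fderiv_regKer N).differentiable (by simp) z)]
  have : regKer N =ᶠ[nhds z] fun z => ‖z‖ ^ (2 - N : ℝ) := by
    filter_upwards [(isOpen_lt continuous_const continuous_norm).mem_nhds hz] with y hy
    rw [regKer, radCut_eq_one (le_of_lt hy), one_mul]
  rw [lap_congr this, lap_norm_rpow _ hz0]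
  ring

theorem integral_fderiv_fderiv_dil_sub (N : ℕ) {ε ε' : ℝ} (hε : 0 < ε) (hε' : 0 < ε') :
    ∫ z : Euc N, (dil ε (2 - N - 1 - 1 : ℝ) (fderiv ℝ (fderiv ℝ (regKer N))) z -
      dil ε' (2 - N - 1 - 1 : ℝ) (fderiv ℝ (fderiv ℝ (regKer N))) z) = 0 := by
  have hcd : ∀ ε : ℝ, ContDiff ℝ 1 (dil ε (2 - N - 1 : ℝ) (fderiv ℝ (regKer N))) := fun ε =>
    contDiff_dil (contDiff_fderiv_regKer N) _ _
  have h := integral_fderiv_eq_zero_of_hasCompactSupport ((hcd ε).sub (hcd ε'))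
    (hasCompactSupport_dil_sub hε hε' (g := fderiv ℝ (regKer N))
      (fderiv_homogeneous regKer_homogeneous))
  rw [← h]
  congr 1
  ext1 z
  rw [← fderiv_dil hε, ← fderiv_dil hε']
  exact (fderiv_fun_sub ((hcd ε).differentiable (by simp) z)
    ((hcd ε').differentiable (by simp) z)).symm

theorem contDiffAt_two_newtPot {f : Euc N → ℝ} (hN : 2 ≤ N) (hf : PotAdmissible f)
    {x₀ : Euc N} {H γ δ : ℝ} (hδ : 0 < δ) (hγ : 0 < γ)
    (hH : ∀ x ∈ ball x₀ δ, ∀ y ∈ ball x₀ δ, ‖f y - f x‖ ≤ H * ‖x - y‖ ^ γ) :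
    ContDiffAt ℝ 2 (newtPot f) x₀ ∧ lap (newtPot f) x₀ = -newtConst N * f x₀ := by
  have hball : ∀ x ∈ ball x₀ (δ / 2), ∀ y, ‖x - y‖ ≤ δ / 3 → y ∈ ball x₀ δ := fun x hx y hy => by
    have h1 : dist x x₀ < δ / 2 := hx
    have h2 : dist y x ≤ δ / 3 := by rw [dist_comm, dist_eq_norm]; exact hy
    have := dist_triangle y x x₀
    exact mem_ball.mpr (by linarith)
  have hsub : ∀ x ∈ ball x₀ (δ / 2), x ∈ ball x₀ δ := fun x hx => ball_subset_ball (by linarith) hx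
  have hH' : ∀ x ∈ ball x₀ δ, ∀ y ∈ ball x₀ δ, ‖f y - f x‖ ≤ |H| * ‖x - y‖ ^ γ :=
    fun x hx y hy => (hH x hx y hy).trans (by gcongr; exact le_abs_self H)
  have hM : ∀ y ∈ ball x₀ δ, ‖f y‖ ≤ ‖f x₀‖ + |H| * δ ^ γ := fun y hy => by
    have h1 := hH' x₀ (mem_ball_self hδ) y hy
    have h2 : ‖x₀ - y‖ ^ γ ≤ δ ^ γ := by
      refine Real.rpow_le_rpow (norm_nonneg _) ?_ hγ.le
      rw [← dist_eq_norm, dist_comm]; exact (mem_ball.mp hy).le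
    have h3 : ‖f y‖ ≤ ‖f x₀‖ + ‖f y - f x₀‖ := by
      calc ‖f y‖ = ‖f x₀ + (f y - f x₀)‖ := by congr 1; ring
        _ ≤ _ := norm_add_le _ _
    have h4 : |H| * ‖x₀ - y‖ ^ γ ≤ |H| * δ ^ γ := by gcongr
    linarith
  obtain ⟨V', h1, h2, h3⟩ := exists_fderiv_newtPot hN hf (s := ball x₀ (δ / 2)) isOpen_ball
    (δ := δ / 3) (by positivity) (by positivity) (M := ‖f x₀‖ + |H| * δ ^ γ)
    (fun x hx y hy => hM y (hball x hx y hy))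
  obtain ⟨D, hD, hb⟩ := exists_bound_fderiv_fderiv_regKer hN
  have hb0 := fderiv_eq_zero_of_ball (fderiv_eq_zero_of_ball (regKer_eq_zero (N := N)))
  have hbh := fderiv_homogeneous (g := fderiv ℝ (regKer N)) (fderiv_homogeneous regKer_homogeneous)
  obtain ⟨V'', h1', h2', h3'⟩ := exists_fderiv_of_uniformCauchySeqOn (s := ball x₀ (δ / 2))
    isOpen_ball (hasFDerivAt_fderiv_regPot hN hf) (continuous_fderiv_fderiv_regPot hN hf)
    (fun x hx => h1.tendsto_at hx)
    (uniformCauchySeqOn_conv_dil hN hf (continuous_fderiv_fderiv_regKer N) hD (by linarith) hb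
      hb0 hbh (γ := γ) (by linarith) (abs_nonneg H) (by positivity : 0 < δ / 3) (c := f)
      (fun x hx y hy => hH' x (hsub x hx) y (hball x hx y hy))
      (fun x hx ε hε ε' hε' => by rw [integral_fderiv_fderiv_dil_sub N hε hε', smul_zero]))
  have hmem := ball_mem_nhds x₀ (half_pos hδ)
  have hVC1 : ContDiffAt ℝ 1 V' x₀ := by
    have h : ContDiffAt ℝ (((0 : ℕ) : WithTop ℕ∞) + 1) V' x₀ := by
      rw [contDiffAt_succ_iff_hasFDerivAt]
      exact ⟨V'', ⟨_, hmem, fun x hx => h2' x hx⟩, contDiffAt_zero.mpr ⟨_, hmem, h3'⟩⟩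
    simpa using h
  refine ⟨?_, ?_⟩
  · have h : ContDiffAt ℝ (((1 : ℕ) : WithTop ℕ∞) + 1) (newtPot f) x₀ := by
      rw [contDiffAt_succ_iff_hasFDerivAt]
      exact ⟨V', ⟨_, hmem, fun x hx => h2 x hx⟩, by simpa using hVC1⟩
    simpa only [Nat.cast_one, one_add_one_eq_two] using h
  have hx₀ : x₀ ∈ ball x₀ (δ / 2) := mem_ball_self (half_pos hδ)
  have hfd : fderiv ℝ (newtPot f) =ᶠ[nhds x₀] V' := by
    filter_upwards [hmem] with x hx
    exact (h2 x hx).fderiv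
  have hfd2 : HasFDerivAt (fderiv ℝ (newtPot f)) (V'' x₀) x₀ :=
    (h2' x₀ hx₀).congr_of_eventuallyEq hfd
  rw [lap_eq_bilinTrace hfd2.differentiableAt, hfd2.fderiv]
  -- identify the limit of the traces
  have ht1 : Tendsto (fun n => bilinTrace (∫ y, f y • dil (epsSeq n) (2 - N - 1 - 1 : ℝ)
      (fderiv ℝ (fderiv ℝ (regKer N))) (x₀ - y))) atTop (nhds (bilinTrace (V'' x₀))) :=
    (continuous_bilinTrace.tendsto _).comp (h1'.tendsto_at hx₀)
  refine tendsto_nhds_unique ht1 ?_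
  let q : Euc N → ℝ := fun z => bilinTrace (fderiv ℝ (fderiv ℝ (regKer N)) z)
  have hq : Continuous q := continuous_bilinTrace.comp (continuous_fderiv_fderiv_regKer N)
  have hq0 : ∀ z, 1 < ‖z‖ → q z = 0 := fun z hz => bilinTrace_regKer_eq_zero hz
  have hqs : ∀ ε > 0, ∀ z, ε < ‖z‖ → dil ε (2 - N - 1 - 1 : ℝ) q z = 0 := fun ε hε z hz => by
    rw [dil, hq0, smul_zero]
    rw [norm_smul, norm_inv, Real.norm_of_nonneg hε.le, lt_inv_mul_iff₀ hε]; simpa using hz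
  have hqb : ∀ z, ‖q z‖ ≤ (N:ℝ) * D * ‖z‖ ^ (2 - N - 1 - 1 : ℝ) := fun z => by
    rw [mul_assoc]
    exact (norm_bilinTrace_le _).trans (by gcongr; exact hb z)
  have hqi : ∀ ε > 0, Integrable (dil ε (2 - N - 1 - 1 : ℝ) q) := fun ε hε =>
    (continuous_dil hq _ _).integrable_of_hasCompactSupport
      (HasCompactSupport.of_support_subset_isCompact (isCompact_closedBall (0 : Euc N) ε)
        fun z hz => by
          rw [mem_closedBall_zero_iff]
          by_contra! h
          exact hz (hqs ε hε z h))
  have hqint : ∀ ε > 0, ∫ z, dil ε (2 - N - 1 - 1 : ℝ) q z = -newtConst N := fun ε hε => by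
    unfold dil
    rw [integral_smul, Measure.integral_comp_smul, finrank_euclideanSpace, Fintype.card_fin,
      smul_smul, newtConst, neg_neg]
    have : ε ^ (2 - N - 1 - 1 : ℝ) * |(ε⁻¹ ^ N)⁻¹| = 1 := by
      rw [show (2 - N - 1 - 1 : ℝ) = -(N : ℝ) by ring, Real.rpow_neg hε.le, Real.rpow_natCast,
        abs_of_pos (by positivity), inv_pow, inv_inv, inv_mul_cancel₀ (by positivity)]
    rw [this, one_smul]
  have hp : (2 - N : ℝ) ≤ 0 := by have : (2:ℝ) ≤ N := by exact_mod_cast hN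
                                  linarith
  have key : ∀ n, epsSeq n ≤ δ / 3 → ‖bilinTrace (∫ y, f y • dil (epsSeq n) (2 - N - 1 - 1 : ℝ)
      (fderiv ℝ (fderiv ℝ (regKer N))) (x₀ - y)) - -newtConst N * f x₀‖ ≤
      |H| * ((N:ℝ) * D) * ballMoment N ((2 - N - 1 - 1 : ℝ) + γ) (epsSeq n) := by
    intro n hn
    obtain ⟨C', hC', hb'⟩ := norm_dil_le_decay (epsSeq_pos n) hD (by linarith) hp hb hb0
    have hi := hf.integrable_smul hN
      (continuous_dil (continuous_fderiv_fderiv_regKer N) (epsSeq n) _) hC' hb' x₀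
    have e1 : bilinTrace (∫ y, f y • dil (epsSeq n) (2 - N - 1 - 1 : ℝ)
        (fderiv ℝ (fderiv ℝ (regKer N))) (x₀ - y)) =
        ∫ y, f y • dil (epsSeq n) (2 - N - 1 - 1 : ℝ) q (x₀ - y) := by
      have := (bilinTraceCLM N).integral_comp_comm hi
      refine this.symm.trans ?_
      congr 1
      ext y
      rw [map_smul, dil, map_smul]
      rfl
    have hi2 : Integrable (fun y => f y • dil (epsSeq n) (2 - N - 1 - 1 : ℝ) q (x₀ - y)) := by
      refine ((bilinTraceCLM N).integrable_comp hi).congr (Eventually.of_forall fun y => ?_)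
      simp only [map_smul, dil]
      rfl
    have hi3 : Integrable (fun y => f x₀ • dil (epsSeq n) (2 - N - 1 - 1 : ℝ) q (x₀ - y)) :=
      ((hqi _ (epsSeq_pos n)).comp_sub_left x₀).smul (f x₀)
    have e2 : -newtConst N * f x₀ =
        ∫ y, f x₀ • dil (epsSeq n) (2 - N - 1 - 1 : ℝ) q (x₀ - y) := by
      rw [integral_smul, integral_sub_left_eq_self (dil (epsSeq n) (2 - N - 1 - 1 : ℝ) q),
        hqint _ (epsSeq_pos n), smul_eq_mul, mul_comm]
    rw [e1, e2, ← integral_sub hi2 hi3]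
    simp only [← sub_smul]
    exact norm_integral_local_le hN (abs_nonneg H) (by positivity) (by linarith)
      (norm_dil_le (epsSeq_pos n) hqb) (hqs _ (epsSeq_pos n))
      (fun y hy => hH' x₀ (mem_ball_self hδ) y (hball x₀ hx₀ y (hy.trans hn)))
  have hlim := (ballMoment_tendsto hN (b := (2 - N - 1 - 1 : ℝ) + γ) (by linarith)).const_mul
    (|H| * ((N:ℝ) * D))
  rw [mul_zero] at hlim
  rw [tendsto_iff_norm_sub_tendsto_zero]
  refine squeeze_zero' (Eventually.of_forall fun n => norm_nonneg _) ?_ hlim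
  filter_upwards [epsSeq_tendsto.eventually (gt_mem_nhds (by positivity : 0 < δ / 3))] with n hn
  exact key n hn.le

end Potential

/-- `f` is Hölder continuous, with some exponent, near `x`. -/
def HolderNear {N : ℕ} (f : Euc N → ℝ) (x : Euc N) : Prop :=
  ∃ γ : ℝ, 0 < γ ∧ ∃ δ : ℝ, 0 < δ ∧ ∃ H : ℝ, 0 ≤ H ∧ ∀ y ∈ ball x δ, ∀ z ∈ ball x δ, |f y - f z| ≤ H * dist y z ^ γ

section Holder
variable {N : ℕ} {f g : Euc N → ℝ} {x : Euc N}

theorem LocHolderOn.holderNear {γ : ℝ} (hγ : 0 < γ) (h : LocHolderOn γ {x : Euc N | x ≠ 0} f)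
    (hx : x ≠ 0) : HolderNear f x := by
  obtain ⟨ε, hε, C, hC, hf⟩ := h x hx
  have hs : ∀ y ∈ ball x (min ε ‖x‖), y ∈ ball x ε ∩ {x : Euc N | x ≠ 0} := fun y hy => by
    refine ⟨ball_subset_ball (min_le_left _ _) hy, fun h0 => ?_⟩
    rw [h0, mem_ball, dist_zero_left] at hy
    exact absurd (hy.trans_le (min_le_right _ _)) (lt_irrefl _)
  exact ⟨γ, hγ, min ε ‖x‖, lt_min hε (norm_pos_iff.mpr hx), C, hC.le,
    fun y hy z hz => hf y (hs y hy) z (hs z hz)⟩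

theorem ContDiffAt.holderNear (h : ContDiffAt ℝ 1 f x) : HolderNear f x := by
  obtain ⟨K, t, ht, hK⟩ := h.exists_lipschitzOnWith
  obtain ⟨δ, hδ, hs⟩ := Metric.mem_nhds_iff.mp ht
  refine ⟨1, one_pos, δ, hδ, K, K.2, fun y hy z hz => ?_⟩
  rw [Real.rpow_one, ← Real.dist_eq]
  exact hK.dist_le_mul y (hs hy) z (hs hz)

theorem HolderNear.continuousAt (h : HolderNear f x) : ContinuousAt f x := by
  obtain ⟨γ, hγ, δ, hδ, H, hH, hf⟩ := h
  rw [ContinuousAt, tendsto_iff_norm_sub_tendsto_zero]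
  have h1 : Tendsto (fun y => H * dist y x ^ γ) (nhds x) (nhds (H * 0 ^ γ)) := by
    have : Tendsto (fun y => dist y x) (nhds x) (nhds 0) := by
      simpa using (continuous_id.dist (continuous_const (y := x))).tendsto x
    exact (this.rpow_const (Or.inr hγ.le)).const_mul H
  rw [Real.zero_rpow hγ.ne', mul_zero] at h1
  refine squeeze_zero' (Eventually.of_forall fun _ => norm_nonneg _) ?_ h1
  filter_upwards [ball_mem_nhds x hδ] with y hy
  exact hf y hy x (mem_ball_self hδ)

theorem HolderNear.mul (hf : HolderNear f x) (hg : HolderNear g x) :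
    HolderNear (fun y => f y * g y) x := by
  have hfc := hf.continuousAt
  have hgc := hg.continuousAt
  obtain ⟨γ₁, hγ₁, δ₁, hδ₁, H₁, hH₁, hf⟩ := hf
  obtain ⟨γ₂, hγ₂, δ₂, hδ₂, H₂, hH₂, hg⟩ := hg
  obtain ⟨δ₃, hδ₃, h3⟩ := Metric.mem_nhds_iff.mp
    ((hfc.norm.eventually (gt_mem_nhds (lt_add_one ‖f x‖))).and
      (hgc.norm.eventually (gt_mem_nhds (lt_add_one ‖g x‖))))
  refine ⟨min γ₁ γ₂, lt_min hγ₁ hγ₂, min (min δ₁ δ₂) (min δ₃ (1 / 2)), by positivity,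
    (‖f x‖ + 1) * H₂ + (‖g x‖ + 1) * H₁, by positivity, fun y hy z hz => ?_⟩
  simp only [mem_ball, lt_min_iff] at hy hz
  have hd : dist y z ≤ 1 := by
    have := dist_triangle_right y z x
    linarith [hy.2.2, hz.2.2]
  have e1 : dist y z ^ γ₁ ≤ dist y z ^ min γ₁ γ₂ := by
    rcases (dist_nonneg (x := y) (y := z)).eq_or_lt with h | h
    · rw [← h, Real.zero_rpow hγ₁.ne', Real.zero_rpow (lt_min hγ₁ hγ₂).ne']
    · exact Real.rpow_le_rpow_of_exponent_ge h hd (min_le_left _ _)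
  have e2 : dist y z ^ γ₂ ≤ dist y z ^ min γ₁ γ₂ := by
    rcases (dist_nonneg (x := y) (y := z)).eq_or_lt with h | h
    · rw [← h, Real.zero_rpow hγ₂.ne', Real.zero_rpow (lt_min hγ₁ hγ₂).ne']
    · exact Real.rpow_le_rpow_of_exponent_ge h hd (min_le_right _ _)
  have a1 : |f y| ≤ ‖f x‖ + 1 := (h3 (mem_ball.mpr hy.2.1)).1.le
  have a2 : |g z| ≤ ‖g x‖ + 1 := (h3 (mem_ball.mpr hz.2.1)).2.le
  have b1 := (hf y hy.1.1 z hz.1.1).trans (mul_le_mul_of_nonneg_left e1 hH₁)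
  have b2 := (hg y hy.1.2 z hz.1.2).trans (mul_le_mul_of_nonneg_left e2 hH₂)
  calc |f y * g y - f z * g z| = |f y * (g y - g z) + g z * (f y - f z)| := by congr 1; ring
    _ ≤ |f y| * |g y - g z| + |g z| * |f y - f z| := by
      rw [← abs_mul, ← abs_mul]; exact abs_add_le _ _
    _ ≤ (‖f x‖ + 1) * (H₂ * dist y z ^ min γ₁ γ₂) + (‖g x‖ + 1) * (H₁ * dist y z ^ min γ₁ γ₂) := by
      gcongr
    _ = _ := by ring

theorem HolderNear.const_mul (hf : HolderNear f x) (c : ℝ) : HolderNear (fun y => c * f y) x :=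
  HolderNear.mul (f := fun _ => c) contDiffAt_const.holderNear hf

theorem aestronglyMeasurable_of_continuousAt (hN : 1 ≤ N)
    (h : ∀ x : Euc N, x ≠ 0 → ContinuousAt f x) : AEStronglyMeasurable f volume := by
  have : Nonempty (Fin N) := ⟨⟨0, by omega⟩⟩
  have h1 : ContinuousOn f {(0 : Euc N)}ᶜ := fun x hx => (h x hx).continuousWithinAt
  have h2 := h1.aestronglyMeasurable (μ := volume) (measurableSet_singleton _).compl
  rwa [restrict_compl_singleton] at h2

end Holder

section Newton
variable {N : ℕ}

theorem HolderNear.newtPot {f : Euc N → ℝ} {x : Euc N} (hN : 2 ≤ N) (hf : PotAdmissible f)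
    (h : HolderNear f x) :
    ContDiffAt ℝ 2 (newtPot f) x ∧ lap (newtPot f) x = -newtConst N * f x := by
  obtain ⟨γ, hγ, δ, hδ, H, hH, hf'⟩ := h
  refine contDiffAt_two_newtPot (H := H) hN hf hδ hγ fun y hy z hz => ?_
  have := hf' z hz y hy
  rwa [dist_comm, dist_eq_norm] at this

/-- Minimum principle on the punctured space, under power lower bounds at `0` and at infinity. -/
theorem nonneg_of_lap_nonpos_of_le {h : Euc N → ℝ} {c c' C C' r R : ℝ} (hN : 3 ≤ N)
    (hc : 2 - (N:ℝ) < c) (hc' : c' < 0) (hr : 0 < r)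
    (hC : ∀ x : Euc N, x ≠ 0 → ContDiffAt ℝ 2 h x)
    (hlap : ∀ x : Euc N, x ≠ 0 → lap h x ≤ 0)
    (h0 : ∀ x : Euc N, x ≠ 0 → ‖x‖ < r → -(C * ‖x‖ ^ c) ≤ h x)
    (hinf : ∀ x : Euc N, R < ‖x‖ → -(C' * ‖x‖ ^ c') ≤ h x) :
    ∀ x : Euc N, x ≠ 0 → 0 ≤ h x := by
  have hp : (2 - N : ℝ) < 0 := by have : (3:ℝ) ≤ N := by exact_mod_cast hN
                                  linarith
  obtain ⟨a, ha1, ha2⟩ := exists_between (lt_min hc hp)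
  obtain ⟨b, hb1, hb2⟩ := exists_between (max_lt hc' hp)
  rw [lt_min_iff] at ha2
  rw [max_lt_iff] at hb1
  refine nonneg_of_lap_nonpos ha1 ha2.2 hb1.2 hb2 hC hlap fun ε hε => ?_
  have t1 : Tendsto (fun t : ℝ => C * t ^ (c - a)) (nhds 0) (nhds 0) := by
    have := ((Real.continuousAt_rpow_const 0 (c - a) (Or.inr (by linarith))).tendsto).const_mul C
    rwa [Real.zero_rpow (by linarith), mul_zero] at this
  have t2 : Tendsto (fun t : ℝ => C' * t ^ (-(b - c'))) atTop (nhds 0) := by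
    have := (tendsto_rpow_neg_atTop (y := b - c') (by linarith)).const_mul C'
    rwa [mul_zero] at this
  obtain ⟨r', hr', h1⟩ := Metric.mem_nhds_iff.mp (t1.eventually (gt_mem_nhds hε))
  obtain ⟨R', h2⟩ := eventually_atTop.mp (t2.eventually (gt_mem_nhds hε))
  refine ⟨min r r', lt_min hr hr', max R R', fun x hx hx' => ?_⟩
  have hxp : 0 < ‖x‖ := norm_pos_iff.mpr hx
  have pa : 0 < ‖x‖ ^ a := by positivity
  have pb : 0 < ‖x‖ ^ b := by positivity
  rcases hx' with h | h
  · rw [lt_min_iff] at h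
    refine le_trans ?_ (h0 x hx h.1)
    have e1 : C * ‖x‖ ^ (c - a) < ε := h1 (by simpa using h.2)
    have e2 : C * ‖x‖ ^ c = C * ‖x‖ ^ (c - a) * ‖x‖ ^ a := by
      rw [mul_assoc, ← Real.rpow_add hxp]; ring_nf
    rw [e2]
    nlinarith
  · rw [max_lt_iff] at h
    refine le_trans ?_ (hinf x h.1)
    have e1 : C' * ‖x‖ ^ (-(b - c')) < ε := h2 _ h.2.le
    have e2 : C' * ‖x‖ ^ c' = C' * ‖x‖ ^ (-(b - c')) * ‖x‖ ^ b := by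
      rw [mul_assoc, ← Real.rpow_add hxp]; ring_nf
    rw [e2]
    nlinarith

theorem potAdmissible_of_hasCompactSupport {f : Euc N → ℝ} (hf : Continuous f)
    (hc : HasCompactSupport f) : PotAdmissible f := by
  refine ⟨hf.aestronglyMeasurable, ?_⟩
  have h1 : Continuous fun y : Euc N => (1 + ‖y‖) ^ (2 - N : ℝ) :=
    (continuous_const.add continuous_norm).rpow_const fun y => Or.inl (by positivity : (0:ℝ) < 1 + ‖y‖).ne'
  exact (h1.mul hf).integrable_of_hasCompactSupport hc.mul_left

theorem newtPot_le_of_hasCompactSupport {f : Euc N → ℝ} (hN : 3 ≤ N) (hf : Continuous f)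
    (hc : HasCompactSupport f) :
    ∃ C r R : ℝ, 0 < r ∧ 0 ≤ R ∧ (∀ x : Euc N, ‖x‖ < r → newtPot f x ≤ C) ∧
      ∀ x : Euc N, R < ‖x‖ → newtPot f x ≤ C * ‖x‖ ^ (2 - N : ℝ) := by
  have hp : (2 - N : ℝ) < 0 := by have : (3:ℝ) ≤ N := by exact_mod_cast hN
                                  linarith
  have had := potAdmissible_of_hasCompactSupport hf hc
  obtain ⟨M, hM⟩ := hc.exists_bound_of_continuous hf
  have hcont : ContinuousAt (newtPot f) 0 :=
    (contDiffAt_one_newtPot (by omega) had one_pos (fun y _ => hM y)).continuousAt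
  obtain ⟨r, hr, h1⟩ := Metric.mem_nhds_iff.mp
    (hcont.eventually (gt_mem_nhds (lt_add_one (newtPot f 0))))
  obtain ⟨R, hR⟩ := hc.isCompact.isBounded.subset_closedBall (0 : Euc N)
  have hi : Integrable f := hf.integrable_of_hasCompactSupport hc
  let D := (∫ y, ‖f y‖) * (1 / 2) ^ (2 - N : ℝ)
  refine ⟨max (newtPot f 0 + 1) D, r, max (2 * R) 0, hr, le_max_right _ _, fun x hx => ?_, fun x hx => ?_⟩
  · exact (le_of_lt (h1 (by simpa using hx))).trans (le_max_left _ _)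
  · rw [max_lt_iff] at hx
    have hx0 := hx.2
    refine le_trans ?_ (mul_le_mul_of_nonneg_right (le_max_right _ _) (by positivity))
    have hb : ∀ y, f y * ‖x - y‖ ^ (2 - N : ℝ) ≤ ‖f y‖ * ((1 / 2) ^ (2 - N : ℝ) * ‖x‖ ^ (2 - N : ℝ)) := by
      intro y
      by_cases hy : f y = 0
      · simp [hy]
      · have hyR : ‖y‖ ≤ R := by
          simpa using hR (subset_tsupport f hy)
        have hxy : 1 / 2 * ‖x‖ ≤ ‖x - y‖ := by
          have := norm_sub_norm_le x y
          linarith [hx.1]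
        rw [← Real.mul_rpow (by norm_num) hx0.le]
        refine mul_le_mul (le_abs_self _) ?_ (by positivity) (norm_nonneg _)
        exact Real.rpow_le_rpow_of_nonpos (by positivity) hxy hp.le
    calc newtPot f x ≤ ∫ y, ‖f y‖ * ((1 / 2) ^ (2 - N : ℝ) * ‖x‖ ^ (2 - N : ℝ)) :=
          integral_mono (integrable_newtKer_mul (by omega) had one_pos (fun y _ => hM y))
            (hi.norm.mul_const _) hb
      _ = _ := by rw [integral_mul_const]; ring

theorem newtConst_pos (hN : 3 ≤ N) : 0 < newtConst N := by
  have hp : (2 - N : ℝ) < 0 := by have : (3:ℝ) ≤ N := by exact_mod_cast hN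
                                  linarith
  have : Nonempty (Fin N) := ⟨⟨0, by omega⟩⟩
  by_contra! hκ
  let f : Euc N → ℝ := fun x => Real.smoothTransition (1 - ‖x‖ ^ 2)
  have hfs : ContDiff ℝ 1 f := Real.smoothTransition.contDiff.comp
    (contDiff_const.sub (contDiff_norm_sq ℝ))
  have hf0 : ∀ x, 0 ≤ f x := fun x => Real.smoothTransition.nonneg _
  have hfc : HasCompactSupport f :=
    HasCompactSupport.of_support_subset_isCompact (isCompact_closedBall (0 : Euc N) 1)
      fun z hz => by
        rw [mem_closedBall_zero_iff]
        by_contra! h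
        exact hz (Real.smoothTransition.zero_of_nonpos (by nlinarith))
  have had := potAdmissible_of_hasCompactSupport hfs.continuous hfc
  obtain ⟨C, r, R, hr, hR, hC0, hCi⟩ := newtPot_le_of_hasCompactSupport hN hfs.continuous hfc
  have hreg := fun x => (hfs.contDiffAt (x := x)).holderNear.newtPot (by omega) had
  have hle := nonneg_of_lap_nonpos_of_le (h := fun x => -1 * newtPot f x) (c := 0) (C := C) (C' := C) hN hp hp hr
    (fun x _ => contDiffAt_const.mul (hreg x).1) (fun x _ => by
      rw [lap_const_mul (hreg x).1.twiceDiffAt, (hreg x).2]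
      nlinarith [hf0 x])
    (fun x _ hx => by rw [Real.rpow_zero]; linarith [hC0 x hx])
    (fun x hx => by linarith [hCi x hx])
  obtain ⟨x, hx⟩ := exists_ne (0 : Euc N)
  obtain ⟨M, hM⟩ := hfc.exists_bound_of_continuous hfs.continuous
  have hpos : 0 < newtPot f x := by
    have hi := integrable_newtKer_mul (by omega) had one_pos (fun y (_ : ‖x - y‖ ≤ 1) => hM y)
    have hnn : 0 ≤ fun y => f y * ‖x - y‖ ^ (2 - N : ℝ) :=
      fun y => mul_nonneg (hf0 y) (by positivity)
    rw [newtPot, integral_pos_iff_support_of_nonneg hnn hi]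
    refine lt_of_lt_of_le (b := volume (ball (0 : Euc N) 1 \ {x})) ?_ (measure_mono ?_)
    · rw [measure_sdiff_null (measure_singleton x)]
      exact measure_ball_pos _ _ one_pos
    · intro y hy
      have h1 : ‖y‖ < 1 := by simpa using hy.1
      have h2 : 0 < f y := Real.smoothTransition.pos_of_pos (by nlinarith [norm_nonneg y])
      have h3 : 0 < ‖x - y‖ := norm_pos_iff.mpr (sub_ne_zero.mpr fun h => hy.2 h.symm)
      exact (by positivity : f y * ‖x - y‖ ^ (2 - N : ℝ) ≠ 0)
  linarith [hle x hx]

/-- The normalised Newtonian potential, inverting `-lap`. -/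
def greenPot (f : Euc N → ℝ) (x : Euc N) : ℝ := (newtConst N)⁻¹ * newtPot f x

theorem HolderNear.greenPot {f : Euc N → ℝ} {x : Euc N} (hN : 3 ≤ N) (hf : PotAdmissible f)
    (h : HolderNear f x) :
    ContDiffAt ℝ 2 (greenPot f) x ∧ lap (greenPot f) x = -f x := by
  obtain ⟨h1, h2⟩ := h.newtPot (by omega) hf
  refine ⟨contDiffAt_const.mul h1, ?_⟩
  have h3 := lap_const_mul h1.twiceDiffAt (newtConst N)⁻¹
  refine h3.trans ?_
  rw [h2]
  have := (newtConst_pos hN).ne'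
  field_simp

/-- A cutoff supported in an annulus, increasing to `1` off the origin. -/
def annCut (j : ℕ) (x : Euc N) : ℝ :=
  Real.smoothTransition (j * ‖x‖ ^ 2 - 1) * Real.smoothTransition (j + 1 - ‖x‖ ^ 2)

theorem contDiff_annCut (j : ℕ) : ContDiff ℝ 1 (annCut j : Euc N → ℝ) :=
  (Real.smoothTransition.contDiff.comp
    ((contDiff_const.mul (contDiff_norm_sq ℝ)).sub contDiff_const)).mul
  (Real.smoothTransition.contDiff.comp (contDiff_const.sub (contDiff_norm_sq ℝ)))

theorem annCut_nonneg (j : ℕ) (x : Euc N) : 0 ≤ annCut j x :=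
  mul_nonneg (Real.smoothTransition.nonneg _) (Real.smoothTransition.nonneg _)

theorem annCut_le_one (j : ℕ) (x : Euc N) : annCut j x ≤ 1 :=
  mul_le_one₀ (Real.smoothTransition.le_one _) (Real.smoothTransition.nonneg _)
    (Real.smoothTransition.le_one _)

theorem annCut_eventually {x : Euc N} (hx : x ≠ 0) : ∀ᶠ j : ℕ in atTop, annCut j x = 1 := by
  have hxp : 0 < ‖x‖ ^ 2 := by have := norm_pos_iff.mpr hx; positivity
  filter_upwards [tendsto_natCast_atTop_atTop.eventually_ge_atTop (2 / ‖x‖ ^ 2),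
    tendsto_natCast_atTop_atTop.eventually_ge_atTop (‖x‖ ^ 2)] with j h1 h2
  rw [div_le_iff₀ hxp] at h1
  rw [annCut, Real.smoothTransition.one_of_one_le (by linarith),
    Real.smoothTransition.one_of_one_le (by linarith), one_mul]

theorem annCut_eq_zero (j : ℕ) : ∀ᶠ x : Euc N in nhds 0, annCut j x = 0 := by
  have : ∀ᶠ x : Euc N in nhds 0, (j:ℝ) * ‖x‖ ^ 2 < 1 :=
    (continuous_const.mul (continuous_norm.pow 2)).continuousAt.eventually_lt_const (by simp)
  filter_upwards [this] with x hx
  rw [annCut, Real.smoothTransition.zero_of_nonpos (by linarith), zero_mul]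

theorem hasCompactSupport_annCut (j : ℕ) : HasCompactSupport (annCut j : Euc N → ℝ) :=
  HasCompactSupport.of_support_subset_isCompact (isCompact_closedBall (0 : Euc N) (j + 1))
    fun z hz => by
      rw [mem_closedBall_zero_iff]
      by_contra! h
      refine hz ?_
      have hj : (0:ℝ) ≤ j := Nat.cast_nonneg j
      rw [annCut, Real.smoothTransition.zero_of_nonpos (x := j + 1 - ‖z‖ ^ 2) (by nlinarith),
        mul_zero]

theorem potAdmissible_of_integrable {f : Euc N → ℝ} (hN : 3 ≤ N)
    (hm : AEStronglyMeasurable f volume) {x : Euc N}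
    (hi : Integrable (fun y => f y * ‖x - y‖ ^ (2 - N : ℝ))) : PotAdmissible f := by
  have hp : (2 - N : ℝ) < 0 := by have : (3:ℝ) ≤ N := by exact_mod_cast hN
                                  linarith
  have : Nonempty (Fin N) := ⟨⟨0, by omega⟩⟩
  refine ⟨hm, ?_⟩
  have hc : Continuous fun y : Euc N => (1 + ‖y‖) ^ (2 - N : ℝ) :=
    (continuous_const.add continuous_norm).rpow_const fun y => Or.inl (by positivity : (0:ℝ) < 1 + ‖y‖).ne'
  refine (hi.norm.const_mul ((1 + ‖x‖) ^ (-(2 - N : ℝ)))).mono' (hc.aestronglyMeasurable.mul hm) ?_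
  filter_upwards [compl_mem_ae_iff.mpr (measure_singleton x)] with y hy
  have hxy : 0 < ‖x - y‖ := norm_pos_iff.mpr (sub_ne_zero.mpr fun h => hy h.symm)
  have h1 := one_add_norm_sub_rpow_le hp.le x (x - y)
  rw [sub_sub_cancel] at h1
  have h2 : (1 + ‖x - y‖) ^ (2 - N : ℝ) ≤ ‖x - y‖ ^ (2 - N : ℝ) :=
    Real.rpow_le_rpow_of_nonpos hxy (by linarith) hp.le
  rw [norm_mul, norm_mul, Real.norm_of_nonneg (r := (1 + ‖y‖) ^ (2 - N : ℝ)) (by positivity),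
    Real.norm_of_nonneg (r := ‖x - y‖ ^ (2 - N : ℝ)) (by positivity)]
  calc (1 + ‖y‖) ^ (2 - N : ℝ) * ‖f y‖
      ≤ ((1 + ‖x‖) ^ (-(2 - N : ℝ)) * ‖x - y‖ ^ (2 - N : ℝ)) * ‖f y‖ := by
        gcongr
        exact h1.trans (by gcongr)
    _ = _ := by ring

/-- A nonnegative supersolution off the origin dominates the potential of its source. -/
theorem greenPot_le_of_supersolution {f v : Euc N → ℝ} (hN : 3 ≤ N)
    (hv : ∀ x : Euc N, x ≠ 0 → ContDiffAt ℝ 2 v x) (hv0 : ∀ x : Euc N, x ≠ 0 → 0 ≤ v x)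
    (hf : ∀ x : Euc N, x ≠ 0 → HolderNear f x) (hf0 : ∀ x : Euc N, x ≠ 0 → 0 ≤ f x)
    (hsup : ∀ x : Euc N, x ≠ 0 → lap v x ≤ -f x) {x : Euc N} (hx : x ≠ 0) :
    Integrable (fun y => f y * ‖x - y‖ ^ (2 - N : ℝ)) ∧ greenPot f x ≤ v x := by
  have hp : (2 - N : ℝ) < 0 := by have : (3:ℝ) ≤ N := by exact_mod_cast hN
                                  linarith
  have : Nonempty (Fin N) := ⟨⟨0, by omega⟩⟩
  have hκ := newtConst_pos hN
  have hae : ∀ᵐ y : Euc N, y ≠ 0 := compl_mem_ae_iff.mpr (measure_singleton 0)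
  let g : ℕ → Euc N → ℝ := fun j y => f y * annCut j y
  have hgH : ∀ j y, HolderNear (g j) y := fun j y => by
    by_cases hy : y = 0
    · have : g j =ᶠ[nhds y] fun _ => 0 := by
        rw [hy]
        filter_upwards [annCut_eq_zero j] with z hz
        simp [g, hz]
      exact (contDiffAt_const.congr_of_eventuallyEq this).holderNear
    · exact (hf y hy).mul (contDiff_annCut j).contDiffAt.holderNear
  have hgc : ∀ j, Continuous (g j) := fun j =>
    continuous_iff_continuousAt.mpr fun y => (hgH j y).continuousAt
  have hgs : ∀ j, HasCompactSupport (g j) := fun j => (hasCompactSupport_annCut j).mul_left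
  have had := fun j => potAdmissible_of_hasCompactSupport (hgc j) (hgs j)
  have hgi : ∀ j, Integrable (fun y => g j y * ‖x - y‖ ^ (2 - N : ℝ)) := fun j => by
    obtain ⟨M, hM⟩ := (hgs j).exists_bound_of_continuous (hgc j)
    exact integrable_newtKer_mul (by omega) (had j) one_pos (fun y (_ : ‖x - y‖ ≤ 1) => hM y)
  have hle : ∀ j, newtPot (g j) x ≤ newtConst N * v x := fun j => by
    obtain ⟨C, r, R, hr, hR, hC0, hCi⟩ := newtPot_le_of_hasCompactSupport hN (hgc j) (hgs j)
    have hreg := fun y => (hgH j y).greenPot hN (had j)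
    have hκi : 0 < (newtConst N)⁻¹ := by positivity
    have := nonneg_of_lap_nonpos_of_le (h := fun y => v y + -1 * greenPot (g j) y) (c := 0)
      (C := (newtConst N)⁻¹ * C) (C' := (newtConst N)⁻¹ * C) hN hp hp hr
      (fun y hy => (hv y hy).add (contDiffAt_const.mul (hreg y).1)) (fun y hy => by
        have e1 : TwiceDiffAt (fun y => -1 * greenPot (g j) y) y :=
          (contDiffAt_const.mul (hreg y).1).twiceDiffAt
        have e2 := lap_add (hv y hy).twiceDiffAt e1
        rw [lap_const_mul (hreg y).1.twiceDiffAt, (hreg y).2] at e2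
        refine e2.trans_le ?_
        have := hsup y hy
        have : g j y ≤ f y := mul_le_of_le_one_right (hf0 y hy) (annCut_le_one j y)
        linarith)
      (fun y hy hyr => by
        rw [Real.rpow_zero, mul_one]
        have := mul_le_mul_of_nonneg_left (hC0 y hyr) hκi.le
        have := hv0 y hy
        unfold greenPot
        linarith)
      (fun y hyr => by
        have hy : y ≠ 0 := norm_pos_iff.mp (hR.trans_lt hyr)
        have := mul_le_mul_of_nonneg_left (hCi y hyr) hκi.le
        have := hv0 y hy
        unfold greenPot
        linarith) x hx
    have h2 : (newtConst N)⁻¹ * newtPot (g j) x ≤ v x := by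
      unfold greenPot at this; linarith
    rwa [inv_mul_le_iff₀ hκ] at h2
  have hmeas : AEStronglyMeasurable f volume :=
    aestronglyMeasurable_of_continuousAt (by omega) fun y hy => (hf y hy).continuousAt
  have hmeas' : AEStronglyMeasurable (fun y => f y * ‖x - y‖ ^ (2 - N : ℝ)) volume :=
    hmeas.mul (measurable_newtKer x).aestronglyMeasurable
  have hnn : 0 ≤ᵐ[volume] fun y => f y * ‖x - y‖ ^ (2 - N : ℝ) := by
    filter_upwards [hae] with y hy
    exact mul_nonneg (hf0 y hy) (by positivity)
  have hgn : ∀ j, 0 ≤ᵐ[volume] fun y => g j y * ‖x - y‖ ^ (2 - N : ℝ) := fun j => by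
    filter_upwards [hae] with y hy
    exact mul_nonneg (mul_nonneg (hf0 y hy) (annCut_nonneg j y)) (by positivity)
  have hv' : 0 ≤ newtConst N * v x := mul_nonneg hκ.le (hv0 x hx)
  have hlint : ∫⁻ y, ENNReal.ofReal (f y * ‖x - y‖ ^ (2 - N : ℝ)) ≤
      ENNReal.ofReal (newtConst N * v x) := by
    calc ∫⁻ y, ENNReal.ofReal (f y * ‖x - y‖ ^ (2 - N : ℝ))
        = ∫⁻ y, liminf (fun j => ENNReal.ofReal (g j y * ‖x - y‖ ^ (2 - N : ℝ))) atTop := by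
          refine lintegral_congr_ae ?_
          filter_upwards [hae] with y hy
          refine (Tendsto.liminf_eq ?_).symm
          refine tendsto_const_nhds.congr' ?_
          filter_upwards [annCut_eventually hy] with j hj
          simp [g, hj]
      _ ≤ liminf (fun j => ∫⁻ y, ENNReal.ofReal (g j y * ‖x - y‖ ^ (2 - N : ℝ))) atTop :=
          lintegral_liminf_le' fun j => (hgi j).1.aemeasurable.ennreal_ofReal
      _ ≤ liminf (fun _ : ℕ => ENNReal.ofReal (newtConst N * v x)) atTop := by
          refine liminf_le_liminf (Eventually.of_forall fun j => ?_)
          rw [← ofReal_integral_eq_lintegral_ofReal (hgi j) (hgn j)]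
          exact ENNReal.ofReal_le_ofReal (hle j)
      _ = _ := liminf_const _
  have hinteg : Integrable (fun y => f y * ‖x - y‖ ^ (2 - N : ℝ)) := by
    refine ⟨hmeas', ?_⟩
    rw [hasFiniteIntegral_iff_ofReal hnn]
    exact hlint.trans_lt ENNReal.ofReal_lt_top
  refine ⟨hinteg, ?_⟩
  rw [← ofReal_integral_eq_lintegral_ofReal hinteg hnn, ENNReal.ofReal_le_ofReal_iff hv'] at hlint
  rw [greenPot, inv_mul_le_iff₀ hκ]
  exact hlint

theorem greenPot_mono {f g : Euc N → ℝ} (hN : 3 ≤ N) {x : Euc N}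
    (hf : Integrable (fun y => f y * ‖x - y‖ ^ (2 - N : ℝ)))
    (hg : Integrable (fun y => g y * ‖x - y‖ ^ (2 - N : ℝ)))
    (h : ∀ y : Euc N, y ≠ 0 → f y ≤ g y) : greenPot f x ≤ greenPot g x := by
  have : Nonempty (Fin N) := ⟨⟨0, by omega⟩⟩
  refine mul_le_mul_of_nonneg_left (integral_mono_ae hf hg ?_) (inv_nonneg.mpr (newtConst_pos hN).le)
  filter_upwards [compl_mem_ae_iff.mpr (measure_singleton (0 : Euc N))] with y hy
  exact mul_le_mul_of_nonneg_right (h y hy) (by positivity)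

/-- Powers are the potentials of powers. -/
theorem greenPot_norm_rpow (hN : 3 ≤ N) {σ : ℝ} (hσ : 2 - (N:ℝ) < σ) (hσ0 : σ < 0) {x : Euc N}
    (hx : x ≠ 0) :
    Integrable (fun y => ‖y‖ ^ (σ - 2) * ‖x - y‖ ^ (2 - N : ℝ)) ∧
      -(σ * (σ + N - 2)) * greenPot (fun y : Euc N => ‖y‖ ^ (σ - 2)) x = ‖x‖ ^ σ := by
  have hc : 0 < -(σ * (σ + N - 2)) := by nlinarith
  set c := -(σ * (σ + N - 2)) with hcdef
  have hH : ∀ y : Euc N, y ≠ 0 → HolderNear (fun y : Euc N => c * ‖y‖ ^ (σ - 2)) y :=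
    fun y hy => (contDiffAt_norm_rpow _ hy).holderNear.const_mul c
  have hlap : ∀ y : Euc N, y ≠ 0 → lap (fun y : Euc N => ‖y‖ ^ σ) y = -(c * ‖y‖ ^ (σ - 2)) :=
    fun y hy => by rw [lap_norm_rpow σ hy, hcdef]; ring
  have key := fun {x : Euc N} (hx : x ≠ 0) => greenPot_le_of_supersolution hN
    (v := fun y : Euc N => ‖y‖ ^ σ)
    (fun y hy => contDiffAt_norm_rpow _ hy) (fun y _ => by positivity) hH
    (fun y _ => by positivity) (fun y hy => (hlap y hy).le) hx
  have hmul : ∀ x : Euc N, greenPot (fun y : Euc N => c * ‖y‖ ^ (σ - 2)) x =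
      c * greenPot (fun y : Euc N => ‖y‖ ^ (σ - 2)) x := fun x => by
    simp only [greenPot, newtPot, mul_assoc, integral_const_mul]
    ring
  refine ⟨?_, ?_⟩
  · refine ((key hx).1.const_mul c⁻¹).congr (Eventually.of_forall fun y => ?_)
    field_simp
  rw [← hmul]
  refine le_antisymm (key hx).2 ?_
  have hm : AEStronglyMeasurable (fun y : Euc N => c * ‖y‖ ^ (σ - 2)) volume :=
    aestronglyMeasurable_of_continuousAt (by omega) fun y hy => (hH y hy).continuousAt
  have had := potAdmissible_of_integrable hN hm (key hx).1
  have hnn : ∀ y : Euc N, 0 ≤ greenPot (fun y : Euc N => c * ‖y‖ ^ (σ - 2)) y := fun y =>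
    mul_nonneg (inv_nonneg.mpr (newtConst_pos hN).le)
      (integral_nonneg fun z => by positivity)
  have hreg := fun y hy => (hH y hy).greenPot hN had
  have := nonneg_of_lap_nonpos_of_le
    (h := fun y => greenPot (fun y : Euc N => c * ‖y‖ ^ (σ - 2)) y + -1 * ‖y‖ ^ σ)
    (c := σ) (c' := σ) (C := 1) (C' := 1) (r := 1) (R := 0) hN hσ hσ0 one_pos
    (fun y hy => (hreg y hy).1.add (contDiffAt_const.mul (contDiffAt_norm_rpow _ hy)))
    (fun y hy => by
      have e1 : TwiceDiffAt (fun y : Euc N => -1 * ‖y‖ ^ σ) y :=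
        (contDiffAt_const.mul (contDiffAt_norm_rpow _ hy)).twiceDiffAt
      have e2 := lap_add (hreg y hy).1.twiceDiffAt e1
      rw [lap_const_mul (contDiffAt_norm_rpow _ hy).twiceDiffAt, (hreg y hy).2, hlap y hy] at e2
      exact (e2.trans (by ring)).le)
    (fun y _ _ => by linarith [hnn y]) (fun y _ => by linarith [hnn y]) x hx
  linarith

end Newton

/-- A positive Hölder potential lying below the inverse square potential by a bounded amount,
with a subcritical coupling constant. -/
structure BelowInvSq (N : ℕ) (μ c : ℝ) (V : Euc N → ℝ) : Prop where
  dim : 3 ≤ N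
  coupling_pos : 0 < μ
  coupling_lt : μ < mu0 N
  const_pos : 0 < c
  holder : ∀ x : Euc N, x ≠ 0 → HolderNear V x
  pos : ∀ x : Euc N, x ≠ 0 → 0 < V x
  lower : ∀ x : Euc N, x ≠ 0 → ‖x‖ ^ (-2 : ℝ) - c ≤ V x
  upper : ∀ x : Euc N, x ≠ 0 → V x ≤ ‖x‖ ^ (-2 : ℝ)

/-- An exponent slightly above `tauMinus` at which the power is a strict supersolution. -/
def auxExp (N : ℕ) (μ : ℝ) : ℝ := tauMinus N μ + min (Real.sqrt (mu0 N - μ)) 1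

/-- `-lap ‖x‖ ^ σ = powConst N σ * ‖x‖ ^ (σ - 2)`. -/
def powConst (N : ℕ) (σ : ℝ) : ℝ := -(σ * (σ + N - 2))

namespace BelowInvSq
variable {N : ℕ} {μ c : ℝ} {V : Euc N → ℝ}

theorem sqrt_pos (h : BelowInvSq N μ c V) : 0 < Real.sqrt (mu0 N - μ) :=
  Real.sqrt_pos.mpr (sub_pos.mpr h.coupling_lt)

theorem sq_sqrt (h : BelowInvSq N μ c V) : Real.sqrt (mu0 N - μ) ^ 2 = mu0 N - μ :=
  Real.sq_sqrt (sub_pos.mpr h.coupling_lt).le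

theorem two_lt (h : BelowInvSq N μ c V) : (2:ℝ) < N := by
  have : (3:ℝ) ≤ N := by exact_mod_cast h.dim
  linarith

theorem nonempty (h : BelowInvSq N μ c V) : Nonempty (Fin N) :=
  ⟨⟨0, by have := h.dim; omega⟩⟩

theorem tauMinus_gt (h : BelowInvSq N μ c V) : 2 - (N:ℝ) < tauMinus N μ := by
  have h1 : Real.sqrt (mu0 N - μ) < ((N:ℝ) - 2) / 2 := by
    refine lt_of_pow_lt_pow_left₀ 2 (by linarith [h.two_lt]) ?_
    rw [h.sq_sqrt, mu0]
    nlinarith [h.coupling_pos]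
  rw [tauMinus]
  linarith

theorem tauMinus_neg (h : BelowInvSq N μ c V) : tauMinus N μ < 0 := by
  rw [tauMinus]
  linarith [h.two_lt, h.sqrt_pos]

theorem tauMinus_lt_auxExp (h : BelowInvSq N μ c V) : tauMinus N μ < auxExp N μ := by
  rw [auxExp]
  linarith [lt_min h.sqrt_pos one_pos]

theorem auxExp_le : auxExp N μ ≤ tauMinus N μ + 1 := by
  rw [auxExp]
  linarith [min_le_right (Real.sqrt (mu0 N - μ)) 1]

theorem auxExp_neg (h : BelowInvSq N μ c V) : auxExp N μ < 0 := by
  rw [auxExp, tauMinus]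
  linarith [h.two_lt, min_le_left (Real.sqrt (mu0 N - μ)) 1]

theorem auxExp_gt (h : BelowInvSq N μ c V) : 2 - (N:ℝ) < auxExp N μ :=
  h.tauMinus_gt.trans h.tauMinus_lt_auxExp

theorem powConst_tauMinus (h : BelowInvSq N μ c V) : powConst N (tauMinus N μ) = μ := by
  have := h.sq_sqrt
  rw [mu0] at this
  rw [powConst, tauMinus, mu0]
  linarith

theorem lt_powConst_auxExp (h : BelowInvSq N μ c V) : μ < powConst N (auxExp N μ) := by
  have h1 := h.sq_sqrt
  have h2 := h.sqrt_pos
  have h3 := lt_min h2 one_pos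
  have h4 := min_le_left (Real.sqrt (mu0 N - μ)) 1
  rw [powConst, auxExp, tauMinus]
  have h5 : mu0 N = ((N:ℝ) - 2) ^ 2 / 4 := rfl
  set s := Real.sqrt (mu0 N - μ)
  set m := min s 1
  nlinarith [mul_pos h3 h2, mul_nonneg h3.le (sub_nonneg.mpr h4)]

/-- The gap to the inverse square potential is a lower order perturbation. -/
theorem gap_le (h : BelowInvSq N μ c V) {x : Euc N} (hx : x ≠ 0) :
    ‖x‖ ^ (-2 : ℝ) - V x ≤ (1 + c) * ‖x‖ ^ (auxExp N μ - tauMinus N μ - 2) := by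
  have hxp : 0 < ‖x‖ := norm_pos_iff.mpr hx
  have hc := h.const_pos
  have h1 := h.tauMinus_lt_auxExp
  have h2 := auxExp_le (N := N) (μ := μ)
  have hp : 0 < ‖x‖ ^ (auxExp N μ - tauMinus N μ - 2) := by positivity
  rcases le_total ‖x‖ 1 with h3 | h3
  · have := Real.one_le_rpow_of_pos_of_le_one_of_nonpos hxp h3
      (z := auxExp N μ - tauMinus N μ - 2) (by linarith)
    nlinarith [h.lower x hx]
  · have := Real.rpow_le_rpow_of_exponent_le h3 (y := -2) (z := auxExp N μ - tauMinus N μ - 2)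
      (by linarith)
    nlinarith [h.pos x hx]

end BelowInvSq

section Potentials
variable {N : ℕ}

theorem ae_ne_zero (hN : 3 ≤ N) : ∀ᵐ y : Euc N, y ≠ 0 := by
  have : Nonempty (Fin N) := ⟨⟨0, by omega⟩⟩
  exact compl_mem_ae_iff.mpr (measure_singleton 0)

theorem integrable_newtKer_of_le (hN : 3 ≤ N) {σ M : ℝ} (hσ : 2 - (N:ℝ) < σ) (hσ0 : σ < 0)
    {f : Euc N → ℝ} (hm : AEStronglyMeasurable f volume)
    (hf : ∀ y : Euc N, y ≠ 0 → |f y| ≤ M * ‖y‖ ^ (σ - 2)) {x : Euc N} (hx : x ≠ 0) :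
    Integrable (fun y => f y * ‖x - y‖ ^ (2 - N : ℝ)) := by
  refine ((greenPot_norm_rpow hN hσ hσ0 hx).1.const_mul M).mono'
    (hm.mul (measurable_newtKer x).aestronglyMeasurable) ?_
  filter_upwards [ae_ne_zero hN] with y hy
  rw [norm_mul, Real.norm_of_nonneg (r := ‖x - y‖ ^ (2 - N : ℝ)) (by positivity), ← mul_assoc]
  exact mul_le_mul_of_nonneg_right (hf y hy) (by positivity)

theorem greenPot_const_mul (a : ℝ) (f : Euc N → ℝ) (x : Euc N) :
    greenPot (fun y => a * f y) x = a * greenPot f x := by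
  simp only [greenPot, newtPot, mul_assoc, integral_const_mul]
  ring

theorem greenPot_sub {f g : Euc N → ℝ} {x : Euc N}
    (hf : Integrable (fun y => f y * ‖x - y‖ ^ (2 - N : ℝ)))
    (hg : Integrable (fun y => g y * ‖x - y‖ ^ (2 - N : ℝ))) :
    greenPot (fun y => f y - g y) x = greenPot f x - greenPot g x := by
  simp only [greenPot, newtPot, sub_mul]
  rw [integral_sub hf hg]
  ring

theorem greenPot_rpow_eq (hN : 3 ≤ N) {σ : ℝ} (hσ : 2 - (N:ℝ) < σ) (hσ0 : σ < 0) (a : ℝ)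
    {x : Euc N} (hx : x ≠ 0) :
    greenPot (fun y : Euc N => a * powConst N σ * ‖y‖ ^ (σ - 2)) x = a * ‖x‖ ^ σ := by
  rw [greenPot_const_mul, mul_assoc, powConst, (greenPot_norm_rpow hN hσ hσ0 hx).2]

theorem contDiffAt_one_greenPot (hN : 3 ≤ N) {f : Euc N → ℝ} (hf : PotAdmissible f) {x : Euc N}
    {δ M : ℝ} (hδ : 0 < δ) (hM : ∀ y ∈ ball x δ, ‖f y‖ ≤ M) : ContDiffAt ℝ 1 (greenPot f) x :=
  contDiffAt_const.mul (contDiffAt_one_newtPot (by omega) hf hδ hM)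

/-- On balls away from the origin, power bounds are uniform bounds. -/
theorem exists_bound_of_le_rpow {f : Euc N → ℝ} {M σ : ℝ}
    (hf : ∀ y : Euc N, y ≠ 0 → |f y| ≤ M * ‖y‖ ^ σ) {x : Euc N} (hx : x ≠ 0) :
    ∃ δ > 0, ∃ C, ∀ y ∈ ball x δ, ‖f y‖ ≤ C := by
  have hxp : 0 < ‖x‖ := norm_pos_iff.mpr hx
  have hc : ContinuousAt (fun y : Euc N => M * ‖y‖ ^ σ) x :=
    continuousAt_const.mul (continuous_norm.continuousAt.rpow_const (Or.inl hxp.ne'))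
  obtain ⟨δ, hδ, h1⟩ := Metric.mem_nhds_iff.mp ((hc.eventually (gt_mem_nhds (lt_add_one _))).and
    (isOpen_ne.mem_nhds hx))
  exact ⟨δ, hδ, _, fun y hy => (hf y (h1 hy).2).trans (h1 hy).1.le⟩

end Potentials

/-- The iteration for the fixed point equation `u = greenPot (μ V u)`. -/
def potIter {N : ℕ} (μ : ℝ) (V u₀ : Euc N → ℝ) : ℕ → Euc N → ℝ
  | 0 => u₀
  | n + 1 => greenPot fun y => μ * V y * potIter μ V u₀ n y

namespace BelowInvSq
variable {N : ℕ} {μ c : ℝ} {V : Euc N → ℝ}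

theorem abs_mul_le (h : BelowInvSq N μ c V) {u : Euc N → ℝ} {k p : ℝ} {y : Euc N} (hy : y ≠ 0)
    (h1 : |u y| ≤ k * ‖y‖ ^ p) :
    |μ * V y * u y| ≤ μ * k * ‖y‖ ^ (p - 2) := by
  have hyp : 0 < ‖y‖ := norm_pos_iff.mpr hy
  have := h.pos y hy
  have := h.coupling_pos
  have e : ‖y‖ ^ (p - 2) = ‖y‖ ^ (-2 : ℝ) * ‖y‖ ^ p := by
    rw [← Real.rpow_add hyp]; ring_nf
  rw [e, abs_mul, abs_of_pos (by positivity)]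
  calc μ * V y * |u y| ≤ μ * ‖y‖ ^ (-2 : ℝ) * (k * ‖y‖ ^ p) := by
        gcongr
        exact h.upper y hy
    _ = _ := by ring

theorem integrable_source (h : BelowInvSq N μ c V) {u : Euc N → ℝ} {k p : ℝ}
    (hp : 2 - (N:ℝ) < p) (hp0 : p < 0) (hm : AEStronglyMeasurable u volume)
    (hu : ∀ y : Euc N, y ≠ 0 → |u y| ≤ k * ‖y‖ ^ p) {x : Euc N} (hx : x ≠ 0) :
    Integrable (fun y => μ * V y * u y * ‖x - y‖ ^ (2 - N : ℝ)) := by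
  have hV : AEStronglyMeasurable V volume :=
    aestronglyMeasurable_of_continuousAt (by have := h.dim; omega)
      fun y hy => (h.holder y hy).continuousAt
  exact integrable_newtKer_of_le h.dim hp hp0 (f := fun y => μ * V y * u y)
    ((hV.const_mul μ).mul hm) (fun y hy => h.abs_mul_le hy (hu y hy)) hx

theorem potAdmissible_source (h : BelowInvSq N μ c V) {u : Euc N → ℝ} {k p : ℝ}
    (hp : 2 - (N:ℝ) < p) (hp0 : p < 0) (hm : AEStronglyMeasurable u volume)
    (hu : ∀ y : Euc N, y ≠ 0 → |u y| ≤ k * ‖y‖ ^ p) : PotAdmissible (fun y => μ * V y * u y) := by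
  have := h.nonempty
  obtain ⟨x, hx⟩ := exists_ne (0 : Euc N)
  have hV : AEStronglyMeasurable V volume :=
    aestronglyMeasurable_of_continuousAt (by have := h.dim; omega)
      fun y hy => (h.holder y hy).continuousAt
  exact potAdmissible_of_integrable h.dim ((hV.const_mul μ).mul hm)
    (h.integrable_source hp hp0 hm hu hx)

theorem contDiffAt_one_source (h : BelowInvSq N μ c V) {u : Euc N → ℝ} {k p : ℝ}
    (hp : 2 - (N:ℝ) < p) (hp0 : p < 0) (hm : AEStronglyMeasurable u volume)
    (hu : ∀ y : Euc N, y ≠ 0 → |u y| ≤ k * ‖y‖ ^ p) {x : Euc N} (hx : x ≠ 0) :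
    ContDiffAt ℝ 1 (greenPot fun y => μ * V y * u y) x := by
  obtain ⟨δ, hδ, C, hC⟩ := exists_bound_of_le_rpow (f := fun y => μ * V y * u y)
    (fun y hy => h.abs_mul_le hy (hu y hy)) hx
  exact contDiffAt_one_greenPot h.dim (h.potAdmissible_source hp hp0 hm hu) hδ hC

/-- Pointwise bounds between the singular profile and its lower order correction. -/
def Sandwich (N : ℕ) (μ k A : ℝ) (u : Euc N → ℝ) : Prop :=
  ∀ x : Euc N, x ≠ 0 → 0 ≤ u x ∧ u x ≤ k * ‖x‖ ^ tauMinus N μ ∧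
    k * ‖x‖ ^ tauMinus N μ - A * ‖x‖ ^ auxExp N μ ≤ u x

theorem Sandwich.abs_le {k A : ℝ} {u : Euc N → ℝ} (hu : Sandwich N μ k A u) (y : Euc N)
    (hy : y ≠ 0) : |u y| ≤ k * ‖y‖ ^ tauMinus N μ := by
  rw [abs_of_nonneg (hu y hy).1]
  exact (hu y hy).2.1

theorem greenPot_tauMinus (h : BelowInvSq N μ c V) (a : ℝ) {x : Euc N} (hx : x ≠ 0) :
    greenPot (fun y : Euc N => μ * a * ‖y‖ ^ (tauMinus N μ - 2)) x = a * ‖x‖ ^ tauMinus N μ := by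
  have := greenPot_rpow_eq h.dim h.tauMinus_gt h.tauMinus_neg a hx
  rw [h.powConst_tauMinus, mul_comm a μ] at this
  exact this

theorem integrable_rpow (h : BelowInvSq N μ c V) {p : ℝ} (hp : 2 - (N:ℝ) < p) (hp0 : p < 0)
    (a : ℝ) {x : Euc N} (hx : x ≠ 0) :
    Integrable (fun y : Euc N => a * ‖y‖ ^ (p - 2) * ‖x - y‖ ^ (2 - N : ℝ)) := by
  simp only [mul_assoc]
  exact (greenPot_norm_rpow h.dim hp hp0 hx).1.const_mul a

theorem sandwich_greenPot (h : BelowInvSq N μ c V) {k A : ℝ} (hk : 0 ≤ k) (hA : 0 ≤ A)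
    (hkA : k * (μ * (1 + c)) + μ * A = A * powConst N (auxExp N μ)) {u : Euc N → ℝ}
    (hm : AEStronglyMeasurable u volume) (hu : Sandwich N μ k A u) :
    Sandwich N μ k A (greenPot fun y => μ * V y * u y) := by
  intro x hx
  have hμ := h.coupling_pos
  have hκ := newtConst_pos h.dim
  have hinteg := h.integrable_source h.tauMinus_gt h.tauMinus_neg hm hu.abs_le hx
  have hτ := h.integrable_rpow h.tauMinus_gt h.tauMinus_neg (μ * k) hx
  have hσ := h.integrable_rpow h.auxExp_gt h.auxExp_neg (A * powConst N (auxExp N μ)) hx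
  refine ⟨?_, ?_, ?_⟩
  · refine mul_nonneg (inv_nonneg.mpr hκ.le) (integral_nonneg_of_ae ?_)
    filter_upwards [ae_ne_zero h.dim] with y hy
    have := h.pos y hy
    have := (hu y hy).1
    simp only [Pi.zero_apply]
    positivity
  · rw [← h.greenPot_tauMinus k hx]
    refine greenPot_mono h.dim hinteg hτ fun y hy => ?_
    exact (le_abs_self _).trans (h.abs_mul_le hy (hu.abs_le y hy))
  · rw [← h.greenPot_tauMinus k hx, ← greenPot_rpow_eq h.dim h.auxExp_gt h.auxExp_neg A hx,
      ← greenPot_sub hτ hσ]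
    refine greenPot_mono h.dim ((hτ.sub hσ).congr
      (Eventually.of_forall fun y => (sub_mul _ _ _).symm)) hinteg fun y hy => ?_
    have hyp : 0 < ‖y‖ := norm_pos_iff.mpr hy
    have h1 := (hu y hy).2.2
    have h2 := h.gap_le hy
    have h3 := h.upper y hy
    have h4 := h.pos y hy
    have e1 : ‖y‖ ^ (tauMinus N μ - 2) = ‖y‖ ^ (-2 : ℝ) * ‖y‖ ^ tauMinus N μ := by
      rw [← Real.rpow_add hyp]; ring_nf
    have e2 : ‖y‖ ^ (auxExp N μ - 2) = ‖y‖ ^ (-2 : ℝ) * ‖y‖ ^ auxExp N μ := by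
      rw [← Real.rpow_add hyp]; ring_nf
    have e3 : ‖y‖ ^ (auxExp N μ - 2) =
        ‖y‖ ^ (auxExp N μ - tauMinus N μ - 2) * ‖y‖ ^ tauMinus N μ := by
      rw [← Real.rpow_add hyp]; ring_nf
    have p1 : 0 < ‖y‖ ^ tauMinus N μ := by positivity
    have p2 : 0 < ‖y‖ ^ auxExp N μ := by positivity
    have a1 : μ * V y * (k * ‖y‖ ^ tauMinus N μ - A * ‖y‖ ^ auxExp N μ) ≤ μ * V y * u y :=
      mul_le_mul_of_nonneg_left h1 (by positivity)
    have a2 : μ * k * ((‖y‖ ^ (-2 : ℝ) - V y) * ‖y‖ ^ tauMinus N μ) ≤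
        μ * k * ((1 + c) * ‖y‖ ^ (auxExp N μ - 2)) := by
      rw [e3, ← mul_assoc (1 + c)]
      exact mul_le_mul_of_nonneg_left (mul_le_mul_of_nonneg_right h2 p1.le) (by positivity)
    have a3 : μ * A * (V y * ‖y‖ ^ auxExp N μ) ≤ μ * A * ‖y‖ ^ (auxExp N μ - 2) := by
      rw [e2]
      exact mul_le_mul_of_nonneg_left (mul_le_mul_of_nonneg_right h3 p2.le) (by positivity)
    rw [← hkA, e1]
    linarith

theorem exists_fixedPoint (h : BelowInvSq N μ c V) {k : ℝ} (hk : 0 ≤ k) :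
    ∃ u : Euc N → ℝ, ∃ A : ℝ, 0 ≤ A ∧ AEStronglyMeasurable u volume ∧ Sandwich N μ k A u ∧
      ∀ x : Euc N, x ≠ 0 → u x = greenPot (fun y => μ * V y * u y) x := by
  have hμ := h.coupling_pos
  have hc := h.const_pos
  have hgap : 0 < powConst N (auxExp N μ) - μ := sub_pos.mpr h.lt_powConst_auxExp
  have hdim : 1 ≤ N := by have := h.dim; omega
  let A : ℝ := k * (μ * (1 + c)) / (powConst N (auxExp N μ) - μ)
  have hA : 0 ≤ A := by positivity
  have hkA : k * (μ * (1 + c)) + μ * A = A * powConst N (auxExp N μ) := by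
    have : A * (powConst N (auxExp N μ) - μ) = k * (μ * (1 + c)) := div_mul_cancel₀ _ hgap.ne'
    linarith
  let w := potIter μ V fun x : Euc N => k * ‖x‖ ^ tauMinus N μ
  have hw : ∀ n, AEStronglyMeasurable (w n) volume ∧ Sandwich N μ k A (w n) := by
    intro n
    induction n with
    | zero =>
      refine ⟨aestronglyMeasurable_of_continuousAt hdim fun x hx => ?_, fun x hx => ?_⟩
      · exact continuousAt_const.mul (contDiffAt_norm_rpow (n := 1) (tauMinus N μ) hx).continuousAt
      · refine ⟨by simp only [w, potIter]; positivity, le_rfl, ?_⟩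
        have : 0 ≤ A * ‖x‖ ^ auxExp N μ := by positivity
        simp only [w, potIter]
        linarith
    | succ n ih =>
      refine ⟨aestronglyMeasurable_of_continuousAt hdim fun x hx => ?_,
        h.sandwich_greenPot hk hA hkA ih.1 ih.2⟩
      exact (h.contDiffAt_one_source h.tauMinus_gt h.tauMinus_neg ih.1 ih.2.abs_le hx).continuousAt
  have hinteg := fun n {x : Euc N} (hx : x ≠ 0) =>
    h.integrable_source h.tauMinus_gt h.tauMinus_neg (hw n).1 (hw n).2.abs_le hx
  have hstep : ∀ n, ∀ x : Euc N, x ≠ 0 → w (n + 1) x ≤ w n x := by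
    intro n
    induction n with
    | zero => exact fun x hx => ((hw 1).2 x hx).2.1
    | succ n ih =>
      refine fun x hx => greenPot_mono h.dim (hinteg _ hx) (hinteg _ hx) fun y hy => ?_
      have := h.pos y hy
      exact mul_le_mul_of_nonneg_left (ih y hy) (by positivity)
  have hlim : ∀ x : Euc N, x ≠ 0 → Tendsto (fun n => w n x) atTop (nhds (⨅ n, w n x)) :=
    fun x hx => tendsto_atTop_ciInf (antitone_nat_of_succ_le fun n => hstep n x hx)
      ⟨0, by rintro _ ⟨n, rfl⟩; exact ((hw n).2 x hx).1⟩
  refine ⟨fun x => ⨅ n, w n x, A, hA, ?_, fun x hx => ⟨?_, ?_, ?_⟩, fun x hx => ?_⟩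
  · refine aestronglyMeasurable_of_tendsto_ae atTop (fun n => (hw n).1) ?_
    filter_upwards [ae_ne_zero h.dim] with x hx using hlim x hx
  · exact ge_of_tendsto' (hlim x hx) fun n => ((hw n).2 x hx).1
  · exact le_of_tendsto' (hlim x hx) fun n => ((hw n).2 x hx).2.1
  · exact ge_of_tendsto' (hlim x hx) fun n => ((hw n).2 x hx).2.2
  · refine tendsto_nhds_unique ((tendsto_add_atTop_iff_nat 1).mpr (hlim x hx)) ?_
    refine Tendsto.const_mul _ ?_
    refine tendsto_integral_of_dominated_convergence _ (fun n => (hinteg n hx).1)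
      (h.integrable_rpow h.tauMinus_gt h.tauMinus_neg (μ * k) hx) (fun n => ?_) ?_
    · filter_upwards [ae_ne_zero h.dim] with y hy
      rw [norm_mul, Real.norm_of_nonneg (r := ‖x - y‖ ^ (2 - N : ℝ)) (by positivity)]
      exact mul_le_mul_of_nonneg_right (h.abs_mul_le hy ((hw n).2.abs_le y hy)) (by positivity)
    · filter_upwards [ae_ne_zero h.dim] with y hy
      exact ((hlim y hy).const_mul _).mul_const _

/-- A positive solution with prescribed leading singularity, given as its own potential. -/
theorem exists_solution (h : BelowInvSq N μ c V) {k : ℝ} (hk : 0 < k) :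
    ∃ u : Euc N → ℝ, ∃ A : ℝ, 0 ≤ A ∧ Sandwich N μ k A u ∧ (∀ x : Euc N, x ≠ 0 → 0 < u x) ∧
      IsSolution N μ V u ∧ ∀ x : Euc N, x ≠ 0 → u x = greenPot (fun y => μ * V y * u y) x := by
  obtain ⟨u, A, hA, hm, hu, hfix⟩ := h.exists_fixedPoint hk.le
  have hμ := h.coupling_pos
  have hinteg := fun {x : Euc N} (hx : x ≠ 0) =>
    h.integrable_source h.tauMinus_gt h.tauMinus_neg hm hu.abs_le hx
  have hev : ∀ x : Euc N, x ≠ 0 → u =ᶠ[nhds x] greenPot fun y => μ * V y * u y := fun x hx => by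
    filter_upwards [isOpen_ne.mem_nhds hx] with y hy using hfix y hy
  have hreg : ∀ x : Euc N, x ≠ 0 → ContDiffAt ℝ 2 (greenPot fun y => μ * V y * u y) x ∧
      lap (greenPot fun y => μ * V y * u y) x = -(μ * V x * u x) := fun x hx => by
    have h1 := (h.contDiffAt_one_source h.tauMinus_gt h.tauMinus_neg hm hu.abs_le
      hx).congr_of_eventuallyEq (hev x hx)
    exact (((h.holder x hx).const_mul μ).mul h1.holderNear).greenPot h.dim
      (h.potAdmissible_source h.tauMinus_gt h.tauMinus_neg hm hu.abs_le)
  refine ⟨u, A, hA, hu, fun x hx => ?_, ⟨fun x hx => ?_, fun x hx => ?_⟩, hfix⟩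
  · have hgap : 0 < auxExp N μ - tauMinus N μ := sub_pos.mpr h.tauMinus_lt_auxExp
    have hlim : ∀ᶠ t : ℝ in nhds 0, A * t ^ (auxExp N μ - tauMinus N μ) < k := by
      have := (continuousAt_const (y := A)).mul
        (Real.continuousAt_rpow_const (0:ℝ) (auxExp N μ - tauMinus N μ) (Or.inr hgap.le))
      refine this.eventually_lt_const ?_
      simpa [Real.zero_rpow hgap.ne'] using hk
    obtain ⟨r, hr, hr1⟩ := Metric.mem_nhds_iff.mp hlim
    have hpos : ∀ y : Euc N, y ≠ 0 → ‖y‖ < r → 0 < u y := fun y hy hyr => by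
      have hyp : 0 < ‖y‖ := norm_pos_iff.mpr hy
      refine lt_of_lt_of_le ?_ (hu y hy).2.2
      have h1 : A * ‖y‖ ^ (auxExp N μ - tauMinus N μ) < k := hr1 (by simpa using hyr)
      have h2 : ‖y‖ ^ auxExp N μ = ‖y‖ ^ (auxExp N μ - tauMinus N μ) * ‖y‖ ^ tauMinus N μ := by
        rw [← Real.rpow_add hyp]; ring_nf
      have h3 : 0 < ‖y‖ ^ tauMinus N μ := by positivity
      rw [h2, ← mul_assoc, ← sub_mul]
      exact mul_pos (sub_pos.mpr h1) h3
    rw [hfix x hx]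
    refine mul_pos (inv_pos.mpr (newtConst_pos h.dim)) ?_
    have hnn : 0 ≤ᵐ[volume] fun y => μ * V y * u y * ‖x - y‖ ^ (2 - N : ℝ) := by
      filter_upwards [ae_ne_zero h.dim] with y hy
      have := h.pos y hy
      have := (hu y hy).1
      simp only [Pi.zero_apply]
      positivity
    rw [newtPot, integral_pos_iff_support_of_nonneg_ae hnn (hinteg hx)]
    have := h.nonempty
    refine lt_of_lt_of_le (b := volume ((ball (0 : Euc N) r \ {x}) \ {0})) ?_ (measure_mono ?_)
    · rw [measure_sdiff_null (measure_singleton _), measure_sdiff_null (measure_singleton _)]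
      exact measure_ball_pos _ _ hr
    · intro y hy
      have h0 : y ≠ 0 := hy.2
      have h1 := hpos y h0 (by simpa using hy.1.1)
      have h2 := h.pos y h0
      have h3 : 0 < ‖x - y‖ := norm_pos_iff.mpr (sub_ne_zero.mpr fun h => hy.1.2 h.symm)
      exact (by positivity : 0 < μ * V y * u y * ‖x - y‖ ^ (2 - N : ℝ)).ne'
  · exact ((hreg x hx).1.congr_of_eventuallyEq (hev x hx)).contDiffWithinAt
  · rw [lap_congr (hev x hx), (hreg x hx).2]
    ring

theorem Sandwich.tendsto (h : BelowInvSq N μ c V) {k A : ℝ} {u : Euc N → ℝ}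
    (hu : Sandwich N μ k A u) :
    Tendsto (fun x : Euc N => u x * ‖x‖ ^ (-(tauMinus N μ)))
      (nhdsWithin (0 : Euc N) {x : Euc N | x ≠ 0}) (nhds k) := by
  have hgap : 0 < auxExp N μ - tauMinus N μ := sub_pos.mpr h.tauMinus_lt_auxExp
  have hlim : Tendsto (fun x : Euc N => k - A * ‖x‖ ^ (auxExp N μ - tauMinus N μ))
      (nhdsWithin (0 : Euc N) {x : Euc N | x ≠ 0}) (nhds k) := by
    have h1 : Continuous fun x : Euc N => k - A * ‖x‖ ^ (auxExp N μ - tauMinus N μ) :=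
      continuous_const.sub (continuous_const.mul
        (continuous_norm.rpow_const fun _ => Or.inr hgap.le))
    have := h1.tendsto 0
    rw [norm_zero, Real.zero_rpow hgap.ne', mul_zero, sub_zero] at this
    exact this.mono_left nhdsWithin_le_nhds
  refine tendsto_of_tendsto_of_tendsto_of_le_of_le' hlim tendsto_const_nhds ?_ ?_
  all_goals
    filter_upwards [self_mem_nhdsWithin] with x hx
    have hxp : 0 < ‖x‖ := norm_pos_iff.mpr hx
    have h3 : 0 < ‖x‖ ^ tauMinus N μ := by positivity
    rw [Real.rpow_neg hxp.le]
  · rw [← div_eq_mul_inv, le_div_iff₀ h3, sub_mul, mul_assoc, ← Real.rpow_add hxp,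
      sub_add_cancel]
    exact (hu x hx).2.2
  · rw [← div_eq_mul_inv, div_le_iff₀ h3]
    exact (hu x hx).2.1

end BelowInvSq

section Green
variable {N : ℕ}

/-- Integration by parts against a compactly supported Lipschitz function. -/
theorem integral_fderiv_mul_add_eq_zero {a ζ : Euc N → ℝ} (ha : ContDiff ℝ 1 a) {L : NNReal}
    (hζ : LipschitzWith L ζ) (hc : HasCompactSupport ζ) (v : Euc N) :
    Integrable (fun x => fderiv ℝ a x v * ζ x + a x * fderiv ℝ ζ x v) ∧
      ∫ x, (fderiv ℝ a x v * ζ x + a x * fderiv ℝ ζ x v) = 0 := by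
  obtain ⟨R, hR⟩ := hc.isCompact.isBounded.subset_closedBall (0 : Euc N)
  let χ : Euc N → ℝ := fun x => Real.smoothTransition (R ^ 2 + 2 - ‖x‖ ^ 2)
  have hχ : ContDiff ℝ 1 χ :=
    Real.smoothTransition.contDiff.comp (contDiff_const.sub (contDiff_norm_sq ℝ))
  have hχc : HasCompactSupport χ :=
    HasCompactSupport.of_support_subset_isCompact (isCompact_closedBall (0 : Euc N) (R ^ 2 + 2))
      fun z hz => by
        rw [mem_closedBall_zero_iff]
        by_contra! h
        exact hz (Real.smoothTransition.zero_of_nonpos (by nlinarith [sq_nonneg R]))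
  let b : Euc N → ℝ := fun x => χ x * a x
  have hb : ContDiff ℝ 1 b := hχ.mul ha
  have hbc : HasCompactSupport b := hχc.mul_right
  obtain ⟨K, hK⟩ := hb.lipschitzWith_of_hasCompactSupport hbc one_ne_zero
  have hnear : ∀ x ∈ tsupport ζ, b =ᶠ[nhds x] a := fun x hx => by
    have h1 : ‖x‖ ≤ R := by simpa using hR hx
    have h2 : ∀ᶠ y : Euc N in nhds x, ‖y‖ ^ 2 < R ^ 2 + 1 :=
      (continuous_norm.pow 2).continuousAt.eventually_lt_const
        (by show ‖x‖ ^ 2 < R ^ 2 + 1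
            nlinarith [norm_nonneg x])
    filter_upwards [h2] with y hy
    simp only [b, χ]
    rw [Real.smoothTransition.one_of_one_le (by linarith), one_mul]
  have hfar : ∀ x, x ∉ tsupport ζ → fderiv ℝ ζ x = 0 := fun x hx =>
    image_eq_zero_of_notMem_tsupport fun h => hx (tsupport_fderiv_subset ℝ h)
  have e1 : ∀ x, fderiv ℝ a x v * ζ x = lineDeriv ℝ b x v * ζ x := fun x => by
    by_cases hx : x ∈ tsupport ζ
    · rw [(hb.differentiable one_ne_zero x).lineDeriv_eq_fderiv, (hnear x hx).fderiv_eq]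
    · rw [image_eq_zero_of_notMem_tsupport hx, mul_zero, mul_zero]
  have e2 : ∀ x, a x * fderiv ℝ ζ x v = b x * fderiv ℝ ζ x v := fun x => by
    by_cases hx : x ∈ tsupport ζ
    · rw [(hnear x hx).self_of_nhds]
    · rw [hfar x hx]; simp
  have i1 : Integrable fun x => fderiv ℝ a x v * ζ x :=
    (((ha.continuous_fderiv one_ne_zero).clm_apply continuous_const).mul
      hζ.continuous).integrable_of_hasCompactSupport hc.mul_left
  have i2 : Integrable fun x => a x * fderiv ℝ ζ x v := by
    simp only [e2]
    refine ((hb.continuous.integrable_of_hasCompactSupport hbc).norm.mul_const (L * ‖v‖)).mono'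
      (hb.continuous.aestronglyMeasurable.mul
        (measurable_fderiv_apply_const ℝ ζ v).aestronglyMeasurable) (Eventually.of_forall fun x => ?_)
    rw [norm_mul]
    refine mul_le_mul_of_nonneg_left ?_ (norm_nonneg _)
    exact (ContinuousLinearMap.le_opNorm _ _).trans (mul_le_mul_of_nonneg_right
      (norm_fderiv_le_of_lipschitz ℝ hζ) (norm_nonneg _))
  refine ⟨i1.add i2, ?_⟩
  rw [integral_add i1 i2]
  have h1 := hK.integral_lineDeriv_mul_eq (μ := volume) hζ hc v
  have h2 : ∫ x, lineDeriv ℝ ζ x (-v) * b x = ∫ x, -(a x * fderiv ℝ ζ x v) := by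
    refine integral_congr_ae ?_
    filter_upwards [hζ.ae_differentiableAt (μ := volume)] with x hx
    rw [hx.lineDeriv_eq_fderiv, e2, map_neg]
    ring
  simp only [e1]
  rw [h1, h2, integral_neg]
  ring

theorem IsC11c.contDiff {ξ : Euc N → ℝ} (hξ : IsC11c ξ) : ContDiff ℝ 1 ξ := by
  obtain ⟨-, h2, L, h3⟩ := hξ
  exact contDiff_one_iff_fderiv.mpr ⟨h2, h3.continuous⟩

theorem IsC11c.lipschitzWith_fderiv_apply {ξ : Euc N → ℝ} (hξ : IsC11c ξ) (v : Euc N) :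
    ∃ L, LipschitzWith L fun x => fderiv ℝ ξ x v := by
  obtain ⟨L, hL⟩ := hξ.2.2
  exact ⟨_, (ContinuousLinearMap.apply ℝ ℝ v).lipschitz.comp hL⟩

theorem IsC11c.hasCompactSupport_fderiv_apply {ξ : Euc N → ℝ} (hξ : IsC11c ξ) (v : Euc N) :
    HasCompactSupport fun x => fderiv ℝ ξ x v :=
  hξ.1.fderiv_apply (𝕜 := ℝ) v

theorem contDiff_of_forall_ne_zero {f : Euc N → ℝ} {n : WithTop ℕ∞}
    (h : ∀ x : Euc N, x ≠ 0 → ContDiffAt ℝ n f x) (h0 : f =ᶠ[nhds 0] fun _ => 0) :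
    ContDiff ℝ n f := by
  rw [contDiff_iff_contDiffAt]
  intro x
  by_cases hx : x = 0
  · exact contDiffAt_const.congr_of_eventuallyEq (hx ▸ h0)
  · exact h x hx

/-- Green's identity for a function regular off the origin, a weight vanishing near the origin and
a test function. -/
theorem integral_green (hN : 3 ≤ N) {ξ u p : Euc N → ℝ} (hξ : IsC11c ξ)
    (hu : ∀ x : Euc N, x ≠ 0 → ContDiffAt ℝ 2 u x) (hp : ∀ x : Euc N, x ≠ 0 → ContDiffAt ℝ 2 p x)
    (hp0 : p =ᶠ[nhds 0] fun _ => 0) :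
    Integrable (fun x => u x * p x * lap ξ x + 2 * u x * gradDot p ξ x +
        ξ x * (u x * lap p x - p x * lap u x)) ∧
      ∫ x, (u x * p x * lap ξ x + 2 * u x * gradDot p ξ x +
        ξ x * (u x * lap p x - p x * lap u x)) = 0 := by
  obtain ⟨Lξ, hLξ⟩ := hξ.contDiff.lipschitzWith_of_hasCompactSupport hξ.1 one_ne_zero
  have ha : ContDiff ℝ 1 fun x => u x * p x := by
    refine contDiff_of_forall_ne_zero (fun x hx => ((hu x hx).mul (hp x hx)).of_le (by norm_num)) ?_
    filter_upwards [hp0] with x hx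
    rw [hx, mul_zero]
  have hd : ∀ {f : Euc N → ℝ} {x : Euc N} (v : Euc N), ContDiffAt ℝ 2 f x →
      ContDiffAt ℝ 1 (fun y => fderiv ℝ f y v) x := fun v hf =>
    (hf.fderiv_right (m := 1) (by norm_num)).clm_apply contDiffAt_const
  have hb : ∀ v : Euc N, ContDiff ℝ 1 fun x => u x * fderiv ℝ p x v - p x * fderiv ℝ u x v := by
    intro v
    refine contDiff_of_forall_ne_zero (fun x hx => ?_) ?_
    · exact (((hu x hx).of_le (by norm_num)).mul (hd v (hp x hx))).sub
        (((hp x hx).of_le (by norm_num)).mul (hd v (hu x hx)))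
    · filter_upwards [hp0, hp0.fderiv (𝕜 := ℝ)] with x hx hx'
      rw [hx, hx']
      simp
  choose L hL using hξ.lipschitzWith_fderiv_apply
  have key := fun i : Fin N =>
    And.intro (integral_fderiv_mul_add_eq_zero ha (hL (coordVec i))
      (hξ.hasCompactSupport_fderiv_apply (coordVec i)) (coordVec i))
      (integral_fderiv_mul_add_eq_zero (hb (coordVec i)) hLξ hξ.1 (coordVec i))
  let F : Fin N → Euc N → ℝ := fun i x => fderiv ℝ (fun x => u x * p x) x (coordVec i) *
    fderiv ℝ ξ x (coordVec i) + u x * p x *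
      fderiv ℝ (fun y => fderiv ℝ ξ y (coordVec i)) x (coordVec i)
  let G : Fin N → Euc N → ℝ := fun i x =>
    fderiv ℝ (fun x => u x * fderiv ℝ p x (coordVec i) - p x * fderiv ℝ u x (coordVec i)) x
        (coordVec i) * ξ x +
      (u x * fderiv ℝ p x (coordVec i) - p x * fderiv ℝ u x (coordVec i)) *
        fderiv ℝ ξ x (coordVec i)
  have hi : ∀ i, Integrable fun x => F i x + G i x := fun i => (key i).1.1.add (key i).2.1
  have hsum : Integrable fun x => ∑ i : Fin N, (F i x + G i x) :=
    integrable_finsetSum Finset.univ fun i _ => hi i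
  have heq : (fun x => ∑ i : Fin N, (F i x + G i x)) =ᵐ[volume]
      fun x => u x * p x * lap ξ x + 2 * u x * gradDot p ξ x +
        ξ x * (u x * lap p x - p x * lap u x) := by
    filter_upwards [ae_ne_zero hN] with x hx
    have du := (hu x hx).twiceDiffAt
    have dp := (hp x hx).twiceDiffAt
    simp only [F, G]
    unfold lap gradDot
    simp only [mul_sub, Finset.mul_sum]
    rw [← Finset.sum_sub_distrib, ← Finset.sum_add_distrib, ← Finset.sum_add_distrib]
    refine Finset.sum_congr rfl fun i _ => ?_
    rw [fderiv_fun_sub (du.differentiableAt.fun_mul (dp.apply (coordVec i)))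
        (dp.differentiableAt.fun_mul (du.apply (coordVec i))),
      fderiv_fun_mul du.differentiableAt (dp.apply (coordVec i)),
      fderiv_fun_mul dp.differentiableAt (du.apply (coordVec i)),
      fderiv_fun_mul du.differentiableAt dp.differentiableAt]
    simp only [add_apply, sub_apply, smul_apply, smul_eq_mul, coordVec]
    ring
  refine ⟨hsum.congr heq, ?_⟩
  rw [← integral_congr_ae heq, integral_finsetSum _ fun i _ => hi i]
  refine Finset.sum_eq_zero fun i _ => ?_
  rw [integral_add (key i).1.1 (key i).2.1, (key i).1.2, (key i).2.2, add_zero]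

end Green

section Profile

theorem contDiff_cutProfile {n : WithTop ℕ∞} (hn : n ≤ (⊤ : ℕ∞)) : ContDiff ℝ n cutProfile :=
  (Real.smoothTransition.contDiff (n := (⊤ : ℕ∞))).of_le hn |>.comp
    ((contDiff_const.mul (contDiff_id.pow 2)).sub contDiff_const)

theorem cutProfile_eq_zero {t : ℝ} (h : |t| ≤ 1 / 2) : cutProfile t = 0 :=
  Real.smoothTransition.zero_of_nonpos (by
    have := sq_le_sq' (abs_le.mp h).1 (abs_le.mp h).2
    linarith)

theorem cutProfile_eq_one {t : ℝ} (h : 1 ≤ t) : cutProfile t = 1 :=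
  Real.smoothTransition.one_of_one_le (by nlinarith)

theorem cutProfile_nonneg (t : ℝ) : 0 ≤ cutProfile t := Real.smoothTransition.nonneg _

theorem cutProfile_le_one (t : ℝ) : cutProfile t ≤ 1 := Real.smoothTransition.le_one _

theorem hasDerivAt_cutProfile (t : ℝ) : HasDerivAt cutProfile (deriv cutProfile t) t :=
  ((contDiff_cutProfile (n := 1) (by norm_cast)).differentiable one_ne_zero t).hasDerivAt

theorem contDiff_deriv_cutProfile : ContDiff ℝ 1 (deriv cutProfile) := by
  have : ContDiff ℝ (1 + 1) cutProfile := contDiff_cutProfile (by norm_cast)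
  exact (contDiff_succ_iff_deriv.mp this).2.2

theorem hasDerivAt_deriv_cutProfile (t : ℝ) :
    HasDerivAt (deriv cutProfile) (deriv (deriv cutProfile) t) t :=
  (contDiff_deriv_cutProfile.differentiable one_ne_zero t).hasDerivAt

theorem deriv_cutProfile_eq_zero {t : ℝ} (h : |t| < 1 / 2 ∨ 1 < t) :
    deriv cutProfile t = 0 ∧ deriv (deriv cutProfile) t = 0 := by
  have key : ∃ a : ℝ, cutProfile =ᶠ[nhds t] fun _ => a := by
    rcases h with h | h
    · refine ⟨0, ?_⟩
      filter_upwards [continuous_abs.continuousAt.eventually_lt_const h] with y hy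
      exact cutProfile_eq_zero hy.le
    · refine ⟨1, ?_⟩
      filter_upwards [lt_mem_nhds h] with y hy
      exact cutProfile_eq_one (le_of_lt hy)
  obtain ⟨a, ha⟩ := key
  refine ⟨by rw [ha.deriv_eq, deriv_const], ?_⟩
  have : deriv cutProfile =ᶠ[nhds t] fun _ => 0 := by
    filter_upwards [ha.deriv] with y hy
    rw [hy, deriv_const]
  rw [this.deriv_eq, deriv_const]

/-- The coefficient produced by a power weight of exponent `τ` times the cutoff. -/
def cutCoef (N : ℕ) (τ t : ℝ) : ℝ :=
  deriv (deriv cutProfile) t + (2 * τ + N - 1) / t * deriv cutProfile t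

theorem cutCoef_eq_zero {N : ℕ} {τ t : ℝ} (h : |t| < 1 / 2 ∨ 1 < t) : cutCoef N τ t = 0 := by
  rw [cutCoef, (deriv_cutProfile_eq_zero h).1, (deriv_cutProfile_eq_zero h).2]
  ring

theorem exists_bound_cutProfile (N : ℕ) (τ : ℝ) : ∃ C, 0 ≤ C ∧ ∀ t : ℝ, 0 < t →
    |deriv cutProfile t / t| ≤ C ∧ |cutCoef N τ t| ≤ C := by
  have hc1 : Continuous (deriv cutProfile) := contDiff_deriv_cutProfile.continuous
  have hc2 : Continuous (deriv (deriv cutProfile)) :=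
    contDiff_deriv_cutProfile.continuous_deriv_one
  have hsub : ∀ t ∈ Set.Icc (1 / 2 : ℝ) 1, t ≠ 0 := fun t ht => by
    have := ht.1; positivity
  have h1 : ContinuousOn (fun t => deriv cutProfile t / t) (Set.Icc (1 / 2) 1) :=
    hc1.continuousOn.div continuousOn_id hsub
  have h2 : ContinuousOn (cutCoef N τ) (Set.Icc (1 / 2) 1) :=
    hc2.continuousOn.add ((continuousOn_const.div continuousOn_id hsub).mul hc1.continuousOn)
  obtain ⟨C1, hC1⟩ := isCompact_Icc.exists_bound_of_continuousOn h1
  obtain ⟨C2, hC2⟩ := isCompact_Icc.exists_bound_of_continuousOn h2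
  refine ⟨max C1 (max C2 0), le_max_of_le_right (le_max_right _ _), fun t ht => ?_⟩
  by_cases h : t ∈ Set.Icc (1 / 2 : ℝ) 1
  · exact ⟨(hC1 t h).trans (le_max_left _ _),
      (hC2 t h).trans ((le_max_left _ _).trans (le_max_right _ _))⟩
  · have h' : |t| < 1 / 2 ∨ 1 < t := by
      rw [abs_of_pos ht]
      rw [Set.mem_Icc, not_and_or] at h
      exact h.imp not_le.mp not_le.mp
    rw [cutCoef_eq_zero h', (deriv_cutProfile_eq_zero h').1, zero_div, abs_zero]
    have : (0:ℝ) ≤ max C1 (max C2 0) := le_max_of_le_right (le_max_right _ _)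
    exact ⟨this, this⟩

theorem integral_Ioi_mul_cutCoef (N : ℕ) (τ : ℝ) :
    ∫ t in Set.Ioi (0:ℝ), t * cutCoef N τ t = 2 * τ + N - 2 := by
  let H : ℝ → ℝ := fun t => (2 * τ + N - 2) * cutProfile t + t * deriv cutProfile t
  let H' : ℝ → ℝ := fun t =>
    (2 * τ + N - 1) * deriv cutProfile t + t * deriv (deriv cutProfile) t
  have hc1 : Continuous (deriv cutProfile) := contDiff_deriv_cutProfile.continuous
  have hc2 : Continuous (deriv (deriv cutProfile)) :=
    contDiff_deriv_cutProfile.continuous_deriv_one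
  have hd : ∀ t, HasDerivAt H (H' t) t := fun t => by
    have := ((hasDerivAt_cutProfile t).const_mul (2 * τ + N - 2)).add
      ((hasDerivAt_id t).mul (hasDerivAt_deriv_cutProfile t))
    refine this.congr_deriv ?_
    simp only [id, H']
    ring
  have hcont : Continuous H' :=
    (continuous_const.mul hc1).add (continuous_id.mul hc2)
  have hinteg : IntegrableOn H' (Set.Ioi 0) := by
    rw [← Set.Ioc_union_Ioi_eq_Ioi (zero_le_one (α := ℝ))]
    refine IntegrableOn.union ?_ ?_
    · exact (hcont.integrableOn_Icc (a := 0) (b := 1)).mono_set Set.Ioc_subset_Icc_self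
    · refine integrableOn_zero.congr_fun (fun t ht => ?_) measurableSet_Ioi
      have := deriv_cutProfile_eq_zero (Or.inr ht)
      simp only [H', this.1, this.2, mul_zero, add_zero]
  have hlim : Tendsto H atTop (nhds (2 * τ + N - 2)) := by
    refine tendsto_const_nhds.congr' ?_
    filter_upwards [eventually_gt_atTop 1] with t ht
    simp only [H, cutProfile_eq_one ht.le, (deriv_cutProfile_eq_zero (Or.inr ht)).1]
    ring
  have e := integral_Ioi_of_hasDerivAt_of_tendsto' (fun t _ => hd t) hinteg hlim
  have h0 : H 0 = 0 := by
    simp only [H, cutProfile_eq_zero (t := 0) (by norm_num)]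
    ring
  rw [h0, sub_zero] at e
  rw [← e]
  refine setIntegral_congr_fun measurableSet_Ioi fun t ht => ?_
  have : t ≠ 0 := ne_of_gt ht
  simp only [cutCoef, H']
  field_simp
  ring

theorem integral_norm_rpow_mul_cutCoef {N : ℕ} (hN : 3 ≤ N) (τ : ℝ) :
    ∫ y : Euc N, ‖y‖ ^ (2 - N : ℝ) * cutCoef N τ ‖y‖ = (2 * τ + N - 2) * sphereArea N := by
  have : Nonempty (Fin N) := ⟨⟨0, by omega⟩⟩
  have := integral_fun_norm_addHaar (volume : Measure (Euc N))
    fun t : ℝ => t ^ (2 - N : ℝ) * cutCoef N τ t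
  rw [this, finrank_euclideanSpace_fin]
  have e : ∫ t in Set.Ioi (0:ℝ), t ^ (N - 1) • (t ^ (2 - N : ℝ) * cutCoef N τ t)
      = ∫ t in Set.Ioi (0:ℝ), t * cutCoef N τ t := by
    refine setIntegral_congr_fun measurableSet_Ioi fun t ht => ?_
    have ht' : (0:ℝ) < t := ht
    have : t ^ (N - 1) * t ^ (2 - N : ℝ) = t := by
      rw [← Real.rpow_natCast, ← Real.rpow_add ht', Nat.cast_sub (by omega)]
      norm_num
    simp only [smul_eq_mul]
    rw [← mul_assoc, this]
  rw [e, integral_Ioi_mul_cutCoef, sphereArea]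
  simp only [nsmul_eq_mul, smul_eq_mul, measureReal_def]
  ring

end Profile

section WeightIdentity
variable {N : ℕ}

theorem gradDot_comp_norm {g : ℝ → ℝ} {g' : ℝ} {x : Euc N} (hx : x ≠ 0) (hg : HasDerivAt g g' ‖x‖)
    (ξ : Euc N → ℝ) :
    gradDot (fun y => g ‖y‖) ξ x = g' / ‖x‖ * fderiv ℝ ξ x x := by
  have e : fderiv ℝ ξ x x = ∑ i, x i * fderiv ℝ ξ x (coordVec i) := by
    refine (congrArg (fderiv ℝ ξ x) ((EuclideanSpace.basisFun (Fin N) ℝ).sum_repr x)).symm.trans ?_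
    simp only [map_sum, map_smul, smul_eq_mul, coordVec, EuclideanSpace.basisFun_apply,
      EuclideanSpace.basisFun_repr]
  rw [e, gradDot, Finset.mul_sum]
  refine Finset.sum_congr rfl fun i _ => ?_
  rw [(hasFDerivAt_comp_norm hx hg).fderiv]
  simp [coordVec, EuclideanSpace.inner_single_right, innerSL_apply_apply]
  ring

end WeightIdentity

section CutWeight
variable {N : ℕ}

/-- The weight `‖x‖ ^ τ` cut off inside the ball of radius comparable to `r`. -/
def cutWeight (τ r : ℝ) (x : Euc N) : ℝ := ‖x‖ ^ τ * cutProfile (‖x‖ / r)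

theorem hasDerivAt_rpow_mul_cutProfile (τ r : ℝ) {t : ℝ} (ht : 0 < t) :
    HasDerivAt (fun t => t ^ τ * cutProfile (t / r))
      (t ^ τ * (τ / t * cutProfile (t / r) + deriv cutProfile (t / r) / r)) t ∧
    HasDerivAt (fun t => t ^ τ * (τ / t * cutProfile (t / r) + deriv cutProfile (t / r) / r))
      (t ^ τ * (τ * (τ - 1) / t ^ 2 * cutProfile (t / r) + 2 * τ / (t * r) *
        deriv cutProfile (t / r) + deriv (deriv cutProfile) (t / r) / r ^ 2)) t := by
  have hp : HasDerivAt (fun t : ℝ => t ^ τ) (t ^ τ * (τ / t)) t := by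
    refine (Real.hasDerivAt_rpow_const (Or.inl ht.ne')).congr_deriv ?_
    rw [Real.rpow_sub_one ht.ne']
    ring
  have hdiv : HasDerivAt (fun t : ℝ => t / r) (1 / r) t := (hasDerivAt_id t).div_const r
  have h1 : HasDerivAt (fun t => cutProfile (t / r)) (deriv cutProfile (t / r) * (1 / r)) t :=
    HasDerivAt.comp (h₂ := cutProfile) (h := fun t => t / r) t (hasDerivAt_cutProfile (t / r)) hdiv
  have h2 : HasDerivAt (fun t => deriv cutProfile (t / r))
      (deriv (deriv cutProfile) (t / r) * (1 / r)) t :=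
    HasDerivAt.comp (h₂ := deriv cutProfile) (h := fun t => t / r) t
      (hasDerivAt_deriv_cutProfile (t / r)) hdiv
  have h3 : HasDerivAt (fun t : ℝ => τ / t) (-τ / t ^ 2) t := by
    refine ((hasDerivAt_const t τ).div (hasDerivAt_id t) ht.ne').congr_deriv ?_
    simp
  constructor
  · refine (hp.mul h1).congr_deriv ?_
    ring
  · refine (hp.mul ((h3.mul h1).add (h2.div_const r))).congr_deriv ?_
    simp only [Pi.add_apply, Pi.mul_apply]
    field_simp
    ring

theorem contDiffAt_cutWeight (τ r : ℝ) {x : Euc N} (hx : x ≠ 0) :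
    ContDiffAt ℝ 2 (cutWeight τ r) x :=
  (contDiffAt_norm_rpow τ hx).mul ((contDiff_cutProfile (n := 2) (by norm_cast)).contDiffAt.comp x
    ((contDiffAt_norm ℝ hx).div_const r))

theorem cutWeight_eventuallyEq_zero (τ : ℝ) {r : ℝ} (hr : 0 < r) :
    (cutWeight τ r : Euc N → ℝ) =ᶠ[nhds 0] fun _ => 0 := by
  filter_upwards [ball_mem_nhds (0 : Euc N) (half_pos hr)] with x hx
  rw [mem_ball_zero_iff] at hx
  rw [cutWeight, cutProfile_eq_zero, mul_zero]
  rw [abs_of_nonneg (by positivity), div_le_iff₀ hr]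
  linarith

theorem lap_cutWeight (τ : ℝ) {r : ℝ} (hr : 0 < r) {x : Euc N} (hx : x ≠ 0) :
    lap (cutWeight τ r) x = ‖x‖ ^ τ * (τ * (τ + N - 2) / ‖x‖ ^ 2 * cutProfile (‖x‖ / r) +
      cutCoef N τ (‖x‖ / r) / r ^ 2) := by
  have hpos : 0 < ‖x‖ := norm_pos_iff.mpr hx
  have e := lap_comp_norm hx
    (by filter_upwards [lt_mem_nhds hpos] with t ht using (hasDerivAt_rpow_mul_cutProfile τ r ht).1)
    (hasDerivAt_rpow_mul_cutProfile τ r hpos).2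
  refine e.trans ?_
  rw [cutCoef]
  field_simp
  ring

theorem gradDot_cutWeight (τ : ℝ) {r : ℝ} (hr : 0 < r) {x : Euc N} (hx : x ≠ 0) (ξ : Euc N → ℝ) :
    gradDot (cutWeight τ r) ξ x = ‖x‖ ^ τ * (τ / ‖x‖ ^ 2 * cutProfile (‖x‖ / r) +
      deriv cutProfile (‖x‖ / r) / (‖x‖ / r) / r ^ 2) * fderiv ℝ ξ x x := by
  have hpos : 0 < ‖x‖ := norm_pos_iff.mpr hx
  refine (gradDot_comp_norm hx (hasDerivAt_rpow_mul_cutProfile τ r hpos).1 ξ).trans ?_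
  field_simp

end CutWeight

theorem tauPlus_add_tauMinus (N : ℕ) (μ : ℝ) : tauPlus N μ + tauMinus N μ = 2 - N := by
  unfold tauPlus tauMinus; ring

theorem IsSolution.contDiffAt {N : ℕ} {μ : ℝ} {V u : Euc N → ℝ} (h : IsSolution N μ V u) {x : Euc N}
    (hx : x ≠ 0) : ContDiffAt ℝ 2 u x := h.1.contDiffAt (isOpen_ne.mem_nhds hx)

theorem lap_eq_zero_of_notMem_tsupport {N : ℕ} {ξ : Euc N → ℝ} {x : Euc N} (hx : x ∉ tsupport ξ) :
    lap ξ x = 0 := by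
  rw [lap_congr (notMem_tsupport_iff_eventuallyEq.mp hx)]
  simp [lap]

theorem LstarMuV_eq_zero_of_notMem_tsupport {N : ℕ} {μ : ℝ} {V ξ : Euc N → ℝ} {x : Euc N}
    (hx : x ∉ tsupport ξ) : LstarMuV N μ V ξ x = 0 := by
  have h1 : fderiv ℝ ξ x = 0 :=
    image_eq_zero_of_notMem_tsupport fun h => hx (tsupport_fderiv_subset ℝ h)
  rw [LstarMuV, LstarMu, lap_eq_zero_of_notMem_tsupport hx, h1,
    image_eq_zero_of_notMem_tsupport hx]
  simp

theorem IsC11c.exists_abs_lap_le {N : ℕ} {ξ : Euc N → ℝ} (hξ : IsC11c ξ) :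
    ∃ C, 0 ≤ C ∧ ∀ x, |lap ξ x| ≤ C := by
  choose L hL using hξ.lipschitzWith_fderiv_apply
  refine ⟨∑ i, (L (coordVec i) : ℝ) * ‖(coordVec i : Euc N)‖, by positivity, fun x => ?_⟩
  refine (Finset.abs_sum_le_sum_abs _ _).trans (Finset.sum_le_sum fun i _ => ?_)
  exact (ContinuousLinearMap.le_opNorm _ _).trans (mul_le_mul_of_nonneg_right
    (norm_fderiv_le_of_lipschitz ℝ (hL (coordVec i))) (norm_nonneg _))

theorem IsC11c.exists_norm_le {N : ℕ} {ξ : Euc N → ℝ} (hξ : IsC11c ξ) :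
    ∃ C, 0 ≤ C ∧ ∀ x, |ξ x| ≤ C ∧ ‖fderiv ℝ ξ x‖ ≤ C := by
  obtain ⟨C1, h1⟩ := hξ.1.exists_bound_of_continuous hξ.contDiff.continuous
  obtain ⟨C2, h2⟩ := (hξ.1.fderiv (𝕜 := ℝ)).exists_bound_of_continuous
    (hξ.contDiff.continuous_fderiv one_ne_zero)
  exact ⟨max C1 C2, (norm_nonneg _).trans ((h1 0).trans (le_max_left _ _)), fun x =>
    ⟨(h1 x).trans (le_max_left _ _), (h2 x).trans (le_max_right _ _)⟩⟩

namespace BelowInvSq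
variable {N : ℕ} {μ c : ℝ} {V : Euc N → ℝ}

theorem two_mul_tauPlus (N : ℕ) (μ : ℝ) : 2 * tauPlus N μ + N - 2 = 2 * √(mu0 N - μ) := by
  unfold tauPlus; ring

theorem tauPlus_mul (h : BelowInvSq N μ c V) : tauPlus N μ * (tauPlus N μ + N - 2) = -μ := by
  have := h.sq_sqrt
  unfold tauPlus
  unfold mu0 at *
  nlinarith

theorem aestronglyMeasurable_potential (h : BelowInvSq N μ c V) : AEStronglyMeasurable V volume :=
  aestronglyMeasurable_of_continuousAt (by have := h.dim; omega)
    fun y hy => (h.holder y hy).continuousAt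

theorem measurable_lap (ξ : Euc N → ℝ) : Measurable (lap ξ) := by
  unfold lap
  exact Finset.measurable_sum _ fun i _ => measurable_fderiv_apply_const ℝ _ _

theorem aestronglyMeasurable_LstarMuV (h : BelowInvSq N μ c V) {ξ : Euc N → ℝ} (hξ : IsC11c ξ) :
    AEStronglyMeasurable (LstarMuV N μ V ξ) volume := by
  have hV := h.aestronglyMeasurable_potential
  have h1 : AEStronglyMeasurable (fun x => 2 * tauPlus N μ / ‖x‖ ^ 2 * fderiv ℝ ξ x x) volume :=
    (by fun_prop : Measurable fun x : Euc N => 2 * tauPlus N μ / ‖x‖ ^ 2).aestronglyMeasurable.mul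
      ((hξ.contDiff.continuous_fderiv one_ne_zero).clm_apply continuous_id).aestronglyMeasurable
  have h2 : AEStronglyMeasurable (fun x : Euc N => ‖x‖ ^ (-2 : ℝ)) volume :=
    (by fun_prop : Measurable fun x : Euc N => ‖x‖ ^ (-2 : ℝ)).aestronglyMeasurable
  exact (((measurable_lap ξ).aestronglyMeasurable.neg).sub h1).sub
    (((hV.sub h2).const_mul μ).mul hξ.contDiff.continuous.aestronglyMeasurable)

theorem exists_abs_LstarMuV_le (h : BelowInvSq N μ c V) {ξ : Euc N → ℝ} (hξ : IsC11c ξ) :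
    ∃ C, 0 ≤ C ∧ ∀ x : Euc N, x ≠ 0 → |LstarMuV N μ V ξ x| ≤ C * (1 + ‖x‖⁻¹) := by
  obtain ⟨C1, hC1, h1⟩ := hξ.exists_abs_lap_le
  obtain ⟨C2, hC2, h2⟩ := hξ.exists_norm_le
  have hc := h.const_pos
  have hμ := h.coupling_pos
  refine ⟨C1 + 2 * |tauPlus N μ| * C2 + μ * c * C2, by positivity, fun x hx => ?_⟩
  have hpos : 0 < ‖x‖ := norm_pos_iff.mpr hx
  have e1 : |2 * tauPlus N μ / ‖x‖ ^ 2 * fderiv ℝ ξ x x| ≤ 2 * |tauPlus N μ| * C2 * ‖x‖⁻¹ := by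
    have : |fderiv ℝ ξ x x| ≤ C2 * ‖x‖ :=
      (ContinuousLinearMap.le_opNorm _ _).trans (mul_le_mul_of_nonneg_right (h2 x).2 hpos.le)
    rw [abs_mul, abs_div, abs_mul, abs_of_pos (by positivity : 0 < ‖x‖ ^ 2),
      abs_of_pos (zero_lt_two (α := ℝ))]
    calc 2 * |tauPlus N μ| / ‖x‖ ^ 2 * |fderiv ℝ ξ x x|
        ≤ 2 * |tauPlus N μ| / ‖x‖ ^ 2 * (C2 * ‖x‖) := by gcongr
      _ = _ := by field_simp
  have e2 : |μ * (V x - ‖x‖ ^ (-2 : ℝ)) * ξ x| ≤ μ * c * C2 := by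
    have : |V x - ‖x‖ ^ (-2 : ℝ)| ≤ c := by
      have h3 := h.lower x hx
      have h4 := h.upper x hx
      rw [abs_le]
      constructor <;> linarith
    rw [abs_mul, abs_mul, abs_of_pos hμ]
    have := (h2 x).1
    gcongr
  have e3 := h1 x
  rw [LstarMuV, LstarMu]
  have hi : 0 < ‖x‖⁻¹ := by positivity
  have t1 := abs_sub (-lap ξ x - 2 * tauPlus N μ / ‖x‖ ^ 2 * fderiv ℝ ξ x x)
    (μ * (V x - ‖x‖ ^ (-2 : ℝ)) * ξ x)
  have t2 := abs_sub (-lap ξ x) (2 * tauPlus N μ / ‖x‖ ^ 2 * fderiv ℝ ξ x x)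
  rw [abs_neg] at t2
  have q1 : 0 ≤ C1 * ‖x‖⁻¹ := by positivity
  have q2 : 0 ≤ 2 * |tauPlus N μ| * C2 := by positivity
  have q3 : 0 ≤ μ * c * C2 * ‖x‖⁻¹ := by positivity
  nlinarith

theorem integrable_test (h : BelowInvSq N μ c V) {u : Euc N → ℝ} {k : ℝ} (hk : 0 ≤ k)
    (hm : AEStronglyMeasurable u volume)
    (hu : ∀ y : Euc N, y ≠ 0 → |u y| ≤ k * ‖y‖ ^ tauMinus N μ) {ξ : Euc N → ℝ} (hξ : IsC11c ξ) :
    Integrable fun x => u x * LstarMuV N μ V ξ x * ‖x‖ ^ tauPlus N μ := by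
  obtain ⟨C, hC0, hC⟩ := h.exists_abs_LstarMuV_le hξ
  obtain ⟨R, hR⟩ := hξ.1.isCompact.isBounded.subset_closedBall (0 : Euc N)
  have hN2 : 2 ≤ N := by have := h.dim; omega
  have i1 := (integrableOn_norm_rpow hN2 (b := 2 - (N:ℝ)) (by linarith) R).add
    (integrableOn_norm_rpow hN2 (b := 1 - (N:ℝ)) (by linarith) R)
  have hw : AEStronglyMeasurable (fun x : Euc N => ‖x‖ ^ tauPlus N μ) volume :=
    (by fun_prop : Measurable fun x : Euc N => ‖x‖ ^ tauPlus N μ).aestronglyMeasurable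
  refine (IntegrableOn.integrable_indicator (i1.const_mul (k * C)) measurableSet_closedBall).mono'
    ((hm.mul (h.aestronglyMeasurable_LstarMuV hξ)).mul hw) ?_
  filter_upwards [ae_ne_zero h.dim] with x hx
  have hpos : 0 < ‖x‖ := norm_pos_iff.mpr hx
  by_cases hxR : x ∈ closedBall (0 : Euc N) R
  · rw [Set.indicator_of_mem hxR, norm_mul, norm_mul, Real.norm_eq_abs, Real.norm_eq_abs,
      Real.norm_of_nonneg (by positivity)]
    calc |u x| * |LstarMuV N μ V ξ x| * ‖x‖ ^ tauPlus N μ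
        ≤ (k * ‖x‖ ^ tauMinus N μ) * (C * (1 + ‖x‖⁻¹)) * ‖x‖ ^ tauPlus N μ := by
          gcongr
          · exact hu x hx
          · exact hC x hx
      _ = k * C * ((‖x‖ ^ tauPlus N μ * ‖x‖ ^ tauMinus N μ) * (1 + ‖x‖⁻¹)) := by ring
      _ = _ := by
          rw [← Real.rpow_add hpos, tauPlus_add_tauMinus, Pi.add_apply, mul_add, mul_one,
            ← Real.rpow_neg_one, ← Real.rpow_add hpos]
          ring_nf
  · rw [Set.indicator_of_notMem hxR, LstarMuV_eq_zero_of_notMem_tsupport fun hx' => hxR (hR hx')]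
    simp

/-- The boundary contribution created by cutting off the weight at scale `r`. -/
def cutTerm (N : ℕ) (μ : ℝ) (u ξ : Euc N → ℝ) (r : ℝ) (x : Euc N) : ℝ :=
  u x * ‖x‖ ^ tauPlus N μ / r ^ 2 * (2 * (deriv cutProfile (‖x‖ / r) / (‖x‖ / r)) * fderiv ℝ ξ x x +
    ξ x * cutCoef N (tauPlus N μ) (‖x‖ / r))

theorem green_integrand_eq (h : BelowInvSq N μ c V) {u ξ : Euc N → ℝ} (hu : IsSolution N μ V u)
    {r : ℝ} (hr : 0 < r) {x : Euc N} (hx : x ≠ 0) :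
    u x * cutWeight (tauPlus N μ) r x * lap ξ x + 2 * u x * gradDot (cutWeight (tauPlus N μ) r) ξ x +
        ξ x * (u x * lap (cutWeight (tauPlus N μ) r) x - cutWeight (tauPlus N μ) r x * lap u x) =
      cutTerm N μ u ξ r x -
        cutProfile (‖x‖ / r) * (u x * LstarMuV N μ V ξ x * ‖x‖ ^ tauPlus N μ) := by
  have hl : lap u x = -(μ * V x * u x) := by have := hu.2 x hx; linarith
  have hpos : 0 < ‖x‖ := norm_pos_iff.mpr hx
  rw [lap_cutWeight _ hr hx, gradDot_cutWeight _ hr hx, h.tauPlus_mul, hl, cutTerm, LstarMuV, LstarMu,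
    cutWeight, Real.rpow_neg hpos.le, Real.rpow_two]
  ring

theorem integral_cutProfile_mul (h : BelowInvSq N μ c V) {u ξ : Euc N → ℝ}
    (hu : IsSolution N μ V u) (hξ : IsC11c ξ)
    (hi : Integrable fun x => u x * LstarMuV N μ V ξ x * ‖x‖ ^ tauPlus N μ) {r : ℝ} (hr : 0 < r) :
    ∫ x, cutProfile (‖x‖ / r) * (u x * LstarMuV N μ V ξ x * ‖x‖ ^ tauPlus N μ) =
      ∫ x, cutTerm N μ u ξ r x := by
  obtain ⟨g1, g2⟩ := integral_green h.dim hξ (fun x hx => hu.contDiffAt hx)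
    (fun x hx => contDiffAt_cutWeight (tauPlus N μ) r hx) (cutWeight_eventuallyEq_zero _ hr)
  have hae := (ae_ne_zero h.dim).mono fun x hx => h.green_integrand_eq (ξ := ξ) hu hr hx
  have hcut : Continuous fun x : Euc N => cutProfile (‖x‖ / r) :=
    (contDiff_cutProfile (n := 0) (by norm_cast)).continuous.comp (continuous_norm.div_const r)
  have hA : Integrable fun x =>
      cutProfile (‖x‖ / r) * (u x * LstarMuV N μ V ξ x * ‖x‖ ^ tauPlus N μ) := by
    refine hi.norm.mono' (hcut.aestronglyMeasurable.mul hi.aestronglyMeasurable)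
      (Eventually.of_forall fun x => ?_)
    rw [norm_mul, Real.norm_of_nonneg (cutProfile_nonneg _)]
    exact mul_le_of_le_one_left (norm_nonneg _) (cutProfile_le_one _)
  have hB : Integrable (cutTerm N μ u ξ r) := by
    refine ((g1.congr hae).add hA).congr (Eventually.of_forall fun x => ?_)
    simp only [Pi.add_apply, sub_add_cancel]
  rw [integral_congr_ae hae, integral_sub hB hA] at g2
  linarith

end BelowInvSq

section CutLimit
variable {N : ℕ}

theorem continuousAt_cutCoef (τ : ℝ) {t : ℝ} (ht : t ≠ 0) : ContinuousAt (cutCoef N τ) t :=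
  contDiff_deriv_cutProfile.continuous_deriv_one.continuousAt.add
    ((continuousAt_const.div continuousAt_id ht).mul contDiff_deriv_cutProfile.continuous.continuousAt)

theorem tendsto_integral_cutProfile_mul (hN : 3 ≤ N) {f : Euc N → ℝ} (hf : Integrable f) :
    Tendsto (fun r : ℝ => ∫ x, cutProfile (‖x‖ / r) * f x) (nhdsWithin 0 (Set.Ioi 0))
      (nhds (∫ x, f x)) := by
  have hcut : ∀ r : ℝ, Continuous fun x : Euc N => cutProfile (‖x‖ / r) := fun r =>
    (contDiff_cutProfile (n := 0) (by norm_cast)).continuous.comp (continuous_norm.div_const r)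
  refine tendsto_integral_filter_of_dominated_convergence (fun x => ‖f x‖)
    (Eventually.of_forall fun r => (hcut r).aestronglyMeasurable.mul hf.aestronglyMeasurable)
    (Eventually.of_forall fun r => Eventually.of_forall fun x => ?_) hf.norm ?_
  · rw [norm_mul, Real.norm_of_nonneg (cutProfile_nonneg _)]
    exact mul_le_of_le_one_left (norm_nonneg _) (cutProfile_le_one _)
  · filter_upwards [ae_ne_zero hN] with x hx
    have hpos : 0 < ‖x‖ := norm_pos_iff.mpr hx
    refine tendsto_const_nhds.congr' ?_
    filter_upwards [Ioc_mem_nhdsGT hpos] with r hr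
    rw [cutProfile_eq_one ((one_le_div hr.1).mpr hr.2), one_mul]

end CutLimit

namespace BelowInvSq
variable {N : ℕ} {μ c : ℝ} {V : Euc N → ℝ}

/-- The integrand `cutTerm` after rescaling to unit size. -/
def scaledTerm (N : ℕ) (μ : ℝ) (u ξ : Euc N → ℝ) (r : ℝ) (y : Euc N) : ℝ :=
  r ^ (-tauMinus N μ) * u (r • y) * ‖y‖ ^ tauPlus N μ *
    (r * (2 * (deriv cutProfile ‖y‖ / ‖y‖) * fderiv ℝ ξ (r • y) y) +
      ξ (r • y) * cutCoef N (tauPlus N μ) ‖y‖)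

theorem integral_cutTerm_eq (u ξ : Euc N → ℝ) {r : ℝ} (hr : 0 < r) :
    ∫ x, cutTerm N μ u ξ r x = ∫ y, scaledTerm N μ u ξ r y := by
  have e : ∀ y, cutTerm N μ u ξ r (r • y) = (r ^ N)⁻¹ * scaledTerm N μ u ξ r y := fun y => by
    have e1 : r ^ (-tauMinus N μ) = r ^ N * r ^ tauPlus N μ / r ^ 2 := by
      rw [← Real.rpow_natCast, ← Real.rpow_natCast, ← Real.rpow_add hr, ← Real.rpow_sub hr]
      congr 1
      have := tauPlus_add_tauMinus N μ
      push_cast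
      linarith
    have e2 : ‖r • y‖ / r = ‖y‖ := by
      rw [norm_smul, Real.norm_of_nonneg hr.le]; field_simp
    rw [cutTerm, scaledTerm, e2, e1, map_smul, smul_eq_mul, norm_smul, Real.norm_of_nonneg hr.le,
      Real.mul_rpow hr.le (norm_nonneg _)]
    field_simp
  have := Measure.integral_comp_smul (volume : Measure (Euc N)) (cutTerm N μ u ξ r) r
  simp only [e] at this
  rw [integral_const_mul, finrank_euclideanSpace_fin, abs_of_pos (by positivity), smul_eq_mul] at this
  exact (mul_left_cancel₀ (by positivity) this).symm

theorem tendsto_integral_cutTerm (h : BelowInvSq N μ c V) {u ξ : Euc N → ℝ} {k A : ℝ} (hk : 0 ≤ k)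
    (hs : Sandwich N μ k A u) (hu : ∀ x : Euc N, x ≠ 0 → ContinuousAt u x) (hξ : IsC11c ξ) :
    Tendsto (fun r : ℝ => ∫ x, cutTerm N μ u ξ r x) (nhdsWithin 0 (Set.Ioi 0))
      (nhds (cMu N μ * k * ξ 0)) := by
  have hN2 : 2 ≤ N := by have := h.dim; omega
  have hval : cMu N μ * k * ξ 0 =
      ∫ y : Euc N, k * ξ 0 * (‖y‖ ^ (2 - N : ℝ) * cutCoef N (tauPlus N μ) ‖y‖) := by
    rw [integral_const_mul, integral_norm_rpow_mul_cutCoef h.dim, cMu, if_pos h.coupling_lt,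
      two_mul_tauPlus]
    ring
  obtain ⟨M, hM0, hM⟩ := hξ.exists_norm_le
  obtain ⟨C, hC0, hC⟩ := exists_bound_cutProfile N (tauPlus N μ)
  have hcong : (fun r : ℝ => ∫ x, cutTerm N μ u ξ r x) =ᶠ[nhdsWithin 0 (Set.Ioi 0)]
      fun r => ∫ y, scaledTerm N μ u ξ r y := by
    filter_upwards [self_mem_nhdsWithin] with r hr using integral_cutTerm_eq u ξ hr
  have hfd := hξ.contDiff.continuous_fderiv one_ne_zero
  rw [hval]
  refine Tendsto.congr' hcong.symm ?_
  have hdom : Integrable ((closedBall (0 : Euc N) 1).indicator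
      fun y => k * (2 * C * M + M * C) * ‖y‖ ^ (2 - N : ℝ)) :=
    IntegrableOn.integrable_indicator
      ((integrableOn_norm_rpow hN2 (b := 2 - (N:ℝ)) (by linarith) 1).const_mul _)
      measurableSet_closedBall
  refine tendsto_integral_filter_of_dominated_convergence _ ?_ ?_ hdom ?_
  · filter_upwards [self_mem_nhdsWithin] with r hr
    have hr' : (0:ℝ) < r := hr
    refine aestronglyMeasurable_of_continuousAt (by omega) fun y hy => ?_
    have hsm : ContinuousAt (fun y : Euc N => r • y) y := by fun_prop
    have hny : ‖y‖ ≠ 0 := norm_ne_zero_iff.mpr hy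
    have c1 : ContinuousAt (fun y : Euc N => u (r • y)) y :=
      ContinuousAt.comp (g := u) (f := fun y : Euc N => r • y)
        (hu _ (smul_ne_zero hr'.ne' hy)) hsm
    have c2 : ContinuousAt (fun y : Euc N => ‖y‖ ^ tauPlus N μ) y :=
      (contDiffAt_norm_rpow (n := 1) _ hy).continuousAt
    have c3 : ContinuousAt (fun y : Euc N => deriv cutProfile ‖y‖ / ‖y‖) y :=
      (contDiff_deriv_cutProfile.continuous.comp continuous_norm).continuousAt.div
        continuous_norm.continuousAt hny
    have c4 : ContinuousAt (fun y : Euc N => fderiv ℝ ξ (r • y) y) y :=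
      ((hfd.comp (continuous_const_smul r)).clm_apply continuous_id).continuousAt
    have c5 : ContinuousAt (fun y : Euc N => ξ (r • y)) y :=
      (hξ.contDiff.continuous.comp (continuous_const_smul r)).continuousAt
    have c6 : ContinuousAt (fun y : Euc N => cutCoef N (tauPlus N μ) ‖y‖) y :=
      ContinuousAt.comp (g := cutCoef N (tauPlus N μ)) (f := fun y : Euc N => ‖y‖)
        (continuousAt_cutCoef _ hny) continuous_norm.continuousAt
    exact ((continuousAt_const.mul c1).mul c2).mul
      ((continuousAt_const.mul ((continuousAt_const.mul c3).mul c4)).add (c5.mul c6))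
  · filter_upwards [Ioc_mem_nhdsGT one_pos] with r hr
    filter_upwards [ae_ne_zero h.dim] with y hy
    have hpos : 0 < ‖y‖ := norm_pos_iff.mpr hy
    have hr0 : 0 < r := hr.1
    by_cases hyR : y ∈ closedBall (0 : Euc N) 1
    · rw [Set.indicator_of_mem hyR]
      have hy1 : ‖y‖ ≤ 1 := by simpa using hyR
      have b1 : |u (r • y)| ≤ k * (r ^ tauMinus N μ * ‖y‖ ^ tauMinus N μ) := by
        have := hs.abs_le (r • y) (smul_ne_zero hr0.ne' hy)
        rwa [norm_smul, Real.norm_of_nonneg hr0.le, Real.mul_rpow hr0.le hpos.le] at this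
      have b2 : |fderiv ℝ ξ (r • y) y| ≤ M :=
        (ContinuousLinearMap.le_opNorm _ _).trans
          ((mul_le_mul (hM _).2 hy1 hpos.le hM0).trans_eq (mul_one M))
      have b3 : |r * (2 * (deriv cutProfile ‖y‖ / ‖y‖) * fderiv ℝ ξ (r • y) y) +
          ξ (r • y) * cutCoef N (tauPlus N μ) ‖y‖| ≤ 2 * C * M + M * C := by
        refine (abs_add_le _ _).trans (add_le_add ?_ ?_)
        · rw [abs_mul, abs_mul, abs_mul, abs_of_pos hr0, abs_of_pos (zero_lt_two (α := ℝ))]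
          have := (hC _ hpos).1
          refine (mul_le_of_le_one_left (by positivity) hr.2).trans ?_
          gcongr
        · rw [abs_mul]
          have := (hC _ hpos).2
          have := (hM (r • y)).1
          gcongr
      have e1 : r ^ (-tauMinus N μ) * r ^ tauMinus N μ = 1 := by
        rw [← Real.rpow_add hr0, neg_add_cancel, Real.rpow_zero]
      have e2 : ‖y‖ ^ tauMinus N μ * ‖y‖ ^ tauPlus N μ = ‖y‖ ^ (2 - N : ℝ) := by
        rw [← Real.rpow_add hpos, add_comm, tauPlus_add_tauMinus]
      rw [scaledTerm, Real.norm_eq_abs, abs_mul, abs_mul, abs_mul,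
        abs_of_nonneg (by positivity : 0 ≤ r ^ (-tauMinus N μ)),
        abs_of_nonneg (by positivity : 0 ≤ ‖y‖ ^ tauPlus N μ)]
      calc _ ≤ r ^ (-tauMinus N μ) * (k * (r ^ tauMinus N μ * ‖y‖ ^ tauMinus N μ)) *
              ‖y‖ ^ tauPlus N μ * (2 * C * M + M * C) := by gcongr
        _ = (r ^ (-tauMinus N μ) * r ^ tauMinus N μ) * k * (2 * C * M + M * C) *
              (‖y‖ ^ tauMinus N μ * ‖y‖ ^ tauPlus N μ) := by ring
        _ = _ := by rw [e1, e2]; ring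
    · rw [Set.indicator_of_notMem hyR, scaledTerm]
      have hy1 : 1 < ‖y‖ := by simpa using hyR
      rw [cutCoef_eq_zero (Or.inr hy1), (deriv_cutProfile_eq_zero (Or.inr hy1)).1]
      simp
  · filter_upwards [ae_ne_zero h.dim] with y hy
    have hpos : 0 < ‖y‖ := norm_pos_iff.mpr hy
    have hsm0 : Tendsto (fun r : ℝ => r • y) (nhdsWithin 0 (Set.Ioi 0)) (nhds 0) := by
      have : Continuous fun r : ℝ => r • y := by fun_prop
      have := this.tendsto 0
      rw [zero_smul] at this
      exact this.mono_left nhdsWithin_le_nhds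
    have hsm : Tendsto (fun r : ℝ => r • y) (nhdsWithin 0 (Set.Ioi 0))
        (nhdsWithin 0 {x : Euc N | x ≠ 0}) := by
      refine tendsto_nhdsWithin_iff.mpr ⟨hsm0, ?_⟩
      filter_upwards [self_mem_nhdsWithin] with r hr
      exact smul_ne_zero (ne_of_gt hr) hy
    have l1 := (Sandwich.tendsto h hs).comp hsm
    have l2 : Tendsto (fun r : ℝ => r ^ (-tauMinus N μ) * u (r • y)) (nhdsWithin 0 (Set.Ioi 0))
        (nhds (k * ‖y‖ ^ tauMinus N μ)) := by
      refine (l1.mul_const (‖y‖ ^ tauMinus N μ)).congr' ?_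
      filter_upwards [self_mem_nhdsWithin] with r hr
      have hr0 : (0:ℝ) < r := hr
      have e1 : ‖y‖ ^ (-tauMinus N μ) * ‖y‖ ^ tauMinus N μ = 1 := by
        rw [← Real.rpow_add hpos, neg_add_cancel, Real.rpow_zero]
      simp only [Function.comp]
      rw [norm_smul, Real.norm_of_nonneg hr0.le, Real.mul_rpow hr0.le hpos.le]
      linear_combination u (r • y) * r ^ (-tauMinus N μ) * e1
    have l3 : Tendsto (fun r : ℝ => fderiv ℝ ξ (r • y) y) (nhdsWithin 0 (Set.Ioi 0))
        (nhds (fderiv ℝ ξ 0 y)) :=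
      ((hfd.clm_apply continuous_const).tendsto 0).comp hsm0
    have l4 : Tendsto (fun r : ℝ => ξ (r • y)) (nhdsWithin 0 (Set.Ioi 0)) (nhds (ξ 0)) :=
      (hξ.contDiff.continuous.tendsto 0).comp hsm0
    have l5 : Tendsto (fun r : ℝ => r) (nhdsWithin 0 (Set.Ioi 0)) (nhds (0:ℝ)) :=
      tendsto_id.mono_left nhdsWithin_le_nhds
    have := (l2.mul_const (‖y‖ ^ tauPlus N μ)).mul
      ((l5.mul (l3.const_mul (2 * (deriv cutProfile ‖y‖ / ‖y‖)))).add
        (l4.mul_const (cutCoef N (tauPlus N μ) ‖y‖)))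
    have e2 : ‖y‖ ^ (2 - N : ℝ) = ‖y‖ ^ tauMinus N μ * ‖y‖ ^ tauPlus N μ := by
      rw [← Real.rpow_add hpos, add_comm, tauPlus_add_tauMinus]
    refine this.trans (le_of_eq (congrArg nhds ?_))
    rw [e2]
    ring

theorem distribIdentity (h : BelowInvSq N μ c V) {u : Euc N → ℝ} {k A : ℝ} (hk : 0 ≤ k)
    (hs : Sandwich N μ k A u) (hu : IsSolution N μ V u) : DistribIdentity N μ V u k := by
  intro ξ hξ
  have hm : AEStronglyMeasurable u volume :=
    aestronglyMeasurable_of_continuousAt (by have := h.dim; omega)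
      fun x hx => (hu.contDiffAt hx).continuousAt
  have hi := h.integrable_test hk hm hs.abs_le hξ
  have l1 := tendsto_integral_cutProfile_mul h.dim hi
  have l2 := h.tendsto_integral_cutTerm hk hs (fun x hx => (hu.contDiffAt hx).continuousAt) hξ
  refine tendsto_nhds_unique l1 (l2.congr' ?_)
  filter_upwards [self_mem_nhdsWithin] with r hr
  exact (h.integral_cutProfile_mul hu hξ hi hr).symm

end BelowInvSq

section UnitTest
variable {N : ℕ}

/-- A smooth function equal to one near the origin and vanishing outside the unit ball. -/
def unitTest (x : Euc N) : ℝ := 1 - radCut x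

theorem unitTest_le_one (x : Euc N) : unitTest x ≤ 1 := sub_le_self _ (radCut_nonneg x)

theorem unitTest_eq_one {x : Euc N} (hx : ‖x‖ ≤ 1 / 2) : unitTest x = 1 := by
  rw [unitTest, radCut_eq_zero hx, sub_zero]

theorem unitTest_eq_zero {x : Euc N} (hx : 1 ≤ ‖x‖) : unitTest x = 0 := by
  rw [unitTest, radCut_eq_one hx, sub_self]

theorem contDiff_unitTest : ContDiff ℝ 2 (unitTest : Euc N → ℝ) :=
  contDiff_const.sub contDiff_radCut

theorem isC11c_unitTest_comp_smul {a : ℝ} (ha : 0 < a) :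
    IsC11c fun x : Euc N => unitTest (a • x) := by
  have hsupp : HasCompactSupport fun x : Euc N => unitTest (a • x) :=
    HasCompactSupport.of_support_subset_isCompact (isCompact_closedBall (0 : Euc N) a⁻¹)
      fun z hz => by
        rw [mem_closedBall_zero_iff]
        by_contra! h
        refine hz (unitTest_eq_zero ?_)
        rw [norm_smul, Real.norm_of_nonneg ha.le]
        exact ((inv_lt_iff_one_lt_mul₀' ha).mp h).le
  have hd : ContDiff ℝ 2 fun x : Euc N => unitTest (a • x) :=
    contDiff_unitTest.comp (contDiff_const_smul a)
  refine ⟨hsupp, hd.differentiable two_ne_zero, ?_⟩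
  exact (hd.fderiv_right (m := 1) (by norm_num)).lipschitzWith_of_hasCompactSupport
    (hsupp.fderiv (𝕜 := ℝ)) one_ne_zero

theorem isC11c_unitTest : IsC11c (unitTest : Euc N → ℝ) := by
  simpa using isC11c_unitTest_comp_smul (N := N) one_pos

theorem LstarMu_comp_smul (μ : ℝ) (ξ : Euc N → ℝ) {a : ℝ} (ha : a ≠ 0) (x : Euc N) :
    LstarMu N μ (fun y => ξ (a • y)) x = a ^ 2 * LstarMu N μ ξ (a • x) := by
  rw [LstarMu, LstarMu, lap_comp_smul, fderiv_comp_smul, norm_smul, mul_pow, Real.norm_eq_abs, sq_abs,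
    smul_apply, map_smul, smul_eq_mul]
  by_cases hx : x = 0
  · simp [hx]
  · have : ‖x‖ ≠ 0 := norm_ne_zero_iff.mpr hx
    field_simp

theorem LstarMu_unitTest_eq_zero (μ : ℝ) {x : Euc N} (hx : ‖x‖ < 1 / 2 ∨ 1 < ‖x‖) :
    LstarMu N μ unitTest x = 0 := by
  have key : ∃ a : ℝ, (unitTest : Euc N → ℝ) =ᶠ[nhds x] fun _ => a := by
    rcases hx with h | h
    · refine ⟨1, ?_⟩
      filter_upwards [continuous_norm.continuousAt.eventually_lt_const h] with y hy
      exact unitTest_eq_one (le_of_lt hy)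
    · refine ⟨0, ?_⟩
      filter_upwards [continuous_norm.continuousAt.eventually_const_lt h] with y hy
      exact unitTest_eq_zero (le_of_lt hy)
  obtain ⟨a, ha⟩ := key
  rw [LstarMu, lap_congr ha, ha.fderiv_eq]
  simp [lap]

theorem exists_abs_LstarMu_unitTest_le (N : ℕ) (μ : ℝ) :
    ∃ D, 0 < D ∧ ∀ x : Euc N, |LstarMu N μ unitTest x| ≤ D := by
  obtain ⟨C, hC0, hC⟩ := (isC11c_unitTest (N := N)).exists_abs_lap_le
  obtain ⟨M, hM0, hM⟩ := (isC11c_unitTest (N := N)).exists_norm_le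
  refine ⟨C + 4 * |tauPlus N μ| * M + 1, by positivity, fun x => ?_⟩
  by_cases hx : ‖x‖ < 1 / 2
  · rw [LstarMu_unitTest_eq_zero μ (Or.inl hx), abs_zero]
    positivity
  · have hx2 : 1 / 2 ≤ ‖x‖ := not_lt.mp hx
    have hpos : 0 < ‖x‖ := by linarith
    have h1 : |fderiv ℝ unitTest x x| ≤ M * ‖x‖ :=
      (ContinuousLinearMap.le_opNorm _ _).trans (mul_le_mul_of_nonneg_right (hM x).2 hpos.le)
    have h2 : |2 * tauPlus N μ / ‖x‖ ^ 2 * fderiv ℝ unitTest x x| ≤ 4 * |tauPlus N μ| * M := by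
      rw [abs_mul, abs_div, abs_mul, abs_of_pos (by positivity : 0 < ‖x‖ ^ 2),
        abs_of_pos (zero_lt_two (α := ℝ))]
      calc 2 * |tauPlus N μ| / ‖x‖ ^ 2 * |fderiv ℝ unitTest x x|
          ≤ 2 * |tauPlus N μ| / ‖x‖ ^ 2 * (M * ‖x‖) := by gcongr
        _ = 2 * |tauPlus N μ| * M * (1 / ‖x‖) := by field_simp
        _ ≤ 2 * |tauPlus N μ| * M * 2 := by
            gcongr
            rw [div_le_iff₀ hpos]
            linarith
        _ = _ := by ring
    have h3 := abs_sub (-lap unitTest x) (2 * tauPlus N μ / ‖x‖ ^ 2 * fderiv ℝ unitTest x x)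
    rw [abs_neg] at h3
    have := hC x
    rw [LstarMu]
    linarith

end UnitTest

namespace BelowInvSq
variable {N : ℕ} {μ c : ℝ} {V : Euc N → ℝ}

/-- A closed dyadic annulus centred at the origin. -/
def annulus (N : ℕ) (r : ℝ) : Set (Euc N) := closedBall 0 r \ ball 0 (r / 2)

theorem mem_annulus {r : ℝ} {x : Euc N} : x ∈ annulus N r ↔ ‖x‖ ≤ r ∧ r / 2 ≤ ‖x‖ := by
  simp [annulus]

theorem isCompact_annulus (r : ℝ) : IsCompact (annulus N r) :=
  (isCompact_closedBall _ _).diff isOpen_ball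

theorem tauPlus_neg (h : BelowInvSq N μ c V) : tauPlus N μ < 0 := by
  have h1 := h.tauMinus_gt
  have := tauPlus_add_tauMinus N μ
  linarith

theorem integrableOn_annulus {e : Euc N → ℝ} (he : ∀ x : Euc N, x ≠ 0 → ContinuousAt e x) {r : ℝ}
    (hr : 0 < r) : IntegrableOn e (annulus N r) := by
  refine ContinuousOn.integrableOn_compact (isCompact_annulus r) fun x hx =>
    (he x ?_).continuousWithinAt
  have := (mem_annulus.mp hx).2
  exact norm_pos_iff.mp (by linarith)

theorem test_le (h : BelowInvSq N μ c V) {e : Euc N → ℝ} (he : ∀ x : Euc N, x ≠ 0 → 0 ≤ e x) {D : ℝ}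
    (hD : ∀ x : Euc N, |LstarMu N μ unitTest x| ≤ D) {r : ℝ} (hr : 0 < r) (hr1 : r < 1 / 2)
    {x : Euc N} (hx : x ≠ 0) :
    e x * LstarMuV N μ V (fun y => unitTest (r⁻¹ • y)) x * ‖x‖ ^ tauPlus N μ ≤
      (annulus N r).indicator (fun x => D * (r ^ 2)⁻¹ * (r / 2) ^ tauPlus N μ * e x) x +
      (closedBall (0 : Euc N) r).indicator
        (fun x => ‖e x * LstarMuV N μ V unitTest x * ‖x‖ ^ tauPlus N μ‖) x := by
  have hpos : 0 < ‖x‖ := norm_pos_iff.mpr hx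
  have hD0 : 0 ≤ D := (abs_nonneg _).trans (hD 0)
  have hri : 0 < r⁻¹ := by positivity
  have hnorm : ‖r⁻¹ • x‖ = ‖x‖ / r := by
    rw [norm_smul, Real.norm_of_nonneg hri.le]; ring
  have hex := he x hx
  have hP : 0 < ‖x‖ ^ tauPlus N μ := by positivity
  have hμ := h.coupling_pos
  have hup : 0 ≤ ‖x‖ ^ (-2 : ℝ) - V x := sub_nonneg.mpr (h.upper x hx)
  rw [LstarMuV, LstarMu_comp_smul μ unitTest hri.ne']
  have split : e x * (r⁻¹ ^ 2 * LstarMu N μ unitTest (r⁻¹ • x) -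
      μ * (V x - ‖x‖ ^ (-2 : ℝ)) * unitTest (r⁻¹ • x)) * ‖x‖ ^ tauPlus N μ =
      e x * (r ^ 2)⁻¹ * LstarMu N μ unitTest (r⁻¹ • x) * ‖x‖ ^ tauPlus N μ +
      e x * (μ * (‖x‖ ^ (-2 : ℝ) - V x) * unitTest (r⁻¹ • x)) * ‖x‖ ^ tauPlus N μ := by
    rw [inv_pow]; ring
  rw [split]
  refine add_le_add ?_ ?_
  · by_cases hxa : x ∈ annulus N r
    · rw [Set.indicator_of_mem hxa]
      have h1 : ‖x‖ ^ tauPlus N μ ≤ (r / 2) ^ tauPlus N μ :=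
        Real.rpow_le_rpow_of_nonpos (by positivity) (mem_annulus.mp hxa).2 h.tauPlus_neg.le
      have h2 := (le_abs_self _).trans (hD (r⁻¹ • x))
      calc _ ≤ e x * (r ^ 2)⁻¹ * D * ‖x‖ ^ tauPlus N μ := by gcongr
        _ ≤ e x * (r ^ 2)⁻¹ * D * (r / 2) ^ tauPlus N μ := by gcongr
        _ = _ := by ring
    · rw [Set.indicator_of_notMem hxa]
      have : ‖r⁻¹ • x‖ < 1 / 2 ∨ 1 < ‖r⁻¹ • x‖ := by
        rw [hnorm, div_lt_iff₀ hr, one_lt_div hr]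
        rw [mem_annulus, not_and_or, not_le, not_le] at hxa
        rcases hxa with h1 | h1
        · exact Or.inr h1
        · exact Or.inl (by linarith)
      rw [LstarMu_unitTest_eq_zero μ this]
      simp
  · by_cases hxb : x ∈ closedBall (0 : Euc N) r
    · rw [Set.indicator_of_mem hxb]
      have hxr : ‖x‖ ≤ r := by simpa using hxb
      rw [LstarMuV, LstarMu_unitTest_eq_zero μ (Or.inl (by linarith : ‖x‖ < 1 / 2)),
        unitTest_eq_one (by linarith : ‖x‖ ≤ 1 / 2)]
      refine le_trans ?_ (le_abs_self _)
      have h1 := unitTest_le_one (r⁻¹ • x)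
      calc _ ≤ e x * (μ * (‖x‖ ^ (-2 : ℝ) - V x) * 1) * ‖x‖ ^ tauPlus N μ := by gcongr
        _ = _ := by ring
    · rw [Set.indicator_of_notMem hxb]
      have hxr : r < ‖x‖ := by simpa using hxb
      rw [unitTest_eq_zero (by rw [hnorm]; exact ((one_lt_div hr).mpr hxr).le)]
      simp

theorem exists_annulus_lower_bound (h : BelowInvSq N μ c V) {e : Euc N → ℝ}
    (hc : ∀ x : Euc N, x ≠ 0 → ContinuousAt e x) (he : ∀ x : Euc N, x ≠ 0 → 0 ≤ e x) {K : ℝ}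
    (hK : 0 < K) (hid : ∀ ξ : Euc N → ℝ, IsC11c ξ → ξ 0 = 1 →
      ∫ x : Euc N, e x * LstarMuV N μ V ξ x * ‖x‖ ^ tauPlus N μ = K) :
    ∃ b > 0, ∃ r₀ > 0, ∀ r, 0 < r → r < r₀ → b * r ^ (2 - tauPlus N μ) ≤ ∫ x in annulus N r, e x := by
  have hN := h.dim
  have hinteg : ∀ ξ : Euc N → ℝ, IsC11c ξ → ξ 0 = 1 →
      Integrable fun x : Euc N => e x * LstarMuV N μ V ξ x * ‖x‖ ^ tauPlus N μ := fun ξ h1 h2 => by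
    by_contra hn
    have := hid ξ h1 h2
    rw [integral_undef hn] at this
    exact hK.ne this
  have ht0 : unitTest (0 : Euc N) = 1 := unitTest_eq_one (by simp)
  obtain ⟨D, hD0, hD⟩ := exists_abs_LstarMu_unitTest_le N μ
  have i1 := (hinteg unitTest isC11c_unitTest ht0).norm
  have hvol : Tendsto (volume ∘ fun r : ℝ => closedBall (0 : Euc N) r) (nhdsWithin 0 (Set.Ioi 0))
      (nhds 0) := by
    have hcont : Continuous fun r : ℝ => ENNReal.ofReal (r ^ N) :=
      ENNReal.continuous_ofReal.comp (continuous_pow N)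
    have h1 : Tendsto (fun r : ℝ => ENNReal.ofReal (r ^ N) * volume (ball (0 : Euc N) 1))
        (nhds 0) (nhds (ENNReal.ofReal (0 ^ N) * volume (ball (0 : Euc N) 1))) :=
      ENNReal.Tendsto.mul_const (hcont.tendsto 0) (Or.inr measure_ball_lt_top.ne)
    rw [zero_pow (by omega), ENNReal.ofReal_zero, zero_mul] at h1
    refine (h1.mono_left nhdsWithin_le_nhds).congr' ?_
    filter_upwards [self_mem_nhdsWithin] with r hr
    rw [Function.comp, Measure.addHaar_closedBall _ _ (le_of_lt hr), finrank_euclideanSpace_fin]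
  have hsmall := (i1.tendsto_setIntegral_nhds_zero hvol).eventually_lt_const (half_pos hK)
  obtain ⟨r₁, hr₁, hsub⟩ := mem_nhdsGT_iff_exists_Ioo_subset.mp hsmall
  have hr₁' : (0:ℝ) < r₁ := hr₁
  refine ⟨K / 2 / (D * (1 / 2) ^ tauPlus N μ), by positivity, min r₁ (1 / 2), by positivity,
    fun r hr hr2 => ?_⟩
  have hrs : r < 1 / 2 := hr2.trans_le (min_le_right _ _)
  have hb : ∫ x in closedBall (0 : Euc N) r,
      ‖e x * LstarMuV N μ V unitTest x * ‖x‖ ^ tauPlus N μ‖ < K / 2 :=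
    hsub ⟨hr, hr2.trans_le (min_le_left _ _)⟩
  have hξ := isC11c_unitTest_comp_smul (N := N) (inv_pos.mpr hr)
  have hξ0 : unitTest (r⁻¹ • (0 : Euc N)) = 1 := by rw [smul_zero, ht0]
  have ia : IntegrableOn (fun x => D * (r ^ 2)⁻¹ * (r / 2) ^ tauPlus N μ * e x) (annulus N r) :=
    (integrableOn_annulus hc hr).const_mul _
  have hma : MeasurableSet (annulus N r) := (isCompact_annulus r).measurableSet
  have hle := integral_mono_ae (hinteg _ hξ hξ0)
    ((ia.integrable_indicator hma).add (i1.integrableOn.integrable_indicator measurableSet_closedBall))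
    ((ae_ne_zero hN).mono fun x hx => h.test_le he hD hr hrs hx)
  rw [hid _ hξ hξ0] at hle
  simp only [Pi.add_apply] at hle
  rw [integral_add (ia.integrable_indicator hma)
    (i1.integrableOn.integrable_indicator measurableSet_closedBall), integral_indicator hma,
    integral_indicator measurableSet_closedBall, integral_const_mul] at hle
  have hkey : K / 2 ≤ D * (r ^ 2)⁻¹ * (r / 2) ^ tauPlus N μ * ∫ x in annulus N r, e x := by
    linarith
  have e1 : (r / 2) ^ tauPlus N μ = r ^ tauPlus N μ * (1 / 2) ^ tauPlus N μ := by
    rw [← Real.mul_rpow hr.le (by norm_num)]; ring_nf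
  have e2 : r ^ (2 - tauPlus N μ) * r ^ tauPlus N μ = r ^ 2 := by
    rw [← Real.rpow_add hr, sub_add_cancel, Real.rpow_two]
  have hp : 0 < r ^ tauPlus N μ := by positivity
  have hh : (0:ℝ) < (1 / 2) ^ tauPlus N μ := by positivity
  calc K / 2 / (D * (1 / 2) ^ tauPlus N μ) * r ^ (2 - tauPlus N μ)
      ≤ (D * (r ^ 2)⁻¹ * (r / 2) ^ tauPlus N μ * ∫ x in annulus N r, e x) /
          (D * (1 / 2) ^ tauPlus N μ) * r ^ (2 - tauPlus N μ) := by gcongr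
    _ = (r ^ (2 - tauPlus N μ) * r ^ tauPlus N μ) * (r ^ 2)⁻¹ * ∫ x in annulus N r, e x := by
        rw [e1]
        field_simp
    _ = _ := by
        rw [e2, mul_inv_cancel₀ (by positivity), one_mul]

end BelowInvSq

namespace BelowInvSq
variable {N : ℕ} {μ c : ℝ} {V : Euc N → ℝ}

theorem greenPot_le (h : BelowInvSq N μ c V) {e : Euc N → ℝ} (hs : IsSolution N μ V e)
    (he : ∀ x : Euc N, x ≠ 0 → 0 ≤ e x) {x : Euc N} (hx : x ≠ 0) :
    Integrable (fun y => μ * V y * e y * ‖x - y‖ ^ (2 - N : ℝ)) ∧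
      greenPot (fun y => μ * V y * e y) x ≤ e x := by
  have hμ := h.coupling_pos
  exact greenPot_le_of_supersolution (f := fun y => μ * V y * e y) h.dim
    (fun y hy => hs.contDiffAt hy) he
    (fun y hy => ((h.holder y hy).const_mul μ).mul
      ((hs.contDiffAt hy).of_le (by norm_num)).holderNear)
    (fun y hy => mul_nonneg (mul_nonneg hμ.le (h.pos y hy).le) (he y hy))
    (fun y hy => by have := hs.2 y hy; linarith) hx

/-- A nonnegative solution with positive mass at the origin dominates the singular profile. -/
theorem exists_singular_lower_bound (h : BelowInvSq N μ c V) {e : Euc N → ℝ}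
    (hs : IsSolution N μ V e) (he : ∀ x : Euc N, x ≠ 0 → 0 ≤ e x) {K : ℝ} (hK : 0 < K)
    (hid : ∀ ξ : Euc N → ℝ, IsC11c ξ → ξ 0 = 1 →
      ∫ x : Euc N, e x * LstarMuV N μ V ξ x * ‖x‖ ^ tauPlus N μ = K) :
    ∃ ε > 0, ∃ δ > 0, ∀ x : Euc N, x ≠ 0 → ‖x‖ < δ → ε * ‖x‖ ^ tauMinus N μ ≤ e x := by
  have hcont : ∀ x : Euc N, x ≠ 0 → ContinuousAt e x := fun x hx => (hs.contDiffAt hx).continuousAt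
  obtain ⟨b, hb, r₀, hr₀, hann⟩ := h.exists_annulus_lower_bound hcont he hK hid
  have hc := h.const_pos
  have hμ := h.coupling_pos
  have hκ := newtConst_pos h.dim
  have hN2 := h.two_lt
  have hm : AEStronglyMeasurable e volume :=
    aestronglyMeasurable_of_continuousAt (by have := h.dim; omega) hcont
  refine ⟨(newtConst N)⁻¹ * (μ * (1 / 2) * 2 ^ (2 - N : ℝ) * b), by positivity,
    min r₀ (√(2 * c))⁻¹, by positivity, fun x hx hxδ => ?_⟩
  set r := ‖x‖ with hr_def
  have hr : 0 < r := norm_pos_iff.mpr hx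
  have hrc : 2 * c * r ^ 2 ≤ 1 := by
    have h1 : r * √(2 * c) ≤ 1 := by
      have := (hxδ.trans_le (min_le_right _ _)).le
      rw [← one_div, le_div_iff₀ (by positivity)] at this
      exact this
    have h2 : √(2 * c) ^ 2 = 2 * c := Real.sq_sqrt (by positivity)
    rw [← h2, ← mul_pow]
    exact pow_le_one₀ (by positivity) (by rwa [mul_comm])
  obtain ⟨hi, hle⟩ := h.greenPot_le hs he hx
  have hma : MeasurableSet (annulus N r) := (isCompact_annulus r).measurableSet
  refine le_trans ?_ hle
  rw [greenPot, newtPot, mul_assoc]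
  refine mul_le_mul_of_nonneg_left ?_ (inv_nonneg.mpr hκ.le)
  have hnn : 0 ≤ᵐ[volume] fun y => μ * V y * e y * ‖x - y‖ ^ (2 - N : ℝ) := by
    filter_upwards [ae_ne_zero h.dim] with y hy
    have := (h.pos y hy).le
    have := he y hy
    simp only [Pi.zero_apply]
    positivity
  refine le_trans ?_ (setIntegral_le_integral hi hnn (s := annulus N r))
  have hlow : ∫ y in annulus N r, μ * (1 / 2 * (r ^ 2)⁻¹) * (2 * r) ^ (2 - N : ℝ) * e y ≤
      ∫ y in annulus N r, μ * V y * e y * ‖x - y‖ ^ (2 - N : ℝ) := by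
    refine setIntegral_mono_on_ae ((integrableOn_annulus hcont hr).const_mul _) hi.integrableOn hma ?_
    have hxne : ∀ᵐ y : Euc N, y ≠ x := by
      have := h.nonempty
      exact (measure_eq_zero_iff_ae_notMem.mp (measure_singleton x)).mono fun y hy => hy
    filter_upwards [hxne] with y hyx hy
    obtain ⟨hy1, hy2⟩ := mem_annulus.mp hy
    have hypos : 0 < ‖y‖ := by linarith
    have hy0 : y ≠ 0 := norm_pos_iff.mp hypos
    have hVy : 1 / 2 * (r ^ 2)⁻¹ ≤ V y := by
      have h1 := h.lower y hy0
      have h2 : (r ^ 2)⁻¹ ≤ ‖y‖ ^ (-2 : ℝ) := by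
        rw [Real.rpow_neg hypos.le, Real.rpow_two]
        gcongr
      have h3 : c ≤ 1 / 2 * (r ^ 2)⁻¹ := by
        rw [← div_eq_mul_inv, le_div_iff₀ (by positivity)]
        linarith
      linarith
    have hker : (2 * r) ^ (2 - N : ℝ) ≤ ‖x - y‖ ^ (2 - N : ℝ) := by
      refine Real.rpow_le_rpow_of_nonpos (norm_pos_iff.mpr (sub_ne_zero.mpr hyx.symm)) ?_
        (by linarith)
      calc ‖x - y‖ ≤ ‖x‖ + ‖y‖ := norm_sub_le _ _
        _ ≤ 2 * r := by linarith
    have hey := he y hy0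
    have hVy0 := h.pos y hy0
    calc _ = μ * (1 / 2 * (r ^ 2)⁻¹) * e y * (2 * r) ^ (2 - N : ℝ) := by ring
      _ ≤ _ := by gcongr
  refine le_trans ?_ hlow
  rw [integral_const_mul]
  have hA := hann r hr (hxδ.trans_le (min_le_left _ _))
  have e1 : r ^ tauMinus N μ = (r ^ 2)⁻¹ * r ^ (2 - N : ℝ) * r ^ (2 - tauPlus N μ) := by
    rw [← Real.rpow_two, ← Real.rpow_neg hr.le, ← Real.rpow_add hr, ← Real.rpow_add hr]
    congr 1
    have := tauPlus_add_tauMinus N μ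
    linarith
  rw [e1, Real.mul_rpow zero_le_two hr.le]
  calc _ = μ * (1 / 2 * (r ^ 2)⁻¹) * (2 ^ (2 - N : ℝ) * r ^ (2 - N : ℝ)) *
        (b * r ^ (2 - tauPlus N μ)) := by ring
    _ ≤ _ := by gcongr

/-- Comparison of a nonnegative solution with a multiple of the constructed one. -/
theorem mul_le_of_singular_lower_bound (h : BelowInvSq N μ c V) {u e : Euc N → ℝ} {k A : ℝ}
    (hk : 0 < k) (hus : Sandwich N μ k A u) (hu : IsSolution N μ V u)
    (hfix : ∀ x : Euc N, x ≠ 0 → u x = greenPot (fun y => μ * V y * u y) x)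
    (hs : IsSolution N μ V e) (he : ∀ x : Euc N, x ≠ 0 → 0 ≤ e x) {ε δ : ℝ} (hε : 0 < ε)
    (hδ : 0 < δ) (hlow : ∀ x : Euc N, x ≠ 0 → ‖x‖ < δ → ε * ‖x‖ ^ tauMinus N μ ≤ e x)
    {x : Euc N} (hx : x ≠ 0) : ε / k * u x ≤ e x := by
  have hμ := h.coupling_pos
  have hμp := h.lt_powConst_auxExp
  have hp : 0 < powConst N (auxExp N μ) := hμ.trans hμp
  have hm : AEStronglyMeasurable u volume :=
    aestronglyMeasurable_of_continuousAt (by have := h.dim; omega)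
      fun y hy => (hu.contDiffAt hy).continuousAt
  let B : ℝ := ε * δ ^ (tauMinus N μ - auxExp N μ)
  let ρ : ℝ := μ / powConst N (auxExp N μ)
  have hB : 0 < B := by positivity
  have hρ0 : 0 < ρ := by positivity
  have hρ1 : ρ < 1 := (div_lt_one hp).mpr hμp
  have hup : ∀ y : Euc N, y ≠ 0 → ε / k * u y ≤ ε * ‖y‖ ^ tauMinus N μ := fun y hy => by
    calc ε / k * u y ≤ ε / k * (k * ‖y‖ ^ tauMinus N μ) := by
          gcongr
          exact (hus y hy).2.1
      _ = _ := by field_simp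
  have hbound : ∀ n : ℕ, ∀ y : Euc N, y ≠ 0 →
      ε / k * u y - e y ≤ B * ρ ^ n * ‖y‖ ^ auxExp N μ := by
    intro n
    induction n with
    | zero =>
      intro y hy
      have hypos : 0 < ‖y‖ := norm_pos_iff.mpr hy
      have h1 := hup y hy
      rw [pow_zero, mul_one]
      by_cases hyδ : ‖y‖ < δ
      · have h2 := hlow y hy hyδ
        have : 0 ≤ B * ‖y‖ ^ auxExp N μ := by positivity
        linarith
      · have h2 : ‖y‖ ^ (tauMinus N μ - auxExp N μ) ≤ δ ^ (tauMinus N μ - auxExp N μ) :=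
          Real.rpow_le_rpow_of_nonpos hδ (not_lt.mp hyδ) (by linarith [h.tauMinus_lt_auxExp])
        have h3 : ε * ‖y‖ ^ tauMinus N μ ≤ B * ‖y‖ ^ auxExp N μ := by
          calc ε * ‖y‖ ^ tauMinus N μ
              = ε * ‖y‖ ^ (tauMinus N μ - auxExp N μ) * ‖y‖ ^ auxExp N μ := by
                rw [mul_assoc, ← Real.rpow_add hypos, sub_add_cancel]
            _ ≤ _ := mul_le_mul_of_nonneg_right (mul_le_mul_of_nonneg_left h2 hε.le) (by positivity)
        have := he y hy
        linarith
    | succ n ih =>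
      intro y hy
      obtain ⟨i1, h1⟩ := h.greenPot_le hs he hy
      have i2 := h.integrable_source h.tauMinus_gt h.tauMinus_neg hm hus.abs_le hy
      have i3 : Integrable fun z => ε / k * (μ * V z * u z) * ‖y - z‖ ^ (2 - N : ℝ) := by
        simp only [mul_assoc] at i2 ⊢
        exact (i2.const_mul k⁻¹ |>.const_mul ε).congr (Eventually.of_forall fun z => by ring)
      have i4 := h.integrable_rpow h.auxExp_gt h.auxExp_neg (μ * (B * ρ ^ n)) hy
      have i5 : Integrable fun z =>
          (ε / k * (μ * V z * u z) - μ * V z * e z) * ‖y - z‖ ^ (2 - N : ℝ) := by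
        simp only [sub_mul]
        exact i3.sub i1
      have h2 : ε / k * u y = greenPot (fun z => ε / k * (μ * V z * u z)) y := by
        rw [greenPot_const_mul, ← hfix y hy]
      have h3 : ε / k * u y - e y ≤
          greenPot (fun z => ε / k * (μ * V z * u z) - μ * V z * e z) y := by
        rw [greenPot_sub i3 i1, ← h2]
        linarith
      have h4 := greenPot_mono h.dim i5 i4 fun z hz => by
        have hzpos : 0 < ‖z‖ := norm_pos_iff.mpr hz
        have hVz := h.pos z hz
        have hVu := h.upper z hz
        have e1 : ‖z‖ ^ (auxExp N μ - 2) = ‖z‖ ^ (-2 : ℝ) * ‖z‖ ^ auxExp N μ := by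
          rw [← Real.rpow_add hzpos]; ring_nf
        calc ε / k * (μ * V z * u z) - μ * V z * e z = μ * V z * (ε / k * u z - e z) := by ring
          _ ≤ μ * V z * (B * ρ ^ n * ‖z‖ ^ auxExp N μ) := by
              gcongr
              exact ih z hz
          _ ≤ μ * ‖z‖ ^ (-2 : ℝ) * (B * ρ ^ n * ‖z‖ ^ auxExp N μ) := by gcongr
          _ = _ := by rw [e1]; ring
      have e2 : μ * (B * ρ ^ n) = B * ρ ^ (n + 1) * powConst N (auxExp N μ) := by
        have : ρ * powConst N (auxExp N μ) = μ := div_mul_cancel₀ _ hp.ne'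
        rw [pow_succ]
        linear_combination -(B * ρ ^ n) * this
      rw [e2, greenPot_rpow_eq h.dim h.auxExp_gt h.auxExp_neg _ hy] at h4
      exact h3.trans h4
  have hlim : Tendsto (fun n : ℕ => B * ρ ^ n * ‖x‖ ^ auxExp N μ) atTop (nhds 0) := by
    have := ((tendsto_pow_atTop_nhds_zero_of_lt_one hρ0.le hρ1).const_mul B).mul_const
      (‖x‖ ^ auxExp N μ)
    simpa using this
  exact sub_nonpos.mp (ge_of_tendsto' hlim fun n => hbound n x hx)

theorem _root_.IsSolution.sub_const_mul {u v : Euc N → ℝ} (hv : IsSolution N μ V v)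
    (hu : IsSolution N μ V u) (a : ℝ) : IsSolution N μ V fun x => v x - a * u x := by
  refine ⟨hv.1.sub (contDiffOn_const.mul hu.1), fun x hx => ?_⟩
  have tu := (hu.contDiffAt hx).twiceDiffAt
  have tau : TwiceDiffAt (fun x => -a * u x) x :=
    (contDiffAt_const.mul (hu.contDiffAt hx)).twiceDiffAt
  have e : (fun x => v x - a * u x) = fun x => v x + -a * u x := by
    funext x; ring
  rw [e, lap_add (hv.contDiffAt hx).twiceDiffAt tau, lap_const_mul tu]
  have h1 := hv.2 x hx
  have h2 := hu.2 x hx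
  linear_combination h1 - a * h2

theorem le_of_distribIdentity (h : BelowInvSq N μ c V) {u v : Euc N → ℝ} {k A : ℝ}
    (hk : 0 < k) (hus : Sandwich N μ k A u) (hupos : ∀ x : Euc N, x ≠ 0 → 0 < u x)
    (hu : IsSolution N μ V u)
    (hfix : ∀ x : Euc N, x ≠ 0 → u x = greenPot (fun y => μ * V y * u y) x)
    (hvpos : ∀ x : Euc N, x ≠ 0 → 0 < v x) (hv : IsSolution N μ V v)
    (hvid : DistribIdentity N μ V v k) {x : Euc N} (hx : x ≠ 0) : u x ≤ v x := by
  have hcM : 0 < cMu N μ := by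
    have := h.nonempty
    have hs := h.sqrt_pos
    have hN : (0:ℝ) < N := by linarith [h.two_lt]
    rw [cMu, if_pos h.coupling_lt, sphereArea]
    have : 0 < (volume (ball (0 : Euc N) 1)).toReal :=
      ENNReal.toReal_pos (measure_ball_pos _ _ one_pos).ne' measure_ball_lt_top.ne
    positivity
  have hm : AEStronglyMeasurable u volume :=
    aestronglyMeasurable_of_continuousAt (by have := h.dim; omega)
      fun y hy => (hu.contDiffAt hy).continuousAt
  have huid := h.distribIdentity hk.le hus hu
  let S : Set ℝ := {a | 0 ≤ a ∧ a ≤ 1 ∧ ∀ y : Euc N, y ≠ 0 → a * u y ≤ v y}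
  have h0S : (0:ℝ) ∈ S := ⟨le_rfl, zero_le_one, fun y hy => by rw [zero_mul]; exact (hvpos y hy).le⟩
  have hbdd : BddAbove S := ⟨1, fun a ha => ha.2.1⟩
  have hclosed : IsClosed S := by
    have : S = Set.Icc 0 1 ∩ ⋂ y : Euc N, ⋂ _ : y ≠ 0, {a | a * u y ≤ v y} := by
      ext a
      simp [S, and_assoc]
    rw [this]
    exact isClosed_Icc.inter (isClosed_iInter fun y => isClosed_iInter fun _ =>
      isClosed_le (by fun_prop) continuous_const)
  have hmem : sSup S ∈ S := hclosed.csSup_mem ⟨0, h0S⟩ hbdd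
  set a := sSup S with ha_def
  obtain ⟨ha0, ha1, hav⟩ := hmem
  have hone : a = 1 := by
    by_contra hne
    have hlt : a < 1 := lt_of_le_of_ne ha1 hne
    have he : ∀ y : Euc N, y ≠ 0 → 0 ≤ v y - a * u y := fun y hy => sub_nonneg.mpr (hav y hy)
    have hes := hv.sub_const_mul hu a
    have hK : 0 < cMu N μ * k * (1 - a) := by
      have := sub_pos.mpr hlt
      positivity
    obtain ⟨ε, hε, δ, hδ, hlow⟩ := h.exists_singular_lower_bound hes he hK fun ξ hξ hξ0 => by
      have iu := h.integrable_test hk.le hm hus.abs_le hξ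
      have ev := hvid ξ hξ
      have eu := huid ξ hξ
      rw [hξ0, mul_one] at ev eu
      have iv : Integrable fun x : Euc N => v x * LstarMuV N μ V ξ x * ‖x‖ ^ tauPlus N μ := by
        by_contra hn
        rw [integral_undef hn] at ev
        exact (by positivity : 0 < cMu N μ * k).ne ev
      calc ∫ x : Euc N, (v x - a * u x) * LstarMuV N μ V ξ x * ‖x‖ ^ tauPlus N μ
          = ∫ x : Euc N, (v x * LstarMuV N μ V ξ x * ‖x‖ ^ tauPlus N μ -
              a * (u x * LstarMuV N μ V ξ x * ‖x‖ ^ tauPlus N μ)) := by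
            refine integral_congr_ae (Eventually.of_forall fun x => ?_)
            ring
        _ = _ := by
            rw [integral_sub iv (iu.const_mul a), integral_const_mul, ev, eu]
            ring
    have hge := fun {y : Euc N} (hy : y ≠ 0) =>
      h.mul_le_of_singular_lower_bound hk hus hu hfix hes he hε hδ hlow hy
    have hstep : a + min (ε / k) (1 - a) ∈ S := by
      have hmin : 0 ≤ min (ε / k) (1 - a) := le_min (by positivity) (by linarith)
      refine ⟨by linarith, by linarith [min_le_right (ε / k) (1 - a)], fun y hy => ?_⟩
      have h1 := hge hy
      have h2 : min (ε / k) (1 - a) * u y ≤ ε / k * u y :=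
        mul_le_mul_of_nonneg_right (min_le_left _ _) (hupos y hy).le
      rw [add_mul]
      linarith
    have hle := le_csSup hbdd hstep
    have hmin : 0 < min (ε / k) (1 - a) := lt_min (by positivity) (by linarith)
    linarith
  have := hav x hx
  rwa [hone, one_mul] at this

end BelowInvSq

/-- Theorem 4.1, existence part: minimal positive fundamental solutions when
|x|⁻² - c₅ ≤ V ≤ |x|⁻². -/
theorem existence_minimal_solution_below_inverse_square
    (N : ℕ) (hN : 3 ≤ N) (μ : ℝ) (hμ : 0 < μ) (hμ0 : μ < mu0 N)
    (γ : ℝ) (hγ : 0 < γ ∧ γ < 1) (V : Euc N → ℝ)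
    (hVreg : LocHolderOn γ {x : Euc N | x ≠ 0} V)
    (hVpos : ∀ x : Euc N, x ≠ 0 → 0 < V x)
    (c₅ : ℝ) (hc₅ : 0 < c₅)
    (hV : ∀ x : Euc N, x ≠ 0 → ‖x‖ ^ (-2 : ℝ) - c₅ ≤ V x ∧ V x ≤ ‖x‖ ^ (-2 : ℝ))
    (k : ℝ) (hk : 0 < k) :
    ∃ u : Euc N → ℝ,
      (∀ x : Euc N, x ≠ 0 → 0 < u x) ∧
      IsSolution N μ V u ∧
      DistribIdentity N μ V u k ∧
      (∀ v : Euc N → ℝ, (∀ x : Euc N, x ≠ 0 → 0 < v x) → IsSolution N μ V v →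
        DistribIdentity N μ V v k → ∀ x : Euc N, x ≠ 0 → u x ≤ v x) ∧
      Tendsto (fun x : Euc N => u x * ‖x‖ ^ (-(tauMinus N μ)))
        (nhdsWithin (0 : Euc N) {x : Euc N | x ≠ 0}) (nhds k) := by
  have h : BelowInvSq N μ c₅ V :=
    ⟨hN, hμ, hμ0, hc₅, fun x hx => hVreg.holderNear hγ.1 hx, hVpos,
      fun x hx => (hV x hx).1, fun x hx => (hV x hx).2⟩
  obtain ⟨u, A, -, hs, hpos, hu, hfix⟩ := h.exists_solution hk
  exact ⟨u, hpos, hu, h.distribIdentity hk.le hs hu, fun v hv1 hv2 hv3 x hx =>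
    h.le_of_distribIdentity hk hs hpos hu hfix hv1 hv2 hv3 hx, BelowInvSq.Sandwich.tendsto h hs⟩
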